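/- arXiv:1206.3419 — 10 statements merged into one kernel-verified Lean document; each statement's English description precedes it below -/
import Mathlib

section
/- Let R be an associative unital algebra over ℚ and let f, g be invertible elements of R satisfying the Serre relations of the rank-2 generalized Cartan matrix with a_{12} = a_{21} = −1, namely f²g − 2fgf + gf² = 0 and g²f − 2gfg + fg² = 0. Then for all integers m, n one has the Verma identity f^m g^{m+n} f^n = g^n f^{m+n} g^m. -/
/-- An element commuting with every conjugate `g ^ (-k) * (f * g) * g ^ k` commutes with every
product `f ^ m * g ^ m`, provided the conjugates of `f * g` by powers of `f` are the same. -/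
theorem commute_zpow_mul_zpow_of_commute_conj {G : Type*} [Group G] {f g x : G}
    (hfg : ∀ k : ℤ, f ^ k * (f * g) * f ^ (-k) = g ^ (-k) * (f * g) * g ^ k)
    (hx : ∀ k : ℤ, Commute x (g ^ (-k) * (f * g) * g ^ k)) (m : ℤ) :
    Commute x (f ^ m * g ^ m) := by
  have step (k : ℤ) : f ^ (k + 1) * g ^ (k + 1) =
      (g ^ (-k) * (f * g) * g ^ k) * (f ^ k * g ^ k) := by
    rw [← hfg]; group
  induction m using Int.induction_on with
  | zero => simp
  | succ k ih => rw [step]; exact (hx k).mul_right ih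
  | pred k ih =>
    have h := step (-(k : ℤ) - 1)
    rw [sub_add_cancel] at h
    rw [← inv_mul_eq_iff_eq_mul.mpr h]
    exact (hx _).inv_right.mul_right ih

/-- The Verma identity in a group: it holds as soon as conjugating `f * g` by powers of `f` and of
`g⁻¹` gives one and the same commuting family. -/
theorem zpow_mul_zpow_add_mul_zpow_of_conj {G : Type*} [Group G] {f g : G}
    (hfg : ∀ k : ℤ, f ^ k * (f * g) * f ^ (-k) = g ^ (-k) * (f * g) * g ^ k)
    (hcomm : ∀ j k : ℤ, Commute (g ^ (-j) * (f * g) * g ^ j) (g ^ (-k) * (f * g) * g ^ k))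
    (m n : ℤ) : f ^ m * g ^ (m + n) * f ^ n = g ^ n * f ^ (m + n) * g ^ m := by
  have hgf (k : ℤ) : f ^ (-k) * (g * f) * f ^ k =
      g ^ (-(-k - 1)) * (f * g) * g ^ (-k - 1) := by
    rw [← hfg]; group
  have hgf' (k : ℤ) : g ^ k * (g * f) * g ^ (-k) =
      g ^ (-(-k - 1)) * (f * g) * g ^ (-k - 1) := by
    group
  have hQ (j : ℤ) : Commute (g ^ (-j) * (f * g) * g ^ j) (g ^ n * f ^ n) := by
    refine commute_zpow_mul_zpow_of_commute_conj (fun k => (hgf' k).trans (hgf k).symm) ?_ n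
    intro k
    rw [hgf]
    exact hcomm _ _
  have h := commute_zpow_mul_zpow_of_commute_conj hfg (fun j => (hQ j).symm) m
  calc f ^ m * g ^ (m + n) * f ^ n = (f ^ m * g ^ m) * (g ^ n * f ^ n) := by
        rw [zpow_add]; group
    _ = (g ^ n * f ^ n) * (f ^ m * g ^ m) := h.eq.symm
    _ = g ^ n * f ^ (m + n) * g ^ m := by
        rw [add_comm m n, zpow_add]; group

/-- If conjugation by a unit `u` adds `h` to `a`, where `u` commutes with `h`, then conjugation by
`u ^ k` adds `k * h`. -/
theorem Units.zpow_conj_eq_add_intCast_mul {R : Type*} [Ring R] {u a : Rˣ} {h : R}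
    (hu : Commute (u : R) h) (ha : (u : R) * a = (a + h) * u) (k : ℤ) :
    ((u ^ k * a * u ^ (-k) : Rˣ) : R) = a + k * h := by
  have hshift (c : ℤ) : (u : R) * (a + c * h) = (a + (c + 1 : ℤ) * h) * u := by
    have hc := (Int.cast_commute c (u : R)).eq
    rw [mul_add, ha, ← mul_assoc, ← hc, mul_assoc, hu.eq]
    push_cast
    noncomm_ring
  induction k using Int.induction_on with
  | zero => simp
  | succ k ih =>
    have e : u ^ ((k : ℤ) + 1) * a * u ^ (-((k : ℤ) + 1)) =
        u * (u ^ (k : ℤ) * a * u ^ (-(k : ℤ))) * u⁻¹ := by group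
    rw [e, Units.val_mul, Units.val_mul, ih, Units.mul_inv_eq_iff_eq_mul, hshift]
  | pred k ih =>
    have e : u ^ (-(k : ℤ) - 1) * a * u ^ (-(-(k : ℤ) - 1)) =
        u⁻¹ * (u ^ (-(k : ℤ)) * a * u ^ (-(-(k : ℤ)))) * u := by group
    rw [e, Units.val_mul, Units.val_mul, ih, mul_assoc, Units.inv_mul_eq_iff_eq_mul, hshift,
      sub_add_cancel]

/-- Verma identity for the rank-2 GCM with `a₁₂ = a₂₁ = -1`. -/
theorem verma_identity_A2 (R : Type*) [Ring R] [Algebra ℚ R] (f g : Rˣ)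
    (hf : (f : R) ^ 2 * (g : R) - 2 * ((f : R) * (g : R) * (f : R)) + (g : R) * (f : R) ^ 2 = 0)
    (hg : (g : R) ^ 2 * (f : R) - 2 * ((g : R) * (f : R) * (g : R)) + (f : R) * (g : R) ^ 2 = 0)
    (m n : ℤ) :
    f ^ m * g ^ (m + n) * f ^ n = g ^ n * f ^ (m + n) * g ^ m := by
  set h : R := f * g - g * f with hh
  have hfh : Commute (f : R) h := by
    rw [commute_iff_eq, ← sub_eq_zero, ← hf, hh]
    noncomm_ring
  have hgh : Commute (g : R) h := by
    rw [commute_iff_eq, ← sub_eq_zero, ← neg_eq_zero, ← hg, hh]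
    noncomm_ring
  have hF (k : ℤ) : ((f ^ k * (f * g) * f ^ (-k) : Rˣ) : R) = (f * g : Rˣ) + k * h := by
    refine Units.zpow_conj_eq_add_intCast_mul hfh ?_ k
    rw [add_mul, ← hfh.eq, hh, Units.val_mul]
    noncomm_ring
  have hG (k : ℤ) : ((g ^ (-k) * (f * g) * g ^ k : Rˣ) : R) = (f * g : Rˣ) + k * h := by
    have key := Units.zpow_conj_eq_add_intCast_mul (a := f * g) hgh.neg_right (by
      rw [add_mul, neg_mul, ← hgh.eq, hgh.eq, hh, Units.val_mul]
      noncomm_ring) (-k)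
    simpa using key
  have hah : Commute ((f * g : Rˣ) : R) h := by
    rw [Units.val_mul]; exact hfh.mul_left hgh
  refine zpow_mul_zpow_add_mul_zpow_of_conj (fun k => Units.ext ((hF k).trans (hG k).symm))
    (fun j k => ?_) m n
  rw [← Commute.units_val_iff, hG, hG]
  have hc (c : ℤ) {x : R} : Commute (c : R) x := Int.cast_commute c x
  exact ((Commute.refl _).add_right ((hc k).symm.mul_right hah)).add_left
    ((hc j).mul_left (hah.symm.add_right ((hc k).symm.mul_right (Commute.refl h))))
end

section
/- Let R be an associative unital algebra over ℚ and let f, g be invertible elements of R satisfying the Serre relations of the rank-2 generalized Cartan matrix with a_{12} = −1, a_{21} = −2, namely f²g − 2fgf + gf² = 0 and g³f − 3g²fg + 3gfg² − fg³ = 0. Then for all integers m, n one has the Verma identity f^m g^{2m+n} f^{m+n} g^n = g^n f^{m+n} g^{2m+n} f^m. -/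
section Verma

/-- The relations of the positive part of type `B₂`, with `h = [f, g]` and central `k = [g, h]`. -/
structure IsB2Quadruple {R : Type*} [Ring R] (f g h k : R) : Prop where
  fg : f * g = g * f + h
  hg : h * g = g * h - k
  fh : f * h = h * f
  kg : k * g = g * k
  fk : f * k = k * f
  kh : k * h = h * k

/-- The element `f ^ (a + s) * g ^ (2 * a + s) * f ^ a`; for fixed `s` these commute. -/
def vermaWord {R : Type*} [Monoid R] (f g : R) (s a : ℕ) : R :=
  f ^ (a + s) * g ^ (2 * a + s) * f ^ a

theorem IsB2Quadruple.of_serre {R : Type*} [Ring R] {f g : R}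
    (hf : f ^ 2 * g - 2 * (f * g * f) + g * f ^ 2 = 0)
    (hg : g ^ 3 * f - 3 * (g ^ 2 * f * g) + 3 * (g * f * g ^ 2) - f * g ^ 3 = 0) :
    IsB2Quadruple f g (f * g - g * f) (g * (f * g - g * f) - (f * g - g * f) * g) := by
  have fh : f * (f * g - g * f) = (f * g - g * f) * f := by
    rw [← sub_eq_zero, ← hf]; noncomm_ring
  have kg : (g * (f * g - g * f) - (f * g - g * f) * g) * g
      = g * (g * (f * g - g * f) - (f * g - g * f) * g) := by
    rw [← sub_eq_zero, ← neg_eq_zero, ← neg_eq_zero, ← hg]; noncomm_ring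
  have fg : f * g = g * f + (f * g - g * f) := by abel
  generalize f * g - g * f = h at *
  have fk : f * (g * h - h * g) = (g * h - h * g) * f := by
    simp only [mul_sub, sub_mul, ← mul_assoc, fg, fh]
    simp only [add_mul, mul_assoc, fg, fh, mul_add]
    abel
  have kh : (g * h - h * g) * h = h * (g * h - h * g) := by
    have e : h = f * g - g * f := by rw [fg]; abel
    generalize g * h - h * g = k at *
    have cf : Commute k f := fk.symm
    have cg : Commute k g := kg
    rw [e]
    exact ((cf.mul_right cg).sub_right (cg.mul_right cf)).eq
  exact ⟨fg, by abel, fh, kg, fk, kh⟩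

namespace IsB2Quadruple

variable {R : Type*} [Ring R] {f g h k : R}

theorem pow_mul_mul (H : IsB2Quadruple f g h k) (b : ℕ) :
    f ^ b * (g * f) = (g * f + (b : ℤ) • h) * f ^ b := by
  induction b with
  | zero => simp
  | succ b ih =>
    have e : f * (g * f + (b : ℤ) • h) = (g * f + ((b + 1 : ℕ) : ℤ) • h) * f := by
      simp only [mul_add, add_mul, mul_smul_comm, smul_mul_assoc, H.fh, ← mul_assoc, H.fg]
      push_cast
      module
    rw [pow_succ', mul_assoc, ih, ← mul_assoc, e, mul_assoc]

theorem pow_succ_mul (H : IsB2Quadruple f g h k) (b : ℕ) :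
    f ^ (b + 1) * g = (g * f + ((b : ℤ) + 1) • h) * f ^ b := by
  have e : f ^ b * h = h * f ^ b := (Commute.pow_left (show Commute f h from H.fh) b).eq
  rw [pow_succ, mul_assoc, H.fg, mul_add, H.pow_mul_mul, e, add_smul, one_smul, ← add_assoc,
    ← add_mul]

theorem mul_pow_add_two (H : IsB2Quadruple f g h k) (n : ℕ) :
    f * g ^ (n + 2) = g ^ n * (g * (g * f) + ((n : ℤ) + 2) • (g * h)
      - ((n + 2).choose 2 : ℤ) • k) := by
  induction n with
  | zero =>
    simp only [pow_two, ← mul_assoc, H.fg, zero_add, add_mul, H.hg]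
    simp only [mul_assoc, H.fg, mul_add, pow_zero, one_mul, Nat.cast_zero,
      zero_add, Nat.choose_self, Nat.cast_one]
    module
  | succ n ih =>
    have e : (g * (g * f) + ((n : ℤ) + 2) • (g * h) - ((n + 2).choose 2 : ℤ) • k) * g
        = g * (g * (g * f) + (((n + 1 : ℕ) : ℤ) + 2) • (g * h)
          - ((n + 1 + 2).choose 2 : ℤ) • k) := by
      have c : (n + 1 + 2).choose 2 = (n + 2) + (n + 2).choose 2 := by
        rw [show n + 1 + 2 = (n + 2) + 1 by ring, Nat.choose_succ_succ' (n + 2) 1,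
          Nat.choose_one_right]
      simp only [mul_add, add_mul, mul_sub, sub_mul, mul_smul_comm, smul_mul_assoc, mul_assoc,
        H.fg, H.hg, H.kg, c]
      push_cast
      module
    rw [show n + 1 + 2 = (n + 2) + 1 by ring, pow_succ, ← mul_assoc, ih, mul_assoc, e,
      ← mul_assoc, ← pow_succ]

theorem mul_pow_mul (H : IsB2Quadruple f g h k) (n : ℕ) :
    f * g ^ (n + 2) * f = g ^ n * (g * (g * (f * f)) + ((n : ℤ) + 2) • (g * (h * f))
      - ((n + 2).choose 2 : ℤ) • (k * f)) := by
  rw [H.mul_pow_add_two]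
  simp only [mul_assoc, add_mul, sub_mul, smul_mul_assoc]

/-- The quadratic Casimir-type element is central. -/
theorem commute_casimir_left (H : IsB2Quadruple f g h k) :
    Commute f (h * h + (2 : ℤ) • (k * f)) := by
  have e1 : f * (h * h) = h * h * f := by rw [← mul_assoc, H.fh, mul_assoc, H.fh, mul_assoc]
  have e2 : f * (k * f) = k * f * f := by rw [← mul_assoc, H.fk]
  simp only [Commute, SemiconjBy, mul_add, add_mul, mul_smul_comm, smul_mul_assoc, e1, e2]

theorem commute_casimir_right (H : IsB2Quadruple f g h k) :
    Commute g (h * h + (2 : ℤ) • (k * f)) := by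
  have hg' (x : R) : h * (g * x) = g * (h * x) - k * x := by rw [← mul_assoc, H.hg]; noncomm_ring
  have kg' (x : R) : k * (g * x) = g * (k * x) := by rw [← mul_assoc, H.kg, mul_assoc]
  simp only [Commute, SemiconjBy, mul_add, add_mul, mul_smul_comm, smul_mul_assoc, mul_assoc,
    H.fg, H.hg, hg', kg', mul_sub, H.kh]
  module

theorem vermaWord_zero_succ (H : IsB2Quadruple f g h k) (a : ℕ) :
    vermaWord f g 0 (a + 1) = vermaWord f g 0 a * (vermaWord f g 0 1
      - ((a : ℤ) * (a + 1)) • (h * h + (2 : ℤ) • (k * f))) := by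
  set z := h * h + (2 : ℤ) • (k * f) with hz
  have hfz : f ^ a * z = z * f ^ a := (H.commute_casimir_left.pow_left a).eq
  have e1 : f ^ a * vermaWord f g 0 1
      = (g * f + ((a : ℤ) + 1) • h) * (g * f + (a : ℤ) • h) * f ^ a := by
    rw [mul_assoc, ← H.pow_mul_mul, ← mul_assoc, ← H.pow_succ_mul]
    simp [vermaWord, pow_succ, mul_assoc]
  have c : (((2 * a + 2).choose 2 : ℕ) : ℤ) = (a + 1) * (2 * a + 1) := by
    have : (2 * a + 2).choose 2 = (a + 1) * (2 * a + 1) := by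
      rw [Nat.choose_two_right, show (2 * a + 2) * (2 * a + 2 - 1) = 2 * ((a + 1) * (2 * a + 1)) by
        rw [show 2 * a + 2 - 1 = 2 * a + 1 by lia]; ring]
      simp
    exact_mod_cast this
  have e2 : f * g ^ (2 * a + 2) * f = g ^ (2 * a)
      * ((g * f + ((a : ℤ) + 1) • h) * (g * f + (a : ℤ) • h) - ((a : ℤ) * (a + 1)) • z) := by
    have hg' (x : R) : h * (g * x) = g * (h * x) - k * x := by
      rw [← mul_assoc, H.hg]; noncomm_ring
    rw [H.mul_pow_mul, c, hz]
    congr 1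
    have fg' (x : R) : f * (g * x) = g * (f * x) + h * x := by
      rw [← mul_assoc, H.fg]; noncomm_ring
    simp only [mul_add, add_mul, mul_smul_comm, smul_mul_assoc, mul_assoc, fg', hg', H.fh]
    push_cast
    module
  calc vermaWord f g 0 (a + 1) = f ^ a * (f * g ^ (2 * a + 2) * f) * f ^ a := by
        rw [vermaWord, add_zero, add_zero, mul_add_one]
        nth_rw 1 [pow_succ]
        rw [pow_succ' f a]
        simp only [mul_assoc]
    _ = _ := by
        rw [e2, vermaWord, add_zero, add_zero]
        simp only [mul_assoc, mul_sub, sub_mul, e1, mul_smul_comm, smul_mul_assoc, hfz]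

theorem vermaWord_one_succ (H : IsB2Quadruple f g h k) (a : ℕ) :
    vermaWord f g 1 (a + 1) = vermaWord f g 1 a * (vermaWord f g 1 0 * vermaWord f g 1 0
      - ((a + 1 : ℤ) * (a + 1)) • (h * h + (2 : ℤ) • (k * f))) := by
  set z := h * h + (2 : ℤ) • (k * f) with hz
  have hfz : f ^ a * z = z * f ^ a := (H.commute_casimir_left.pow_left a).eq
  have e1 : f ^ a * (vermaWord f g 1 0 * vermaWord f g 1 0)
      = (g * f + ((a : ℤ) + 1) • h) * (g * f + ((a : ℤ) + 1) • h) * f ^ a := by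
    have : f ^ a * (vermaWord f g 1 0 * vermaWord f g 1 0) = f ^ (a + 1) * g * f * g := by
      simp [vermaWord, pow_succ, mul_assoc]
    rw [this, H.pow_succ_mul, mul_assoc _ _ f, ← pow_succ, mul_assoc, H.pow_succ_mul, mul_assoc]
  have c : (((2 * a + 1 + 2).choose 2 : ℕ) : ℤ) = (a + 1) * (2 * a + 3) := by
    have : (2 * a + 1 + 2).choose 2 = (a + 1) * (2 * a + 3) := by
      rw [Nat.choose_two_right,
        show (2 * a + 1 + 2) * (2 * a + 1 + 2 - 1) = 2 * ((a + 1) * (2 * a + 3)) by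
          rw [show 2 * a + 1 + 2 - 1 = 2 * a + 2 by lia]; ring]
      simp
    exact_mod_cast this
  have e2 : f * g ^ (2 * a + 1 + 2) * f = g ^ (2 * a + 1)
      * ((g * f + ((a : ℤ) + 1) • h) * (g * f + ((a : ℤ) + 1) • h)
        - ((a + 1 : ℤ) * (a + 1)) • z) := by
    have hg' (x : R) : h * (g * x) = g * (h * x) - k * x := by
      rw [← mul_assoc, H.hg]; noncomm_ring
    rw [H.mul_pow_mul, c, hz]
    congr 1
    have fg' (x : R) : f * (g * x) = g * (f * x) + h * x := by
      rw [← mul_assoc, H.fg]; noncomm_ring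
    simp only [mul_add, add_mul, mul_smul_comm, smul_mul_assoc, mul_assoc, fg', hg', H.fh]
    push_cast
    module
  calc vermaWord f g 1 (a + 1) = f ^ (a + 1) * (f * g ^ (2 * a + 1 + 2) * f) * f ^ a := by
        rw [vermaWord, pow_succ, show 2 * (a + 1) + 1 = 2 * a + 1 + 2 by ring, pow_succ' f a]
        simp only [mul_assoc]
    _ = _ := by
        rw [e2, vermaWord]
        simp only [mul_assoc, mul_sub, sub_mul, e1, mul_smul_comm, smul_mul_assoc, hfz]

theorem commute_vermaWord_casimir (H : IsB2Quadruple f g h k) (s a : ℕ) :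
    Commute (vermaWord f g s a) (h * h + (2 : ℤ) • (k * f)) :=
  ((H.commute_casimir_left.pow_left _).mul_left (H.commute_casimir_right.pow_left _)).mul_left
    (H.commute_casimir_left.pow_left _)

theorem commute_vermaWord_zero (H : IsB2Quadruple f g h k) (a b : ℕ) :
    Commute (vermaWord f g 0 a) (vermaWord f g 0 b) := by
  have key (y : R) (hX : Commute y (vermaWord f g 0 1))
      (hz : Commute y (h * h + (2 : ℤ) • (k * f))) (a : ℕ) : Commute y (vermaWord f g 0 a) := by
    induction a with
    | zero => simp [vermaWord]
    | succ a ih =>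
      rw [H.vermaWord_zero_succ]
      exact ih.mul_right (hX.sub_right (hz.smul_right _))
  exact key _ (key _ (Commute.refl _) (H.commute_vermaWord_casimir 0 1) a).symm
    (H.commute_vermaWord_casimir 0 a) b

theorem commute_vermaWord_one (H : IsB2Quadruple f g h k) (a b : ℕ) :
    Commute (vermaWord f g 1 a) (vermaWord f g 1 b) := by
  have key (y : R) (hX : Commute y (vermaWord f g 1 0))
      (hz : Commute y (h * h + (2 : ℤ) • (k * f))) (a : ℕ) : Commute y (vermaWord f g 1 a) := by
    induction a with
    | zero => exact hX
    | succ a ih =>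
      rw [H.vermaWord_one_succ]
      exact ih.mul_right ((hX.mul_right hX).sub_right (hz.smul_right _))
  exact key _ (key _ (Commute.refl _) (H.commute_vermaWord_casimir 1 0) a).symm
    (H.commute_vermaWord_casimir 1 a) b

end IsB2Quadruple

/-- In a group, commutation of the words `vermaWord f g s a` for natural exponents implies the
Verma identity for all integer exponents of the corresponding parity. -/
theorem verma_identity_of_commute {G : Type*} [Group G] {f g : G} {s : ℕ} (hs : s ≤ 1)
    (H : ∀ a b : ℕ, Commute (vermaWord f g s a) (vermaWord f g s b)) (m l : ℤ) :
    f ^ m * g ^ (2 * m + (2 * l + s)) * f ^ (m + (2 * l + s)) * g ^ (2 * l + s)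
      = g ^ (2 * l + s) * f ^ (m + (2 * l + s)) * g ^ (2 * m + (2 * l + s)) * f ^ m := by
  let W : ℤ → G := fun a => f ^ (a + s) * g ^ (2 * a + s) * f ^ a
  have hW (a : ℤ) : ∃ b : ℕ, W a = vermaWord f g s b ∨ W a = (vermaWord f g s b)⁻¹ := by
    have hnat (b : ℕ) : vermaWord f g s b = W b := by
      simp only [vermaWord, W]
      norm_cast
    rcases le_or_gt 0 a with ha | ha
    · lift a to ℕ using ha
      exact ⟨a, Or.inl (hnat a).symm⟩
    · obtain ⟨b, hb⟩ := Int.eq_ofNat_of_zero_le (show 0 ≤ -a - s by lia)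
      refine ⟨b, Or.inr ?_⟩
      rw [hnat, ← hb]
      simp only [W, mul_inv_rev, ← zpow_neg, mul_assoc]
      rw [show -(-a - (s : ℤ)) = a + s by ring, show -(2 * (-a - (s : ℤ)) + s) = 2 * a + s by ring,
        show -(-a - (s : ℤ) + s) = a by ring]
  have hcomm (a b : ℤ) : W a * W b = W b * W a := by
    change Commute (W a) (W b)
    obtain ⟨a', ha | ha⟩ := hW a <;> obtain ⟨b', hb | hb⟩ := hW b <;> rw [ha, hb] <;>
      simpa using H a' b'
  have h := congrArg (fun x => f ^ (-l - s) * x * f ^ (-l)) (hcomm (m + l) l)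
  simp only [W, mul_assoc] at h
  simp only [← mul_assoc, ← zpow_add] at h
  have h1 : -l - s + (m + l + s) = m := by ring
  have h2 : 2 * (m + l) + s = 2 * m + (2 * l + s) := by ring
  have h3 : m + l + (l + s) = m + (2 * l + s) := by ring
  have h4 : l + (m + l + s) = m + (2 * l + s) := by ring
  have h5 : m + l + -l = m := by ring
  have h6 : -l - s + (l + s) = (0 : ℤ) := by ring
  have h7 : l + -l = 0 := by ring
  simpa only [h1, h2, h3, h4, h5, h6, h7, zpow_zero, one_mul, mul_one] using h

end Verma

/-- Verma identity for the rank-2 GCM with `a₁₂ = -1`, `a₂₁ = -2`. -/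
theorem verma_identity_B2 (R : Type*) [Ring R] [Algebra ℚ R] (f g : Rˣ)
    (hf : (f : R) ^ 2 * (g : R) - 2 * ((f : R) * (g : R) * (f : R)) + (g : R) * (f : R) ^ 2 = 0)
    (hg : (g : R) ^ 3 * (f : R) - 3 * ((g : R) ^ 2 * (f : R) * (g : R))
        + 3 * ((g : R) * (f : R) * (g : R) ^ 2) - (f : R) * (g : R) ^ 3 = 0)
    (m n : ℤ) :
    f ^ m * g ^ (2 * m + n) * f ^ (m + n) * g ^ n
      = g ^ n * f ^ (m + n) * g ^ (2 * m + n) * f ^ m := by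
  have H := IsB2Quadruple.of_serre hf hg
  obtain ⟨l, rfl | rfl⟩ := Int.even_or_odd' n
  · have := verma_identity_of_commute (f := f) (g := g) (s := 0) zero_le_one
      (fun a b => Units.ext (by simpa [vermaWord] using (H.commute_vermaWord_zero a b).eq)) m l
    simpa only [Nat.cast_zero, add_zero] using this
  · have := verma_identity_of_commute (f := f) (g := g) (s := 1) le_rfl
      (fun a b => Units.ext (by simpa [vermaWord] using (H.commute_vermaWord_one a b).eq)) m l
    simpa only [Nat.cast_one] using this
end

section
/- Let R be an associative unital algebra over ℚ and let f, g be invertible elements of R satisfying the Serre relations of the rank-2 generalized Cartan matrix with a_{12} = −1, a_{21} = −3, namely f²g − 2fgf + gf² = 0 and g⁴f − 4g³fg + 6g²fg² − 4gfg³ + fg⁴ = 0. Then for all integers m, n one has the Verma identity f^m g^{3m+n} f^{2m+n} g^{3m+2n} f^{m+n} g^n = g^n f^{m+n} g^{3m+2n} f^{2m+n} g^{3m+n} f^m. -/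
namespace VermaG2

section Relations

variable {R : Type*} [Ring R]

/-- The commutation relations among the root vectors `f`, `g`, `h₁ = [g, f]`, `h₂ = [g, h₁]`,
`h₃ = [g, h₂]`, `k = [f, h₃]` of the positive part of the Lie algebra of type `G₂`. -/
structure RootVectors (f g h₁ h₂ h₃ k : R) : Prop where
  g_f : g * f = f * g + h₁
  g_h₁ : g * h₁ = h₁ * g + h₂
  g_h₂ : g * h₂ = h₂ * g + h₃
  g_h₃ : g * h₃ = h₃ * g
  g_k : g * k = k * g
  h₁_f : h₁ * f = f * h₁
  h₂_f : h₂ * f = f * h₂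
  h₃_f : h₃ * f = f * h₃ - k
  k_f : k * f = f * k
  h₂_h₁ : h₂ * h₁ = h₁ * h₂ + k
  h₃_h₁ : h₃ * h₁ = h₁ * h₃
  k_h₁ : k * h₁ = h₁ * k
  h₃_h₂ : h₃ * h₂ = h₂ * h₃
  k_h₂ : k * h₂ = h₂ * k
  k_h₃ : k * h₃ = h₃ * k

attribute [local instance] LieRing.ofAssociativeRing in
theorem RootVectors.of_serre [Algebra ℚ R] {f g : R}
    (hf : f ^ 2 * g - 2 * (f * g * f) + g * f ^ 2 = 0)
    (hg : g ^ 4 * f - 4 * (g ^ 3 * f * g) + 6 * (g ^ 2 * f * g ^ 2) - 4 * (g * f * g ^ 3) +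
      f * g ^ 4 = 0) :
    RootVectors f g ⁅g, f⁆ ⁅g, ⁅g, f⁆⁆ ⁅g, ⁅g, ⁅g, f⁆⁆⁆ ⁅f, ⁅g, ⁅g, ⁅g, f⁆⁆⁆⁆ := by
  obtain ⟨h₁, e₁⟩ : ∃ x, x = ⁅g, f⁆ := ⟨_, rfl⟩
  obtain ⟨h₂, e₂⟩ : ∃ x, x = ⁅g, h₁⁆ := ⟨_, rfl⟩
  obtain ⟨h₃, e₃⟩ : ∃ x, x = ⁅g, h₂⁆ := ⟨_, rfl⟩
  obtain ⟨k, e₄⟩ : ∃ x, x = ⁅f, h₃⁆ := ⟨_, rfl⟩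
  have f_h₁ : ⁅f, h₁⁆ = 0 := by
    rw [e₁, ← neg_eq_zero, ← hf]
    simp only [Ring.lie_def]
    noncomm_ring
  have g_h₃ : ⁅g, h₃⁆ = 0 := by
    rw [e₃, e₂, e₁, ← hg]
    simp only [Ring.lie_def]
    noncomm_ring
  have f_h₂ : ⁅f, h₂⁆ = 0 := by
    have h := leibniz_lie g f h₁
    rwa [f_h₁, lie_zero, ← e₁, lie_self, zero_add, ← e₂, eq_comm] at h
  have h₂_h₁ : ⁅h₂, h₁⁆ = k := by
    have h := leibniz_lie g f h₂
    rw [f_h₂, lie_zero, ← e₁, ← e₃, ← e₄] at h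
    rw [← lie_skew, neg_eq_iff_add_eq_zero, h]
  have h₁_h₃ : ⁅h₁, h₃⁆ = 0 := by
    have h := leibniz_lie g f h₃
    have h' := leibniz_lie g h₂ h₁
    rw [g_h₃, lie_zero, add_zero, ← e₁, ← e₄] at h
    rw [h₂_h₁, ← e₂, ← e₃, lie_self, add_zero, h, ← lie_skew, neg_eq_iff_add_eq_zero,
      ← two_smul ℚ] at h'
    rw [← lie_skew, (smul_eq_zero.mp h').resolve_left two_ne_zero, neg_zero]
  have h₂_h₃ : ⁅h₂, h₃⁆ = 0 := by
    have h := leibniz_lie g h₁ h₃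
    rwa [h₁_h₃, g_h₃, lie_zero, lie_zero, ← e₂, add_zero, eq_comm] at h
  have g_k : ⁅g, k⁆ = 0 := by
    rw [e₄, leibniz_lie, ← e₁, h₁_h₃, g_h₃, lie_zero, add_zero]
  have commute_k (x : R) (h : ⁅x, h₁⁆ = 0) (h' : ⁅x, h₂⁆ = 0) : ⁅x, k⁆ = 0 := by
    rw [← h₂_h₁, leibniz_lie, h, h', zero_lie, lie_zero, add_zero]
  have f_k : ⁅f, k⁆ = 0 := commute_k f f_h₁ f_h₂
  have h₃_k : ⁅h₃, k⁆ = 0 :=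
    commute_k h₃ (by rw [← lie_skew, h₁_h₃, neg_zero]) (by rw [← lie_skew, h₂_h₃, neg_zero])
  have h₁_k : ⁅h₁, k⁆ = 0 := by
    rw [e₄, leibniz_lie, h₁_h₃, lie_zero, ← lie_skew h₁ f, f_h₁, neg_zero, zero_lie, add_zero]
  have h₂_k : ⁅h₂, k⁆ = 0 := by
    rw [e₄, leibniz_lie, h₂_h₃, lie_zero, ← lie_skew h₂ f, f_h₂, neg_zero, zero_lie, add_zero]
  rw [← e₁, ← e₂, ← e₃, ← e₄]
  simp only [Ring.lie_def] at *
  constructor <;> grind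

/-- The relations of `RootVectors`, in a form that applies inside right-associated products. -/
theorem RootVectors.left_assoc {f g h₁ h₂ h₃ k : R} (r : RootVectors f g h₁ h₂ h₃ k) :
    (∀ x, g * (f * x) = f * (g * x) + h₁ * x) ∧
    (∀ x, g * (h₁ * x) = h₁ * (g * x) + h₂ * x) ∧
    (∀ x, g * (h₂ * x) = h₂ * (g * x) + h₃ * x) ∧
    (∀ x, g * (h₃ * x) = h₃ * (g * x)) ∧
    (∀ x, g * (k * x) = k * (g * x)) ∧
    (∀ x, h₁ * (f * x) = f * (h₁ * x)) ∧
    (∀ x, h₂ * (f * x) = f * (h₂ * x)) ∧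
    (∀ x, h₃ * (f * x) = f * (h₃ * x) - k * x) ∧
    (∀ x, k * (f * x) = f * (k * x)) ∧
    (∀ x, h₂ * (h₁ * x) = h₁ * (h₂ * x) + k * x) ∧
    (∀ x, h₃ * (h₁ * x) = h₁ * (h₃ * x)) ∧
    (∀ x, k * (h₁ * x) = h₁ * (k * x)) ∧
    (∀ x, h₃ * (h₂ * x) = h₂ * (h₃ * x)) ∧
    (∀ x, k * (h₂ * x) = h₂ * (k * x)) ∧
    (∀ x, k * (h₃ * x) = h₃ * (k * x)) := by
  refine ⟨?_, ?_, ?_, ?_, ?_, ?_, ?_, ?_, ?_, ?_, ?_, ?_, ?_, ?_, ?_⟩ <;> intro x <;>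
    simp only [← mul_assoc, r.g_f, r.g_h₁, r.g_h₂, r.g_h₃, r.g_k, r.h₁_f, r.h₂_f, r.h₃_f, r.k_f,
      r.h₂_h₁, r.h₃_h₁, r.k_h₁, r.h₃_h₂, r.k_h₂, r.k_h₃, add_mul, sub_mul]

/-- A shift-equivariant family computes conjugation by all integer powers of a unit. -/
theorem mul_zpow_of_shift (x : Rˣ) (u : ℚ → R) (hu : ∀ s, u s * x = x * u (s + 1)) (n : ℤ) :
    u 0 * ↑(x ^ n) = ↑(x ^ n) * u n := by
  induction n using Int.induction_on with
  | zero => simp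
  | succ i ih =>
    rw [zpow_add_one, Units.val_mul, ← mul_assoc, ih, mul_assoc, hu, ← mul_assoc]
    push_cast
    rfl
  | pred i ih =>
    rw [← Units.mul_left_inj x, zpow_sub_one]
    simp only [Units.val_mul, mul_assoc, Units.inv_mul, mul_one, hu]
    rw [ih, Units.inv_mul_cancel_left]
    push_cast
    rw [sub_add_cancel]

end Relations

section NormalForms

set_option linter.unusedSimpArgs false

variable {R : Type*} [Ring R] [Algebra ℚ R]

/-- `f ^ (-a) * g * f ^ (a + 1)` in normal form. -/
def stage₁ (f g h₁ : R) (a : ℚ) : R :=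
  f * g + (1 + a) • h₁

/-- `g ^ (-b) * stage₁ a * g ^ (b + 2)` in normal form. -/
def stage₂ (f g h₁ h₂ h₃ : R) (a b : ℚ) : R :=
  f * g ^ 3 + (1 + a - b) • (h₁ * g ^ 2) + (-1 / 2 * b - a * b + 1 / 2 * b ^ 2) • (h₂ * g) +
    (1 / 6 * b + 1 / 2 * a * b + 1 / 2 * a * b ^ 2 - 1 / 6 * b ^ 3) • h₃

/-- `f ^ (-c) * stage₂ a b * f ^ (c + 2)` in normal form. -/
def stage₃Aux (f g h₁ h₂ h₃ k : R) (a b c : ℚ) : R :=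
  f ^ 3 * g ^ 3 + (7 + a - b + 3 * c) • (f ^ 2 * h₁ * g ^ 2) +
    (10 + 4 * a - 4 * b + 11 * c + 2 * a * c - 2 * b * c + 3 * c ^ 2) • (f * h₁ ^ 2 * g) +
    (6 - 1 / 2 * b + 3 * c - a * b + 1 / 2 * b ^ 2) • (f ^ 2 * h₂ * g) +
    (2 + 2 * a - 2 * b + 5 * c + 3 * a * c - 3 * b * c + 4 * c ^ 2 + a * c ^ 2 - b * c ^ 2 +
      c ^ 3) • (h₁ ^ 3) +
    (2 - 4 / 3 * b + 3 * c - 3 * a * b + b ^ 2 - 2 / 3 * b * c + c ^ 2 - a * b ^ 2 -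
      3 / 2 * a * b * c + 1 / 3 * b ^ 3 + 1 / 2 * b ^ 2 * c - 1 / 2 * a * b ^ 2 * c +
      1 / 6 * b ^ 3 * c) • (f * k) +
    (8 + 2 * a - 3 * b + 10 * c - 2 * a * b + a * c + b ^ 2 - 3 / 2 * b * c + 3 * c ^ 2 -
      a * b * c + 1 / 2 * b ^ 2 * c) • (f * h₁ * h₂) +
    (2 + 1 / 6 * b + c + 1 / 2 * a * b + 1 / 2 * a * b ^ 2 - 1 / 6 * b ^ 3) • (f ^ 2 * h₃)

/-- `f ^ (-c) * stage₂ a (a + c) * f ^ (c + 1)` in normal form. -/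
def stage₃ (f g h₁ h₂ h₃ k : R) (a c : ℚ) : R :=
  f ^ 2 * g ^ 3 + (4 + 2 * c) • (f * h₁ * g ^ 2) + (2 + 3 * c + c ^ 2) • (h₁ ^ 2 * g) +
    (3 - 1 / 2 * a + 5 / 2 * c - 1 / 2 * a ^ 2 + 1 / 2 * c ^ 2) • (f * h₂ * g) +
    (-2 / 3 * a + 1 / 3 * c - a ^ 2 - 7 / 6 * a * c + 5 / 6 * c ^ 2 - 1 / 3 * a ^ 3 -
      3 / 2 * a ^ 2 * c - 1 / 2 * a * c ^ 2 + 2 / 3 * c ^ 3 - 1 / 3 * a ^ 3 * c -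
      1 / 2 * a ^ 2 * c ^ 2 + 1 / 6 * c ^ 4) • k +
    (1 - 1 / 2 * a + 5 / 2 * c - 1 / 2 * a ^ 2 - 1 / 2 * a * c + 2 * c ^ 2 - 1 / 2 * a ^ 2 * c +
      1 / 2 * c ^ 3) • (h₁ * h₂) +
    (1 + 1 / 6 * a + 7 / 6 * c + 1 / 2 * a ^ 2 + 1 / 2 * a * c + 1 / 3 * a ^ 3 +
      1 / 2 * a ^ 2 * c - 1 / 6 * c ^ 3) • (f * h₃)

set_option maxHeartbeats 1000000 in
/-- `g ^ (-s) * stage₃ a c * g ^ (s + 3)` in normal form. -/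
def translatorAux (f g h₁ h₂ h₃ k : R) (a c s : ℚ) : R :=
  f ^ 2 * g ^ 6 + (4 + 2 * c - 2 * s) • (f * h₁ * g ^ 5) +
    (2 + 3 * c - 3 * s + c ^ 2 - 2 * c * s + s ^ 2) • (h₁ ^ 2 * g ^ 4) +
    (3 - 1 / 2 * a + 5 / 2 * c - 3 * s - 1 / 2 * a ^ 2 + 1 / 2 * c ^ 2 - 2 * c * s +
      s ^ 2) • (f * h₂ * g ^ 4) +
    (-2 / 3 * a + 1 / 3 * c - 2 / 3 * s - a ^ 2 - 7 / 6 * a * c + 5 / 6 * c ^ 2 - 2 * c * s +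
      s ^ 2 - 1 / 3 * a ^ 3 - 3 / 2 * a ^ 2 * c - 1 / 2 * a * c ^ 2 + 2 / 3 * c ^ 3 - c ^ 2 * s +
      c * s ^ 2 - 1 / 3 * s ^ 3 - 1 / 3 * a ^ 3 * c - 1 / 2 * a ^ 2 * c ^ 2 +
      1 / 6 * c ^ 4) • (k * g ^ 3) +
    (1 - 1 / 2 * a + 5 / 2 * c - 3 * s - 1 / 2 * a ^ 2 - 1 / 2 * a * c + 1 / 2 * a * s +
      2 * c ^ 2 - 11 / 2 * c * s + 3 * s ^ 2 - 1 / 2 * a ^ 2 * c + 1 / 2 * a ^ 2 * s +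
      1 / 2 * c ^ 3 - 5 / 2 * c ^ 2 * s + 3 * c * s ^ 2 - s ^ 3) • (h₁ * h₂ * g ^ 3) +
    (1 + 1 / 6 * a + 7 / 6 * c - 5 / 3 * s + 1 / 2 * a ^ 2 + 1 / 2 * a * c + 1 / 2 * a * s -
      3 / 2 * c * s + s ^ 2 + 1 / 3 * a ^ 3 + 1 / 2 * a ^ 2 * c + 1 / 2 * a ^ 2 * s -
      1 / 6 * c ^ 3 - 1 / 2 * c ^ 2 * s + c * s ^ 2 - 1 / 3 * s ^ 3) • (f * h₃ * g ^ 3) +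
    (1 / 4 * a * s - 1 / 4 * c * s + 1 / 4 * s ^ 2 + 1 / 4 * a ^ 2 * s + 1 / 2 * a * c * s -
      1 / 4 * a * s ^ 2 - 3 / 4 * c ^ 2 * s + 5 / 4 * c * s ^ 2 - 1 / 2 * s ^ 3 +
      1 / 2 * a ^ 2 * c * s - 1 / 4 * a ^ 2 * s ^ 2 - 1 / 2 * c ^ 3 * s + 5 / 4 * c ^ 2 * s ^ 2 -
      c * s ^ 3 + 1 / 4 * s ^ 4) • (h₂ ^ 2 * g ^ 2) +
    (-1 / 3 * s - 1 / 6 * a * s - 5 / 6 * c * s + 2 / 3 * s ^ 2 - 1 / 2 * a ^ 2 * s -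
      1 / 2 * a * s ^ 2 - 1 / 2 * c ^ 2 * s + 3 / 2 * c * s ^ 2 - 2 / 3 * s ^ 3 -
      1 / 3 * a ^ 3 * s - 1 / 2 * a ^ 2 * s ^ 2 - 1 / 3 * c ^ 3 * s + 3 / 2 * c ^ 2 * s ^ 2 -
      4 / 3 * c * s ^ 3 + 1 / 3 * s ^ 4) • (h₁ * h₃ * g ^ 2) +
    (1 / 6 * a ^ 2 * s - 1 / 2 * a * c * s + 1 / 3 * a * s ^ 2 + 1 / 3 * c ^ 2 * s -
      1 / 2 * c * s ^ 2 + 1 / 6 * s ^ 3 + 1 / 6 * a ^ 3 * s - 1 / 2 * a ^ 2 * c * s +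
      1 / 2 * a ^ 2 * s ^ 2 - 1 / 2 * a * c * s ^ 2 + 1 / 3 * a * s ^ 3 + 2 / 3 * c ^ 3 * s -
      c ^ 2 * s ^ 2 + 1 / 3 * c * s ^ 3 + 1 / 6 * a ^ 3 * s ^ 2 - 1 / 2 * a ^ 2 * c * s ^ 2 +
      1 / 3 * a ^ 2 * s ^ 3 + 2 / 3 * c ^ 3 * s ^ 2 - 4 / 3 * c ^ 2 * s ^ 3 + 5 / 6 * c * s ^ 4 -
      1 / 6 * s ^ 5) • (h₂ * h₃ * g) +
    (-1 / 18 * a * s + 1 / 9 * c * s - 1 / 18 * s ^ 2 - 1 / 6 * a ^ 2 * s + 1 / 3 * a * c * s -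
      1 / 4 * a * s ^ 2 + 1 / 6 * c * s ^ 2 - 1 / 12 * s ^ 3 - 1 / 9 * a ^ 3 * s +
      1 / 3 * a ^ 2 * c * s - 5 / 12 * a ^ 2 * s ^ 2 + 1 / 2 * a * c * s ^ 2 -
      5 / 18 * a * s ^ 3 - 4 / 9 * c ^ 3 * s + 2 / 3 * c ^ 2 * s ^ 2 - 5 / 18 * c * s ^ 3 +
      1 / 36 * s ^ 4 - 1 / 6 * a ^ 3 * s ^ 2 + 1 / 2 * a ^ 2 * c * s ^ 2 - 1 / 3 * a ^ 2 * s ^ 3 +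
      1 / 6 * a * c * s ^ 3 - 1 / 12 * a * s ^ 4 - 2 / 3 * c ^ 3 * s ^ 2 + c ^ 2 * s ^ 3 -
      1 / 2 * c * s ^ 4 + 1 / 12 * s ^ 5 - 1 / 18 * a ^ 3 * s ^ 3 + 1 / 6 * a ^ 2 * c * s ^ 3 -
      1 / 12 * a ^ 2 * s ^ 4 - 2 / 9 * c ^ 3 * s ^ 3 + 1 / 3 * c ^ 2 * s ^ 4 - 1 / 6 * c * s ^ 5 +
      1 / 36 * s ^ 6) • (h₃ ^ 2)

/-- `g ^ (a - 2 * c) * stage₃ a c * g ^ (2 * c - a + 1)` in normal form. -/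
def translator (f g h₁ h₂ h₃ k : R) (a c : ℚ) : R :=
  f ^ 2 * g ^ 4 + (4 + 2 * a - 2 * c) • (f * h₁ * g ^ 3) +
    (2 + 3 * a - 3 * c + a ^ 2 - 2 * a * c + c ^ 2) • (h₁ ^ 2 * g ^ 2) +
    (3 + 5 / 2 * a - 7 / 2 * c + 1 / 2 * a ^ 2 - 2 * a * c + 1 / 2 * c ^ 2) • (f * h₂ * g ^ 2) +
    (-c - 19 / 6 * a * c + 5 / 6 * c ^ 2 - 5 / 2 * a ^ 2 * c + 1 / 2 * a * c ^ 2 -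
      1 / 3 * a ^ 3 * c - 1 / 2 * a ^ 2 * c ^ 2 + 1 / 6 * c ^ 4) • (k * g) +
    (1 + 5 / 2 * a - 7 / 2 * c + 2 * a ^ 2 - 6 * a * c + 3 * c ^ 2 + 1 / 2 * a ^ 3 -
      5 / 2 * a ^ 2 * c + 5 / 2 * a * c ^ 2 - 1 / 2 * c ^ 3) • (h₁ * h₂ * g) +
    (1 + 11 / 6 * a - 13 / 6 * c + a ^ 2 - a * c + c ^ 2 + 1 / 6 * a ^ 3 + 1 / 2 * a ^ 2 * c +
      1 / 2 * a * c ^ 2 + 1 / 6 * c ^ 3) • (f * h₃ * g) +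
    (-1 / 4 * a * c + 1 / 2 * c ^ 2 - 3 / 4 * a ^ 2 * c + 7 / 4 * a * c ^ 2 - 1 / 2 * c ^ 3 -
      1 / 2 * a ^ 3 * c + 5 / 4 * a ^ 2 * c ^ 2 - 1 / 2 * a * c ^ 3) • (h₂ ^ 2) +
    (1 / 3 * a - 2 / 3 * c + 5 / 6 * a ^ 2 - 13 / 6 * a * c + c ^ 2 + 2 / 3 * a ^ 3 -
      3 / 2 * a ^ 2 * c + 1 / 2 * a * c ^ 2 - 1 / 3 * c ^ 3 + 1 / 6 * a ^ 4 -
      1 / 2 * a ^ 2 * c ^ 2 - 1 / 3 * a * c ^ 3) • (h₁ * h₃)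

set_option maxHeartbeats 1000000 in
/-- `f ^ s * translator a c * f ^ (2 - s)` in normal form. -/
def conjTranslator (f g h₁ h₂ h₃ k : R) (a c s : ℚ) : R :=
  f ^ 4 * g ^ 4 + (12 + 2 * a - 2 * c - 4 * s) • (f ^ 3 * h₁ * g ^ 3) +
    (38 + 15 * a - 15 * c - 30 * s + a ^ 2 - 2 * a * c - 6 * a * s + c ^ 2 + 6 * c * s +
      6 * s ^ 2) • (f ^ 2 * h₁ ^ 2 * g ^ 2) +
    (15 + 5 / 2 * a - 7 / 2 * c - 6 * s + 1 / 2 * a ^ 2 - 2 * a * c +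
      1 / 2 * c ^ 2) • (f ^ 3 * h₂ * g ^ 2) +
    (32 + 24 * a - 24 * c - 48 * s + 4 * a ^ 2 - 8 * a * c - 24 * a * s + 4 * c ^ 2 + 24 * c * s +
      24 * s ^ 2 - 2 * a ^ 2 * s + 4 * a * c * s + 6 * a * s ^ 2 - 2 * c ^ 2 * s - 6 * c * s ^ 2 -
      4 * s ^ 3) • (f * h₁ ^ 3 * g) +
    (18 + 19 / 3 * a - 32 / 3 * c - 17 * s - 55 / 6 * a * c - 19 / 6 * a * s + 5 / 6 * c ^ 2 +
      29 / 6 * c * s + 4 * s ^ 2 - 1 / 3 * a ^ 3 - 7 / 2 * a ^ 2 * c - 1 / 2 * a * c ^ 2 +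
      3 * a * c * s - 1 / 3 * c ^ 3 - 1 / 3 * a ^ 3 * c + 1 / 6 * a ^ 3 * s -
      1 / 2 * a ^ 2 * c ^ 2 + 1 / 2 * a ^ 2 * c * s + 1 / 2 * a * c ^ 2 * s + 1 / 6 * c ^ 4 +
      1 / 6 * c ^ 3 * s) • (f ^ 2 * k * g) +
    (61 + 49 / 2 * a - 59 / 2 * c - 54 * s + 4 * a ^ 2 - 14 * a * c - 11 * a * s + 5 * c ^ 2 +
      13 * c * s + 12 * s ^ 2 + 1 / 2 * a ^ 3 - 5 / 2 * a ^ 2 * c - a ^ 2 * s +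
      5 / 2 * a * c ^ 2 + 4 * a * c * s - 1 / 2 * c ^ 3 - c ^ 2 * s) • (f ^ 2 * h₁ * h₂ * g) +
    (9 + 11 / 6 * a - 13 / 6 * c - 4 * s + a ^ 2 - a * c + c ^ 2 + 1 / 6 * a ^ 3 +
      1 / 2 * a ^ 2 * c + 1 / 2 * a * c ^ 2 + 1 / 6 * c ^ 3) • (f ^ 3 * h₃ * g) +
    (4 + 6 * a - 6 * c - 12 * s + 2 * a ^ 2 - 4 * a * c - 13 * a * s + 2 * c ^ 2 + 13 * c * s +
      13 * s ^ 2 - 3 * a ^ 2 * s + 6 * a * c * s + 9 * a * s ^ 2 - 3 * c ^ 2 * s - 9 * c * s ^ 2 -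
      6 * s ^ 3 + a ^ 2 * s ^ 2 - 2 * a * c * s ^ 2 - 2 * a * s ^ 3 + c ^ 2 * s ^ 2 +
      2 * c * s ^ 3 + s ^ 4) • (h₁ ^ 4) +
    (20 + 44 / 3 * a - 64 / 3 * c - 36 * s + 7 / 3 * a ^ 2 - 20 * a * c - 53 / 3 * a * s +
      17 / 3 * c ^ 2 + 73 / 3 * c * s + 21 * s ^ 2 - 2 / 3 * a ^ 3 - 8 * a ^ 2 * c -
      7 / 6 * a ^ 2 * s + 4 * a * c ^ 2 + 16 * a * c * s + 31 / 6 * a * s ^ 2 - 2 / 3 * c ^ 3 -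
      17 / 6 * c ^ 2 * s - 41 / 6 * c * s ^ 2 - 4 * s ^ 3 - 1 / 3 * a ^ 4 - 2 / 3 * a ^ 3 * c +
      2 / 3 * a ^ 3 * s + 5 * a ^ 2 * c * s + 2 / 3 * a * c ^ 3 - a * c ^ 2 * s -
      3 * a * c * s ^ 2 + 1 / 3 * c ^ 4 + 2 / 3 * c ^ 3 * s + 1 / 6 * a ^ 4 * s +
      1 / 3 * a ^ 3 * c * s - 1 / 6 * a ^ 3 * s ^ 2 - 1 / 2 * a ^ 2 * c * s ^ 2 -
      1 / 3 * a * c ^ 3 * s - 1 / 2 * a * c ^ 2 * s ^ 2 - 1 / 6 * c ^ 4 * s -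
      1 / 6 * c ^ 3 * s ^ 2) • (f * h₁ * k) +
    (36 + 28 * a - 32 * c - 60 * s + 7 * a ^ 2 - 20 * a * c - 31 * a * s + 9 * c ^ 2 +
      35 * c * s + 33 * s ^ 2 + a ^ 3 - 5 * a ^ 2 * c - 9 / 2 * a ^ 2 * s + 5 * a * c ^ 2 +
      14 * a * c * s + 17 / 2 * a * s ^ 2 - c ^ 3 - 11 / 2 * c ^ 2 * s - 19 / 2 * c * s ^ 2 -
      6 * s ^ 3 - 1 / 2 * a ^ 3 * s + 5 / 2 * a ^ 2 * c * s + 1 / 2 * a ^ 2 * s ^ 2 -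
      5 / 2 * a * c ^ 2 * s - 2 * a * c * s ^ 2 + 1 / 2 * c ^ 3 * s +
      1 / 2 * c ^ 2 * s ^ 2) • (f * h₁ ^ 2 * h₂) +
    (12 + 5 * a - 7 * c - 12 * s + a ^ 2 - 17 / 4 * a * c - 5 / 2 * a * s + 3 / 2 * c ^ 2 +
      7 / 2 * c * s + 3 * s ^ 2 - 3 / 4 * a ^ 2 * c - 1 / 2 * a ^ 2 * s + 7 / 4 * a * c ^ 2 +
      2 * a * c * s - 1 / 2 * c ^ 3 - 1 / 2 * c ^ 2 * s - 1 / 2 * a ^ 3 * c +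
      5 / 4 * a ^ 2 * c ^ 2 - 1 / 2 * a * c ^ 3) • (f ^ 2 * h₂ ^ 2) +
    (18 + 8 * a - 9 * c - 17 * s + 17 / 6 * a ^ 2 - 25 / 6 * a * c - 23 / 6 * a * s + 3 * c ^ 2 +
      25 / 6 * c * s + 4 * s ^ 2 + a ^ 3 - 1 / 2 * a ^ 2 * c - a ^ 2 * s + 3 / 2 * a * c ^ 2 +
      a * c * s - c ^ 2 * s + 1 / 6 * a ^ 4 - 1 / 6 * a ^ 3 * s - 1 / 2 * a ^ 2 * c ^ 2 -
      1 / 2 * a ^ 2 * c * s - 1 / 3 * a * c ^ 3 - 1 / 2 * a * c ^ 2 * s -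
      1 / 6 * c ^ 3 * s) • (f ^ 2 * h₁ * h₃)

theorem stage₁_zero {f g h₁ h₂ h₃ k : R} (r : RootVectors f g h₁ h₂ h₃ k)
    :
    stage₁ f g h₁ 0 = g * f := by
  obtain ⟨e₁, e₂, e₃, e₄, e₅, e₆, e₇, e₈, e₉, e₁₀, e₁₁, e₁₂, e₁₃, e₁₄, e₁₅⟩ := r.left_assoc
  simp only [stage₁, pow_succ, pow_zero, one_mul, mul_add, add_mul, mul_sub,
    sub_mul, smul_mul_assoc, mul_smul_comm, smul_add, smul_sub, mul_assoc, r.g_f, r.g_h₁, r.g_h₂,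
    r.g_h₃, r.g_k, r.h₁_f, r.h₂_f, r.h₃_f, r.k_f, r.h₂_h₁, r.h₃_h₁, r.k_h₁, r.h₃_h₂, r.k_h₂,
    r.k_h₃, e₁, e₂, e₃, e₄, e₅, e₆, e₇, e₈, e₉, e₁₀, e₁₁, e₁₂, e₁₃, e₁₄, e₁₅]
  module

theorem stage₁_shift {f g h₁ h₂ h₃ k : R} (r : RootVectors f g h₁ h₂ h₃ k)
    (a : ℚ) :
    stage₁ f g h₁ a * f = f * stage₁ f g h₁ (a + 1) := by
  obtain ⟨e₁, e₂, e₃, e₄, e₅, e₆, e₇, e₈, e₉, e₁₀, e₁₁, e₁₂, e₁₃, e₁₄, e₁₅⟩ := r.left_assoc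
  simp only [stage₁, pow_succ, pow_zero, one_mul, mul_add, add_mul, mul_sub,
    sub_mul, smul_mul_assoc, mul_smul_comm, smul_add, smul_sub, mul_assoc, r.g_f, r.g_h₁, r.g_h₂,
    r.g_h₃, r.g_k, r.h₁_f, r.h₂_f, r.h₃_f, r.k_f, r.h₂_h₁, r.h₃_h₁, r.k_h₁, r.h₃_h₂, r.k_h₂,
    r.k_h₃, e₁, e₂, e₃, e₄, e₅, e₆, e₇, e₈, e₉, e₁₀, e₁₁, e₁₂, e₁₃, e₁₄, e₁₅]
  module

theorem stage₂_zero {f g h₁ h₂ h₃ k : R} (r : RootVectors f g h₁ h₂ h₃ k)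
    (a : ℚ) :
    stage₂ f g h₁ h₂ h₃ a 0 = stage₁ f g h₁ a * g ^ 2 := by
  obtain ⟨e₁, e₂, e₃, e₄, e₅, e₆, e₇, e₈, e₉, e₁₀, e₁₁, e₁₂, e₁₃, e₁₄, e₁₅⟩ := r.left_assoc
  simp only [stage₁, stage₂, pow_succ, pow_zero, one_mul, mul_add, add_mul, mul_sub,
    sub_mul, smul_mul_assoc, mul_smul_comm, smul_add, smul_sub, mul_assoc, r.g_f, r.g_h₁, r.g_h₂,
    r.g_h₃, r.g_k, r.h₁_f, r.h₂_f, r.h₃_f, r.k_f, r.h₂_h₁, r.h₃_h₁, r.k_h₁, r.h₃_h₂, r.k_h₂,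
    r.k_h₃, e₁, e₂, e₃, e₄, e₅, e₆, e₇, e₈, e₉, e₁₀, e₁₁, e₁₂, e₁₃, e₁₄, e₁₅]
  module

theorem stage₂_shift {f g h₁ h₂ h₃ k : R} (r : RootVectors f g h₁ h₂ h₃ k)
    (a b : ℚ) :
    stage₂ f g h₁ h₂ h₃ a b * g = g * stage₂ f g h₁ h₂ h₃ a (b + 1) := by
  obtain ⟨e₁, e₂, e₃, e₄, e₅, e₆, e₇, e₈, e₉, e₁₀, e₁₁, e₁₂, e₁₃, e₁₄, e₁₅⟩ := r.left_assoc
  simp only [stage₂, pow_succ, pow_zero, one_mul, mul_add, add_mul, mul_sub,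
    sub_mul, smul_mul_assoc, mul_smul_comm, smul_add, smul_sub, mul_assoc, r.g_f, r.g_h₁, r.g_h₂,
    r.g_h₃, r.g_k, r.h₁_f, r.h₂_f, r.h₃_f, r.k_f, r.h₂_h₁, r.h₃_h₁, r.k_h₁, r.h₃_h₂, r.k_h₂,
    r.k_h₃, e₁, e₂, e₃, e₄, e₅, e₆, e₇, e₈, e₉, e₁₀, e₁₁, e₁₂, e₁₃, e₁₄, e₁₅]
  module

theorem stage₃Aux_zero {f g h₁ h₂ h₃ k : R} (r : RootVectors f g h₁ h₂ h₃ k)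
    (a b : ℚ) :
    stage₃Aux f g h₁ h₂ h₃ k a b 0 = stage₂ f g h₁ h₂ h₃ a b * f ^ 2 := by
  obtain ⟨e₁, e₂, e₃, e₄, e₅, e₆, e₇, e₈, e₉, e₁₀, e₁₁, e₁₂, e₁₃, e₁₄, e₁₅⟩ := r.left_assoc
  simp only [stage₃Aux, stage₂, pow_succ, pow_zero, one_mul, mul_add, add_mul, mul_sub,
    sub_mul, smul_mul_assoc, mul_smul_comm, smul_add, smul_sub, mul_assoc, r.g_f, r.g_h₁, r.g_h₂,
    r.g_h₃, r.g_k, r.h₁_f, r.h₂_f, r.h₃_f, r.k_f, r.h₂_h₁, r.h₃_h₁, r.k_h₁, r.h₃_h₂, r.k_h₂,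
    r.k_h₃, e₁, e₂, e₃, e₄, e₅, e₆, e₇, e₈, e₉, e₁₀, e₁₁, e₁₂, e₁₃, e₁₄, e₁₅]
  module

theorem stage₃Aux_shift {f g h₁ h₂ h₃ k : R} (r : RootVectors f g h₁ h₂ h₃ k)
    (a b c : ℚ) :
    stage₃Aux f g h₁ h₂ h₃ k a b c * f = f * stage₃Aux f g h₁ h₂ h₃ k a b (c + 1) := by
  obtain ⟨e₁, e₂, e₃, e₄, e₅, e₆, e₇, e₈, e₉, e₁₀, e₁₁, e₁₂, e₁₃, e₁₄, e₁₅⟩ := r.left_assoc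
  simp only [stage₃Aux, pow_succ, pow_zero, one_mul, mul_add, add_mul, mul_sub,
    sub_mul, smul_mul_assoc, mul_smul_comm, smul_add, smul_sub, mul_assoc, r.g_f, r.g_h₁, r.g_h₂,
    r.g_h₃, r.g_k, r.h₁_f, r.h₂_f, r.h₃_f, r.k_f, r.h₂_h₁, r.h₃_h₁, r.k_h₁, r.h₃_h₂, r.k_h₂,
    r.k_h₃, e₁, e₂, e₃, e₄, e₅, e₆, e₇, e₈, e₉, e₁₀, e₁₁, e₁₂, e₁₃, e₁₄, e₁₅]
  module

theorem stage₃Aux_eq {f g h₁ h₂ h₃ k : R} (r : RootVectors f g h₁ h₂ h₃ k)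
    (a c : ℚ) :
    stage₃Aux f g h₁ h₂ h₃ k a (a + c) c = stage₃ f g h₁ h₂ h₃ k a c * f := by
  obtain ⟨e₁, e₂, e₃, e₄, e₅, e₆, e₇, e₈, e₉, e₁₀, e₁₁, e₁₂, e₁₃, e₁₄, e₁₅⟩ := r.left_assoc
  simp only [stage₃Aux, stage₃, pow_succ, pow_zero, one_mul, mul_add, add_mul, mul_sub,
    sub_mul, smul_mul_assoc, mul_smul_comm, smul_add, smul_sub, mul_assoc, r.g_f, r.g_h₁, r.g_h₂,
    r.g_h₃, r.g_k, r.h₁_f, r.h₂_f, r.h₃_f, r.k_f, r.h₂_h₁, r.h₃_h₁, r.k_h₁, r.h₃_h₂, r.k_h₂,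
    r.k_h₃, e₁, e₂, e₃, e₄, e₅, e₆, e₇, e₈, e₉, e₁₀, e₁₁, e₁₂, e₁₃, e₁₄, e₁₅]
  module

set_option maxHeartbeats 1000000 in
theorem translatorAux_zero {f g h₁ h₂ h₃ k : R} (r : RootVectors f g h₁ h₂ h₃ k)
    (a c : ℚ) :
    translatorAux f g h₁ h₂ h₃ k a c 0 = stage₃ f g h₁ h₂ h₃ k a c * g ^ 3 := by
  obtain ⟨e₁, e₂, e₃, e₄, e₅, e₆, e₇, e₈, e₉, e₁₀, e₁₁, e₁₂, e₁₃, e₁₄, e₁₅⟩ := r.left_assoc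
  simp only [translatorAux, stage₃, pow_succ, pow_zero, one_mul, mul_add, add_mul, mul_sub,
    sub_mul, smul_mul_assoc, mul_smul_comm, smul_add, smul_sub, mul_assoc, r.g_f, r.g_h₁, r.g_h₂,
    r.g_h₃, r.g_k, r.h₁_f, r.h₂_f, r.h₃_f, r.k_f, r.h₂_h₁, r.h₃_h₁, r.k_h₁, r.h₃_h₂, r.k_h₂,
    r.k_h₃, e₁, e₂, e₃, e₄, e₅, e₆, e₇, e₈, e₉, e₁₀, e₁₁, e₁₂, e₁₃, e₁₄, e₁₅]
  module

set_option maxHeartbeats 1000000 in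
theorem translatorAux_shift {f g h₁ h₂ h₃ k : R} (r : RootVectors f g h₁ h₂ h₃ k)
    (a c s : ℚ) :
    translatorAux f g h₁ h₂ h₃ k a c s * g = g * translatorAux f g h₁ h₂ h₃ k a c (s + 1) := by
  obtain ⟨e₁, e₂, e₃, e₄, e₅, e₆, e₇, e₈, e₉, e₁₀, e₁₁, e₁₂, e₁₃, e₁₄, e₁₅⟩ := r.left_assoc
  simp only [translatorAux, pow_succ, pow_zero, one_mul, mul_add, add_mul, mul_sub,
    sub_mul, smul_mul_assoc, mul_smul_comm, smul_add, smul_sub, mul_assoc, r.g_f, r.g_h₁, r.g_h₂,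
    r.g_h₃, r.g_k, r.h₁_f, r.h₂_f, r.h₃_f, r.k_f, r.h₂_h₁, r.h₃_h₁, r.k_h₁, r.h₃_h₂, r.k_h₂,
    r.k_h₃, e₁, e₂, e₃, e₄, e₅, e₆, e₇, e₈, e₉, e₁₀, e₁₁, e₁₂, e₁₃, e₁₄, e₁₅]
  module

set_option maxHeartbeats 1000000 in
theorem translatorAux_eq {f g h₁ h₂ h₃ k : R} (r : RootVectors f g h₁ h₂ h₃ k)
    (a c : ℚ) :
    translatorAux f g h₁ h₂ h₃ k a c (2 * c - a) = translator f g h₁ h₂ h₃ k a c * g ^ 2 := by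
  obtain ⟨e₁, e₂, e₃, e₄, e₅, e₆, e₇, e₈, e₉, e₁₀, e₁₁, e₁₂, e₁₃, e₁₄, e₁₅⟩ := r.left_assoc
  simp only [translatorAux, translator, pow_succ, pow_zero, one_mul, mul_add, add_mul, mul_sub,
    sub_mul, smul_mul_assoc, mul_smul_comm, smul_add, smul_sub, mul_assoc, r.g_f, r.g_h₁, r.g_h₂,
    r.g_h₃, r.g_k, r.h₁_f, r.h₂_f, r.h₃_f, r.k_f, r.h₂_h₁, r.h₃_h₁, r.k_h₁, r.h₃_h₂, r.k_h₂,
    r.k_h₃, e₁, e₂, e₃, e₄, e₅, e₆, e₇, e₈, e₉, e₁₀, e₁₁, e₁₂, e₁₃, e₁₄, e₁₅]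
  module

set_option maxHeartbeats 1000000 in
theorem conjTranslator_zero {f g h₁ h₂ h₃ k : R} (r : RootVectors f g h₁ h₂ h₃ k)
    (a c : ℚ) :
    conjTranslator f g h₁ h₂ h₃ k a c 0 = translator f g h₁ h₂ h₃ k a c * f ^ 2 := by
  obtain ⟨e₁, e₂, e₃, e₄, e₅, e₆, e₇, e₈, e₉, e₁₀, e₁₁, e₁₂, e₁₃, e₁₄, e₁₅⟩ := r.left_assoc
  simp only [conjTranslator, translator, pow_succ, pow_zero, one_mul, mul_add, add_mul, mul_sub,
    sub_mul, smul_mul_assoc, mul_smul_comm, smul_add, smul_sub, mul_assoc, r.g_f, r.g_h₁, r.g_h₂,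
    r.g_h₃, r.g_k, r.h₁_f, r.h₂_f, r.h₃_f, r.k_f, r.h₂_h₁, r.h₃_h₁, r.k_h₁, r.h₃_h₂, r.k_h₂,
    r.k_h₃, e₁, e₂, e₃, e₄, e₅, e₆, e₇, e₈, e₉, e₁₀, e₁₁, e₁₂, e₁₃, e₁₄, e₁₅]
  module

set_option maxHeartbeats 1000000 in
theorem conjTranslator_shift {f g h₁ h₂ h₃ k : R} (r : RootVectors f g h₁ h₂ h₃ k)
    (a c s : ℚ) :
    f * conjTranslator f g h₁ h₂ h₃ k a c s = conjTranslator f g h₁ h₂ h₃ k a c (s + 1) * f := by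
  obtain ⟨e₁, e₂, e₃, e₄, e₅, e₆, e₇, e₈, e₉, e₁₀, e₁₁, e₁₂, e₁₃, e₁₄, e₁₅⟩ := r.left_assoc
  simp only [conjTranslator, pow_succ, pow_zero, one_mul, mul_add, add_mul, mul_sub,
    sub_mul, smul_mul_assoc, mul_smul_comm, smul_add, smul_sub, mul_assoc, r.g_f, r.g_h₁, r.g_h₂,
    r.g_h₃, r.g_k, r.h₁_f, r.h₂_f, r.h₃_f, r.k_f, r.h₂_h₁, r.h₃_h₁, r.k_h₁, r.h₃_h₂, r.k_h₂,
    r.k_h₃, e₁, e₂, e₃, e₄, e₅, e₆, e₇, e₈, e₉, e₁₀, e₁₁, e₁₂, e₁₃, e₁₄, e₁₅]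
  module

set_option maxHeartbeats 1000000 in
theorem conjTranslator_eq {f g h₁ h₂ h₃ k : R} (r : RootVectors f g h₁ h₂ h₃ k)
    (a c : ℚ) :
    conjTranslator f g h₁ h₂ h₃ k a c (a - c) = translator f g h₁ h₂ h₃ k c a * f ^ 2 := by
  obtain ⟨e₁, e₂, e₃, e₄, e₅, e₆, e₇, e₈, e₉, e₁₀, e₁₁, e₁₂, e₁₃, e₁₄, e₁₅⟩ := r.left_assoc
  simp only [conjTranslator, translator, pow_succ, pow_zero, one_mul, mul_add, add_mul, mul_sub,
    sub_mul, smul_mul_assoc, mul_smul_comm, smul_add, smul_sub, mul_assoc, r.g_f, r.g_h₁, r.g_h₂,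
    r.g_h₃, r.g_k, r.h₁_f, r.h₂_f, r.h₃_f, r.k_f, r.h₂_h₁, r.h₃_h₁, r.k_h₁, r.h₃_h₂, r.k_h₂,
    r.k_h₃, e₁, e₂, e₃, e₄, e₅, e₆, e₇, e₈, e₉, e₁₀, e₁₁, e₁₂, e₁₃, e₁₄, e₁₅]
  module

end NormalForms

section Units

variable {R : Type*} [Ring R] [Algebra ℚ R] {f g : Rˣ} {h₁ h₂ h₃ k : R}

theorem stage₂_mul_zpow (r : RootVectors (f : R) g h₁ h₂ h₃ k) (a c : ℤ) :
    stage₂ (f : R) g h₁ h₂ h₃ a (a + c) * ↑(f ^ (c + 1)) =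
      ↑(f ^ c) * stage₃ (f : R) g h₁ h₂ h₃ k a c := by
  have h := mul_zpow_of_shift f (stage₃Aux (f : R) g h₁ h₂ h₃ k a (a + c))
    (stage₃Aux_shift r _ _) c
  rw [stage₃Aux_zero r, stage₃Aux_eq r] at h
  rw [← Units.mul_left_inj f, mul_assoc (↑(f ^ c) : R), ← h, ← Units.val_pow_eq_pow_val, mul_assoc,
    mul_assoc, ← Units.val_mul, ← Units.val_mul, ← zpow_add_one, ← zpow_natCast, ← zpow_add]
  congr 3
  push_cast
  ring

theorem stage₃_mul_zpow (r : RootVectors (f : R) g h₁ h₂ h₃ k) (a c : ℤ) :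
    stage₃ (f : R) g h₁ h₂ h₃ k a c * ↑(g ^ (2 * c - a + 1)) =
      ↑(g ^ (2 * c - a)) * translator (f : R) g h₁ h₂ h₃ k a c := by
  have h := mul_zpow_of_shift g (translatorAux (f : R) g h₁ h₂ h₃ k a c)
    (translatorAux_shift r _ _) (2 * c - a)
  push_cast at h
  rw [translatorAux_zero r, translatorAux_eq r] at h
  rw [← Units.mul_left_inj (g ^ 2), mul_assoc (↑(g ^ (2 * c - a)) : R), Units.val_pow_eq_pow_val,
    ← h, ← Units.val_pow_eq_pow_val, ← Units.val_pow_eq_pow_val, mul_assoc,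
    mul_assoc, ← Units.val_mul, ← Units.val_mul, ← zpow_natCast, ← zpow_natCast, ← zpow_add,
    ← zpow_add]
  congr 3
  push_cast
  ring

/-- Raising the exponents of `f ^ a * g ^ (a + c) * f ^ c * g ^ (2 * c - a)` amounts to right
multiplication by `translator`. -/
theorem zpow_mul_translator (r : RootVectors (f : R) g h₁ h₂ h₃ k) (a c : ℤ) :
    (↑(g * f ^ (a + 1) * g ^ (a + c + 2) * f ^ (c + 1) * g ^ (2 * c - a + 1)) : R) =
      ↑(f ^ a * g ^ (a + c) * f ^ c * g ^ (2 * c - a)) *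
        translator (f : R) g h₁ h₂ h₃ k a c := by
  have e₁ : (g : R) * ↑(f ^ (a + 1)) = ↑(f ^ a) * stage₁ (f : R) g h₁ a := by
    have h := mul_zpow_of_shift f (stage₁ (f : R) g h₁) (stage₁_shift r) a
    rw [stage₁_zero r] at h
    rw [← h, mul_assoc, ← Units.val_mul f, mul_self_zpow, add_comm]
  have e₂ : stage₁ (f : R) g h₁ a * ↑(g ^ (a + c + 2)) =
      ↑(g ^ (a + c)) * stage₂ (f : R) g h₁ h₂ h₃ a (a + c) := by
    have h := mul_zpow_of_shift g (stage₂ (f : R) g h₁ h₂ h₃ a) (stage₂_shift r _) (a + c)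
    push_cast at h
    rw [← h, stage₂_zero r, mul_assoc, ← Units.val_pow_eq_pow_val, ← Units.val_mul,
      ← zpow_natCast, ← zpow_add, add_comm]
    rfl
  simp only [Units.val_mul]
  rw [e₁, mul_assoc _ (stage₁ _ _ _ _), e₂, ← mul_assoc, mul_assoc _ (stage₂ _ _ _ _ _ _ _),
    stage₂_mul_zpow r, ← mul_assoc, mul_assoc _ (stage₃ _ _ _ _ _ _ _ _), stage₃_mul_zpow r,
    ← mul_assoc]

theorem zpow_mul_translator_comm (r : RootVectors (f : R) g h₁ h₂ h₃ k) (a c : ℤ) :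
    ↑(f ^ (a - c)) * translator (f : R) g h₁ h₂ h₃ k a c =
      translator (f : R) g h₁ h₂ h₃ k c a * ↑(f ^ (a - c)) := by
  have h := mul_zpow_of_shift f (fun s ↦ conjTranslator (f : R) g h₁ h₂ h₃ k a c (a - c - s))
    (fun s ↦ by rw [conjTranslator_shift r]; congr 2; ring) (a - c)
  push_cast at h
  rw [sub_self, sub_zero, conjTranslator_zero r, conjTranslator_eq r, mul_assoc,
    ← Units.val_pow_eq_pow_val, ← Units.val_mul, (((Commute.refl f).pow_left 2).zpow_right _).eq,
    Units.val_mul, ← mul_assoc, ← mul_assoc, Units.mul_left_inj] at h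
  exact h.symm

theorem translation_quotient_eq (r : RootVectors (f : R) g h₁ h₂ h₃ k) (m n : ℤ) :
    (f ^ m * g ^ (3 * m + n) * f ^ (2 * m + n) * g ^ (3 * m + 2 * n) * f ^ (m + n) * g ^ n)⁻¹ *
      (f ^ m * g ^ (3 * m + (n + 1)) * f ^ (2 * m + (n + 1)) * g ^ (3 * m + 2 * (n + 1)) *
        f ^ (m + (n + 1)) * g ^ (n + 1)) =
    (g ^ n * f ^ (m + n) * g ^ (3 * m + 2 * n) * f ^ (2 * m + n) * g ^ (3 * m + n) * f ^ m)⁻¹ *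
      (g ^ (n + 1) * f ^ (m + (n + 1)) * g ^ (3 * m + 2 * (n + 1)) * f ^ (2 * m + (n + 1)) *
        g ^ (3 * m + (n + 1)) * f ^ m) := by
  have hX := zpow_mul_translator r (2 * m + n) (m + n)
  have hY := zpow_mul_translator r (m + n) (2 * m + n)
  have hC := zpow_mul_translator_comm r (2 * m + n) (m + n)
  have e₁ : 2 * m + n + (m + n) = 3 * m + 2 * n := by ring
  have e₂ : m + n + (2 * m + n) = 3 * m + 2 * n := by ring
  have e₃ : 2 * (m + n) - (2 * m + n) = n := by ring
  have e₄ : 2 * (2 * m + n) - (m + n) = 3 * m + n := by ring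
  have e₅ : 2 * m + n - (m + n) = m := by ring
  have quotient {x y : Rˣ} {t : R} (h : (x : R) = ↑y * t) : t = ↑(y⁻¹ * x) := by
    rw [Units.val_mul, h, Units.inv_mul_cancel_left]
  rw [e₁, e₃] at hX
  rw [e₂, e₄] at hY
  rw [e₅, quotient hX, quotient hY, ← Units.val_mul, ← Units.val_mul, Units.val_inj,
    ← eq_inv_mul_iff_mul_eq] at hC
  have e₆ : 3 * m + 2 * (n + 1) = 3 * m + 2 * n + 2 := by ring
  rw [e₆, ← add_assoc, ← add_assoc, ← add_assoc, zpow_add_one g (3 * m + n)]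
  calc
    _ = _ := by group
    _ = _ := hC
    _ = _ := by group

end Units

end VermaG2

/-- Verma identity for the rank-2 GCM with `a₁₂ = -1`, `a₂₁ = -3`. -/
theorem verma_identity_G2 (R : Type*) [Ring R] [Algebra ℚ R] (f g : Rˣ)
    (hf : (f : R) ^ 2 * (g : R) - 2 * ((f : R) * (g : R) * (f : R)) + (g : R) * (f : R) ^ 2 = 0)
    (hg : (g : R) ^ 4 * (f : R) - 4 * ((g : R) ^ 3 * (f : R) * (g : R))
        + 6 * ((g : R) ^ 2 * (f : R) * (g : R) ^ 2)
        - 4 * ((g : R) * (f : R) * (g : R) ^ 3) + (f : R) * (g : R) ^ 4 = 0)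
    (m n : ℤ) :
    f ^ m * g ^ (3 * m + n) * f ^ (2 * m + n) * g ^ (3 * m + 2 * n) * f ^ (m + n) * g ^ n
      = g ^ n * f ^ (m + n) * g ^ (3 * m + 2 * n) * f ^ (2 * m + n) * g ^ (3 * m + n) * f ^ m := by
  have r := VermaG2.RootVectors.of_serre hf hg
  have step (i : ℤ) := VermaG2.translation_quotient_eq r m i
  induction n using Int.induction_on with
  | zero => simp [mul_assoc]
  | succ i ih =>
    have h := step i
    rwa [ih, mul_right_inj] at h
  | pred i ih =>
    have h := step (-i - 1)
    rwa [sub_add_cancel, ih, mul_left_inj, inv_inj] at h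
end

section
/- Let F = ℚ(q) be the field of rational functions in one indeterminate q over ℚ, let R be an associative unital F-algebra, and let f, g be invertible elements of R satisfying the q-Serre relations of the rank-2 generalized Cartan matrix with a_{12} = a_{21} = −1, namely f²g − (q + q^{−1})fgf + gf² = 0 and g²f − (q + q^{−1})gfg + fg² = 0. Then for all integers m, n one has the quantum Verma identity f^m g^{m+n} f^n = g^n f^{m+n} g^m. -/
/-- Conjugation by `f` preserves the subalgebra generated by `f * g` and `g * f`
when `f` and `g` satisfy the `q`-Serre relation `f²g - c fgf + gf² = 0`. -/
theorem conj_mem_adjoin_of_serre {K R : Type*} [CommRing K] [Ring R] [Algebra K R] (f g : Rˣ)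
    (c : K) (hf : (f : R) ^ 2 * (g : R) - c • ((f : R) * (g : R) * (f : R))
      + (g : R) * (f : R) ^ 2 = 0)
    {x : R} (hx : x ∈ Algebra.adjoin K {(f : R) * g, (g : R) * f}) :
    (f : R) * x * (f⁻¹ : Rˣ) ∈ Algebra.adjoin K {(f : R) * g, (g : R) * f} := by
  have ha : (f : R) * g ∈ Algebra.adjoin K {(f : R) * g, (g : R) * f} :=
    Algebra.subset_adjoin (by simp)
  have hb : (g : R) * f ∈ Algebra.adjoin K {(f : R) * g, (g : R) * f} :=
    Algebra.subset_adjoin (by simp)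
  induction hx using Algebra.adjoin_induction with
  | mem x hx =>
    rcases hx with rfl | rfl
    · have h : (f : R) * (f * g) * (f⁻¹ : Rˣ) = c • ((f : R) * g) - g * f := by
        rw [Units.mul_inv_eq_iff_eq_mul, sub_mul, smul_mul_assoc, ← sub_eq_zero, ← hf]
        noncomm_ring
      rw [h]
      exact sub_mem (Subalgebra.smul_mem _ ha c) hb
    · have h : (f : R) * (g * f) * (f⁻¹ : Rˣ) = f * g := by
        rw [Units.mul_inv_eq_iff_eq_mul, mul_assoc]
      rwa [h]
  | algebraMap r =>
    rw [← Algebra.commutes, mul_assoc, Units.mul_inv, mul_one]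
    exact Subalgebra.algebraMap_mem _ r
  | add x y _ _ hx hy =>
    rw [mul_add, add_mul]
    exact add_mem hx hy
  | mul x y _ _ hx hy =>
    have h : (f : R) * (x * y) * (f⁻¹ : Rˣ) = (f * x * (f⁻¹ : Rˣ)) * (f * y * (f⁻¹ : Rˣ)) := by
      simp [mul_assoc]
    rw [h]
    exact mul_mem hx hy

theorem pow_mul_pow_mem_adjoin_of_serre {K R : Type*} [CommRing K] [Ring R] [Algebra K R]
    (f g : Rˣ) (c : K) (hf : (f : R) ^ 2 * (g : R) - c • ((f : R) * (g : R) * (f : R))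
      + (g : R) * (f : R) ^ 2 = 0) (n : ℕ) :
    (f : R) ^ n * (g : R) ^ n ∈ Algebra.adjoin K {(f : R) * g, (g : R) * f} := by
  induction n with
  | zero => simp
  | succ n ih =>
    have h : (f : R) ^ (n + 1) * (g : R) ^ (n + 1)
        = (f * ((f : R) ^ n * (g : R) ^ n) * (f⁻¹ : Rˣ)) * (f * g) := by
      rw [pow_succ', pow_succ]
      simp [mul_assoc]
    rw [h]
    exact mul_mem (conj_mem_adjoin_of_serre f g c hf ih) (Algebra.subset_adjoin (by simp))

theorem commute_mul_mul_swap_of_serre {K R : Type*} [CommRing K] [Ring R] [Algebra K R]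
    (f g : R) (c : K) (hf : f ^ 2 * g - c • (f * g * f) + g * f ^ 2 = 0)
    (hg : g ^ 2 * f - c • (g * f * g) + f * g ^ 2 = 0) :
    Commute (f * g) (g * f) := by
  have h₁ : f * (g ^ 2 * f - c • (g * f * g) + f * g ^ 2)
      - (f ^ 2 * g - c • (f * g * f) + g * f ^ 2) * g = 0 := by simp [hf, hg]
  simp only [mul_add, mul_sub, add_mul, sub_mul, mul_smul_comm, smul_mul_assoc] at h₁
  rw [commute_iff_eq, ← sub_eq_zero, ← h₁]
  simp only [pow_two, mul_assoc]
  abel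

theorem commute_pow_mul_pow_of_serre {K R : Type*} [CommRing K] [Ring R] [Algebra K R]
    (f g : Rˣ) (c : K) (hf : (f : R) ^ 2 * (g : R) - c • ((f : R) * (g : R) * (f : R))
      + (g : R) * (f : R) ^ 2 = 0)
    (hg : (g : R) ^ 2 * (f : R) - c • ((g : R) * (f : R) * (g : R))
      + (f : R) * (g : R) ^ 2 = 0) (m n : ℕ) :
    Commute (f ^ m * g ^ m) (g ^ n * f ^ n) := by
  have hab := commute_mul_mul_swap_of_serre (f : R) (g : R) c hf hg
  have hm := pow_mul_pow_mem_adjoin_of_serre f g c hf m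
  have hn := pow_mul_pow_mem_adjoin_of_serre g f c hg n
  rw [Set.pair_comm] at hn
  have h : Commute ((f : R) ^ m * (g : R) ^ m) ((g : R) ^ n * (f : R) ^ n) := by
    refine Algebra.commute_of_mem_adjoin_of_forall_mem_commute hn fun y hy => ?_
    refine (Algebra.commute_of_mem_adjoin_of_forall_mem_commute hm fun z hz => ?_).symm
    rcases hy with rfl | rfl <;> rcases hz with rfl | rfl
    exacts [Commute.refl _, hab, hab.symm, Commute.refl _]
  exact Units.ext (by simpa using h.eq)

/-- In a group, the Verma identities for nonnegative exponents imply those for all integers. -/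
theorem zpow_verma_of_pow_verma {G : Type*} [Group G] (f g : G)
    (h : ∀ m n : ℤ, 0 ≤ m → 0 ≤ n →
      f ^ m * g ^ (m + n) * f ^ n = g ^ n * f ^ (m + n) * g ^ m) (m n : ℤ) :
    f ^ m * g ^ (m + n) * f ^ n = g ^ n * f ^ (m + n) * g ^ m := by
  have reflect_left : ∀ a b : ℤ,
      f ^ (-a) * g ^ (-a + (a + b)) * f ^ (a + b) = g ^ (a + b) * f ^ (-a + (a + b)) * g ^ (-a) →
      f ^ a * g ^ (a + b) * f ^ b = g ^ b * f ^ (a + b) * g ^ a := by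
    intro a b hab
    rw [neg_add_cancel_left, zpow_neg, zpow_neg, eq_mul_inv_iff_mul_eq] at hab
    simp only [mul_assoc] at hab ⊢
    rw [inv_mul_eq_iff_eq_mul] at hab
    exact hab.symm
  have reflect_right : ∀ a b : ℤ,
      f ^ (a + b) * g ^ (a + b + -b) * f ^ (-b) = g ^ (-b) * f ^ (a + b + -b) * g ^ (a + b) →
      f ^ a * g ^ (a + b) * f ^ b = g ^ b * f ^ (a + b) * g ^ a := by
    intro a b hab
    rw [add_neg_cancel_right, zpow_neg, zpow_neg, mul_inv_eq_iff_eq_mul] at hab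
    simp only [mul_assoc] at hab ⊢
    rw [eq_inv_mul_iff_mul_eq] at hab
    exact hab.symm
  rcases le_total 0 m with hm | hm <;> rcases le_total 0 n with hn | hn
  · exact h m n hm hn
  · apply reflect_right
    rcases le_total 0 (m + n) with hmn | hmn
    · exact h _ _ hmn (by lia)
    · apply reflect_left
      exact h _ _ (by lia) (by lia)
  · apply reflect_left
    rcases le_total 0 (m + n) with hmn | hmn
    · exact h _ _ (by lia) hmn
    · apply reflect_right
      exact h _ _ (by lia) (by lia)
  · have key := congrArg (·⁻¹) (h (-n) (-m) (by lia) (by lia))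
    simpa [mul_assoc, ← zpow_neg, add_comm] using key

/-- Quantum Verma identity for the rank-2 GCM with `a₁₂ = a₂₁ = -1`,
over the field `F = ℚ(q)` of rational functions. -/
theorem quantum_verma_identity_A2 (R : Type*) [Ring R] [Algebra (RatFunc ℚ) R] (f g : Rˣ)
    (q : RatFunc ℚ) (hq : q = RatFunc.X)
    (hf : (f : R) ^ 2 * (g : R) - (q + q⁻¹) • ((f : R) * (g : R) * (f : R))
        + (g : R) * (f : R) ^ 2 = 0)
    (hg : (g : R) ^ 2 * (f : R) - (q + q⁻¹) • ((g : R) * (f : R) * (g : R))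
        + (f : R) * (g : R) ^ 2 = 0)
    (m n : ℤ) :
    f ^ m * g ^ (m + n) * f ^ n = g ^ n * f ^ (m + n) * g ^ m := by
  refine zpow_verma_of_pow_verma f g (fun a b ha hb => ?_) m n
  lift a to ℕ using ha
  lift b to ℕ using hb
  have h := (commute_pow_mul_pow_of_serre f g (q + q⁻¹) hf hg a b).eq
  norm_cast
  rw [pow_add, add_comm a b, pow_add]
  simpa only [mul_assoc] using h
end

section
/- Let F = ℚ(q) be the field of rational functions in one indeterminate q over ℚ, let R be an associative unital F-algebra, and let f, g be invertible elements of R satisfying the q-Serre relations of the rank-2 generalized Cartan matrix with a_{12} = −1, a_{21} = −2 (symmetrized by d₁ = 2, d₂ = 1), namely f²g − (q² + q^{−2})fgf + gf² = 0 and g³f − (q² + 1 + q^{−2})g²fg + (q² + 1 + q^{−2})gfg² − fg³ = 0. Then for all integers m, n one has the quantum Verma identity f^m g^{2m+n} f^{m+n} g^n = g^n f^{m+n} g^{2m+n} f^m. -/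
section QSerreB2

variable {K R : Type*} [Field K] [Ring R] [Algebra K R]

/-- If a unit `g` scales `x` by `c` under conjugation, then `g ^ n` scales it by `c ^ n`. -/
theorem zpow_mul_eq_smul {g : Rˣ} {x : R} {c : K} (hc : c ≠ 0)
    (h : (g : R) * x = c • (x * g)) (n : ℤ) :
    ((g ^ n : Rˣ) : R) * x = c ^ n • (x * ((g ^ n : Rˣ) : R)) := by
  have hinv : ((g⁻¹ : Rˣ) : R) * x = c⁻¹ • (x * ((g⁻¹ : Rˣ) : R)) := by
    rw [Units.inv_mul_eq_iff_eq_mul, mul_smul_comm, ← mul_assoc, h, smul_mul_assoc,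
      mul_assoc, Units.mul_inv, mul_one, smul_smul, inv_mul_cancel₀ hc, one_smul]
  induction n with
  | zero => simp
  | succ n ih =>
    rw [zpow_add_one, Units.val_mul, mul_assoc, h, mul_smul_comm, ← mul_assoc, ih,
      smul_mul_assoc, smul_smul, mul_assoc, zpow_add_one₀ hc, mul_comm]
  | pred n ih =>
    rw [zpow_sub_one, Units.val_mul, mul_assoc, hinv, mul_smul_comm, ← mul_assoc, ih,
      smul_mul_assoc, smul_smul, mul_assoc, zpow_sub_one₀ hc, mul_comm]

/-- The relations satisfied by the `f`-eigencomponents `u`, `v` of `g * f` (up to a common factor)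
and by the `g`-invariant element `e` arising from conjugating them by `g`. -/
structure SerreEigen (Q : K) (f g : Rˣ) (u v e : R) : Prop where
  f_u : (f : R) * u = Q • (u * f)
  f_v : (f : R) * v = Q⁻¹ • (v * f)
  g_f : (Q - Q⁻¹) • ((g : R) * f) = u + v
  u_g : u * (g : R) = g * (Q • u + e)
  v_g : v * (g : R) = g * (Q⁻¹ • v - e)
  e_g : (g : R) * e = e * g

theorem SerreEigen.exists_of_serre {Q : K} (hQ : Q ≠ 0) {f g : Rˣ}
    (hf : (f : R) * f * g - (Q + Q⁻¹) • ((f : R) * g * f) + (g : R) * f * f = 0)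
    (hg : (g : R) * g * g * f - (Q + 1 + Q⁻¹) • ((g : R) * g * f * g)
      + (Q + 1 + Q⁻¹) • ((g : R) * f * g * g) - (f : R) * g * g * g = 0) :
    ∃ u v e : R, SerreEigen Q f g u v e := by
  obtain ⟨u, hu⟩ : ∃ u : R, u = (f : R) * g - Q⁻¹ • ((g : R) * f) := ⟨_, rfl⟩
  obtain ⟨v, hv⟩ : ∃ v : R, v = Q • ((g : R) * f) - (f : R) * g := ⟨_, rfl⟩
  obtain ⟨e, he⟩ : ∃ e : R, e = ((g⁻¹ : Rˣ) : R) * (u * g) - Q • u := ⟨_, rfl⟩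
  have hge : (g : R) * e = u * g - Q • ((g : R) * u) := by
    rw [he, mul_sub, Units.mul_inv_cancel_left, mul_smul_comm]
  refine ⟨u, v, e, ?_, ?_, ?_, ?_, ?_, ?_⟩
  · rw [hu]
    linear_combination (norm := skip) hf
    simp only [mul_sub, sub_mul, smul_mul_assoc, mul_smul_comm, smul_sub, smul_smul, mul_assoc]
    match_scalars <;> field_simp <;> ring
  · rw [hv]
    linear_combination (norm := skip) -hf
    simp only [mul_sub, sub_mul, smul_mul_assoc, mul_smul_comm, smul_sub, smul_smul, mul_assoc]
    match_scalars <;> field_simp <;> ring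
  · rw [hu, hv]; module
  · rw [mul_add, hge, mul_smul_comm]; abel
  · rw [mul_sub, hge, hu, hv]
    simp only [mul_sub, sub_mul, smul_mul_assoc, mul_smul_comm, smul_sub, smul_smul, mul_assoc]
    match_scalars <;> field_simp <;> ring
  · rw [← Units.mul_right_inj g, ← mul_assoc (g : R) e, hge, hu]
    linear_combination (norm := skip) hg
    simp only [mul_sub, sub_mul, smul_mul_assoc, mul_smul_comm, smul_sub, smul_smul, mul_assoc]
    match_scalars <;> field_simp <;> ring

namespace SerreEigen

variable {Q : K} {f g : Rˣ} {u v e : R}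

theorem e_mul (h : SerreEigen Q f g u v e) : e * (u + v) = u * v - v * u := by
  have h1 : e * ((g : R) * f) = u * (g * f) - g * f * u := by
    rw [← mul_assoc, ← h.e_g, mul_assoc (g : R) f u, h.f_u, ← mul_assoc, h.u_g]
    simp only [mul_add, add_mul, smul_mul_assoc, mul_smul_comm, mul_assoc]
    have := congrArg (· * (f : R)) h.e_g
    simp only [mul_assoc] at this
    abel
  rw [← h.g_f, mul_smul_comm, h1, smul_sub, ← mul_smul_comm, ← smul_mul_assoc _ _ u, h.g_f]
  noncomm_ring

theorem mul_e (hQ : Q ≠ 0) (h : SerreEigen Q f g u v e) :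
    (Q • u + Q⁻¹ • v) * e = u * v - v * u := by
  have h0 : (Q • u + Q⁻¹ • v) = (Q - Q⁻¹) • ((f : R) * g) := by
    rw [← Units.mul_left_inj f, smul_mul_assoc, mul_assoc, ← mul_smul_comm, h.g_f, mul_add, h.f_u,
      h.f_v, add_mul, smul_mul_assoc, smul_mul_assoc]
  have h1 : (f : R) * g * e = Q • (u * (f * g) - f * g * u) := by
    rw [mul_assoc, show (g : R) * e = u * g - Q • (g * u) by
      rw [h.u_g, mul_add, mul_smul_comm]; abel, mul_sub, ← mul_assoc, h.f_u]
    simp only [smul_sub, smul_mul_assoc, mul_smul_comm, mul_assoc]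
  rw [h0, smul_mul_assoc, h1, smul_comm, smul_sub, ← mul_smul_comm, ← smul_mul_assoc _ _ u, ← h0]
  simp only [mul_add, add_mul, smul_mul_assoc, mul_smul_comm, smul_sub, smul_add, smul_smul]
  match_scalars <;> field_simp
  ring

theorem add_mul_bracket (hQ : Q ≠ 0) (h : SerreEigen Q f g u v e) :
    (u + v) * (u * v - v * u) = (u * v - v * u) * (Q⁻¹ • u + Q • v) := by
  have h1 : (f : R) * (u + v) = (Q • u + Q⁻¹ • v) * f := by
    rw [mul_add, h.f_u, h.f_v, add_mul, smul_mul_assoc, smul_mul_assoc]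
  have h2 : (f : R) * (Q⁻¹ • u + Q • v) = (u + v) * f := by
    rw [mul_add, mul_smul_comm, mul_smul_comm, h.f_u, h.f_v, smul_smul, smul_smul,
      inv_mul_cancel₀ hQ, mul_inv_cancel₀ hQ, one_smul, one_smul, add_mul]
  have h3 : (f : R) * (u * v - v * u) = (u * v - v * u) * f := by
    rw [mul_sub, ← mul_assoc, ← mul_assoc, h.f_u, h.f_v, smul_mul_assoc, smul_mul_assoc, mul_assoc,
      mul_assoc, h.f_u, h.f_v, mul_smul_comm, mul_smul_comm, smul_smul, smul_smul,
      inv_mul_cancel₀ hQ, mul_inv_cancel₀ hQ, one_smul, one_smul, sub_mul, mul_assoc, mul_assoc]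
  rw [← Units.mul_right_inj f, ← mul_assoc, h1, mul_assoc, h3, ← mul_assoc (f : R), h3, mul_assoc,
    h2, ← mul_assoc, ← mul_assoc]
  congr 1
  nth_rw 1 [← h.e_mul]
  rw [← mul_assoc, h.mul_e hQ]

theorem u_bracket (hQ : Q ≠ 0) (hQ2 : Q - Q⁻¹ ≠ 0) (h : SerreEigen Q f g u v e) :
    u * (u * v - v * u) = Q⁻¹ • ((u * v - v * u) * u) ∧
      v * (u * v - v * u) = Q • ((u * v - v * u) * v) := by
  have hfu (x : R) : (f : R) * (u * x) = Q • (u * (f * x)) := by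
    rw [← mul_assoc, h.f_u, smul_mul_assoc, mul_assoc]
  have hfv (x : R) : (f : R) * (v * x) = Q⁻¹ • (v * (f * x)) := by
    rw [← mul_assoc, h.f_v, smul_mul_assoc, mul_assoc]
  have hs := h.add_mul_bracket hQ
  obtain ⟨x, hx⟩ : ∃ x, x = u * (u * v - v * u) - Q⁻¹ • ((u * v - v * u) * u) := ⟨_, rfl⟩
  have hy : -x = v * (u * v - v * u) - Q • ((u * v - v * u) * v) := by
    rw [hx]
    linear_combination (norm := skip) -hs
    simp only [mul_add, add_mul, mul_smul_comm]
    abel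
  have fx : (f : R) * x = Q • (x * f) := by
    rw [hx]
    simp only [mul_sub, sub_mul, mul_smul_comm, smul_mul_assoc, mul_assoc, hfu, hfv, h.f_u, h.f_v,
      smul_sub, smul_smul]
    match_scalars <;> field_simp
  have fy : (f : R) * -x = Q⁻¹ • (-x * f) := by
    rw [hy]
    simp only [mul_sub, sub_mul, mul_smul_comm, smul_mul_assoc, mul_assoc, hfu, hfv, h.f_u, h.f_v,
      smul_sub, smul_smul]
    match_scalars <;> field_simp
  have hx0 : x = 0 := by
    have : (Q - Q⁻¹) • (x * (f : R)) = 0 := by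
      rw [mul_neg, fx, neg_mul, smul_neg, neg_inj] at fy
      rw [sub_smul, fy, sub_self]
    rw [smul_eq_zero_iff_right hQ2] at this
    simpa using this
  rw [hx0] at hx hy
  exact ⟨sub_eq_zero.mp hx.symm, sub_eq_zero.mp (by rw [← hy, neg_zero])⟩

/-- The element `u * v - Q⁻¹ • (v * u)` commutes with `f` and `g`. -/
theorem central (hQ : Q ≠ 0) (hQ2 : Q - Q⁻¹ ≠ 0) (h : SerreEigen Q f g u v e) :
    Commute (f : R) (u * v - Q⁻¹ • (v * u)) ∧ Commute (g : R) (u * v - Q⁻¹ • (v * u)) := by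
  obtain ⟨hu, hv⟩ := h.u_bracket hQ hQ2
  obtain ⟨z, hz⟩ : ∃ z, z = u * v - Q⁻¹ • (v * u) := ⟨_, rfl⟩
  rw [← hz]
  have cu : u * z = z * u := by
    rw [hz]
    linear_combination (norm := skip) hu
    simp only [mul_sub, sub_mul, smul_mul_assoc, mul_smul_comm, smul_sub, mul_assoc]
    module
  have cv : v * z = z * v := by
    rw [hz]
    linear_combination (norm := skip) Q⁻¹ • hv
    simp only [mul_sub, sub_mul, smul_mul_assoc, mul_smul_comm, smul_sub, smul_smul, mul_assoc]
    match_scalars <;> field_simp <;> ring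
  have cf : (f : R) * z = z * f := by
    have fuv : (f : R) * (u * v) = u * v * f := by
      rw [← mul_assoc, h.f_u, smul_mul_assoc, mul_assoc, h.f_v, mul_smul_comm, smul_smul,
        mul_inv_cancel₀ hQ, one_smul, mul_assoc]
    have fvu : (f : R) * (v * u) = v * u * f := by
      rw [← mul_assoc, h.f_v, smul_mul_assoc, mul_assoc, h.f_u, mul_smul_comm, smul_smul,
        inv_mul_cancel₀ hQ, one_smul, mul_assoc]
    rw [hz, mul_sub, mul_smul_comm, fuv, fvu, sub_mul, smul_mul_assoc]
  refine ⟨cf, ?_⟩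
  have cgf : (g : R) * f * z = z * (g * f) := by
    have : (Q - Q⁻¹) • ((g : R) * f * z) = (Q - Q⁻¹) • (z * (g * f)) := by
      rw [← smul_mul_assoc _ _ z, ← mul_smul_comm _ z, h.g_f, add_mul, mul_add, cu, cv]
    exact (smul_right_inj hQ2).mp this
  change (g : R) * z = z * g
  rw [← Units.mul_left_inj f, mul_assoc, ← cf, ← mul_assoc, cgf, mul_assoc]

/-- Conjugation by powers of `g` on a combination of `u` and `v`. -/
theorem smul_add_smul_mul_zpow (hQ : Q ≠ 0) (hQ1 : Q - 1 ≠ 0) (h : SerreEigen Q f g u v e)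
    (a b : K) (n : ℤ) :
    (a • u + b • v) * ((g ^ n : Rˣ) : R) = ((g ^ n : Rˣ) : R) *
      ((a * Q ^ n) • u + (b * (Q ^ n)⁻¹) • v
        + ((a * (Q ^ n - 1) + b * Q * ((Q ^ n)⁻¹ - 1)) / (Q - 1)) • e) := by
  have hU : (g : R) * ((Q - 1) • u + e) = Q⁻¹ • (((Q - 1) • u + e) * g) := by
    simp only [add_mul, smul_mul_assoc, h.u_g, ← h.e_g, mul_add, mul_smul_comm, smul_add, smul_smul]
    match_scalars <;> field_simp
    ring
  have hV : (g : R) * ((Q - 1) • v + Q • e) = Q • (((Q - 1) • v + Q • e) * g) := by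
    simp only [add_mul, smul_mul_assoc, h.v_g, ← h.e_g, mul_add, mul_sub, mul_smul_comm, smul_add,
      smul_sub, smul_smul]
    match_scalars <;> field_simp
    ring
  have hE : (g : R) * e = (1 : K) • (e * g) := by rw [one_smul, h.e_g]
  have hU' := zpow_mul_eq_smul (inv_ne_zero hQ) hU n
  have hV' := zpow_mul_eq_smul hQ hV n
  have hE' := zpow_mul_eq_smul one_ne_zero hE n
  have hs : Q ^ n ≠ 0 := zpow_ne_zero n hQ
  rw [inv_zpow] at hU'
  rw [one_zpow, one_smul] at hE'
  generalize Q ^ n = s at *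
  generalize ((g ^ n : Rˣ) : R) = G at *
  simp only [mul_add, add_mul, mul_smul_comm, smul_mul_assoc, smul_add, smul_smul, hE']
    at hU' hV' ⊢
  linear_combination (norm := skip) (-(a * s / (Q - 1))) • hU' - (b * s⁻¹ / (Q - 1)) • hV'
  match_scalars <;> field_simp <;> ring

/-- Raising `m` by one multiplies the Verma monomial by a combination of the square of a centred
element and the central element. -/
theorem exists_smul_verma_succ (hQ : Q ≠ 0) (hQ1 : Q - 1 ≠ 0) (h : SerreEigen Q f g u v e)
    {a : K} {n : ℤ} (ha : a ^ 2 = Q * (Q ^ n)⁻¹) (m : ℤ) : ∃ κ : K,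
    (Q - Q⁻¹) ^ 2 • ((f ^ (m + 1) * g ^ (2 * (m + 1) + n) * f ^ (m + 1 + n) : Rˣ) : R) =
      ((f ^ m * g ^ (2 * m + n) * f ^ (m + n) : Rˣ) : R) *
        ((a • u + a⁻¹ • v) * (a • u + a⁻¹ • v) + κ • (u * v - Q⁻¹ • (v * u))) := by
  have hs : Q ^ n ≠ 0 := zpow_ne_zero n hQ
  have hσ : Q ^ (m + n) ≠ 0 := zpow_ne_zero _ hQ
  have hS : Q ^ (2 * m + n + 1) = Q * (Q ^ (m + n)) ^ 2 * (Q ^ n)⁻¹ := by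
    rw [← zpow_natCast, ← zpow_mul, ← zpow_neg, ← zpow_one_add₀ hQ, ← zpow_add₀ hQ]
    congr 1
    push_cast
    ring
  have key := h.smul_add_smul_mul_zpow hQ hQ1 1 1 (2 * m + n + 1)
  have hFu := zpow_mul_eq_smul hQ h.f_u (m + n)
  have hFv := zpow_mul_eq_smul (inv_ne_zero hQ) h.f_v (m + n)
  rw [inv_zpow] at hFv
  have hsplit : f ^ (m + 1) * g ^ (2 * (m + 1) + n) * f ^ (m + 1 + n) =
      f ^ m * g⁻¹ * ((g * f) * g ^ (2 * m + n + 1)) * ((g * f) * f ^ (m + n)) := by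
    group
  have hmerge : f ^ m * g ^ (2 * m + n) * f ^ (m + n) =
      f ^ m * g⁻¹ * g ^ (2 * m + n + 1) * f ^ (m + n) := by
    group
  have hY : (a • u + a⁻¹ • v) * (a • u + a⁻¹ • v) =
      (Q * (Q ^ n)⁻¹) • (u * u) + u * v + v * u + (Q⁻¹ * Q ^ n) • (v * v) := by
    have ha0 : a ≠ 0 := by
      rintro rfl
      simp [hQ, hs] at ha
    have ha' : a⁻¹ * a⁻¹ = Q⁻¹ * Q ^ n := by
      rw [← mul_inv, ← pow_two, ha, mul_inv, inv_inv]
    rw [← ha, ← ha']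
    simp only [mul_add, add_mul, mul_smul_comm, smul_mul_assoc]
    match_scalars <;> field_simp
  rw [hsplit, hmerge, hY]
  rw [hS] at key
  simp only [Units.val_mul]
  generalize Q ^ (m + n) = σ at *
  generalize Q ^ n = s at *
  generalize ((f ^ (m + n) : Rˣ) : R) = F at *
  generalize ((g ^ (2 * m + n + 1) : Rˣ) : R) = G at *
  generalize ((f ^ m : Rˣ) : R) * ((g⁻¹ : Rˣ) : R) = P at *
  set S := Q * σ ^ 2 * s⁻¹ with hSdef
  have hS0 : S ≠ 0 := by
    rw [hSdef]; positivity
  obtain ⟨η, hη⟩ : ∃ η, η = (1 * (S - 1) + 1 * Q * (S⁻¹ - 1)) / (Q - 1) := ⟨_, rfl⟩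
  rw [← hη] at key
  have hW : ((1 * S) • u + (1 * S⁻¹) • v + η • e) * (u + v) =
      (S • u + S⁻¹ • v) * (u + v) + η • (u * v - v * u) := by
    rw [add_mul, smul_mul_assoc η, h.e_mul, one_mul, one_mul]
  have hFu' (x : R) : F * (u * x) = σ • (u * (F * x)) := by
    rw [← mul_assoc, hFu, smul_mul_assoc, mul_assoc]
  have hFv' (x : R) : F * (v * x) = σ⁻¹ • (v * (F * x)) := by
    rw [← mul_assoc, hFv, smul_mul_assoc, mul_assoc]
  refine ⟨S + η - 1, ?_⟩
  have hF : ((S • u + S⁻¹ • v) * (u + v) + η • (u * v - v * u)) * F =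
      F * ((Q * s⁻¹) • (u * u) + u * v + v * u + (Q⁻¹ * s) • (v * v)
        + (S + η - 1) • (u * v - Q⁻¹ • (v * u))) := by
    simp only [mul_add, add_mul, mul_sub, sub_mul, mul_smul_comm, smul_mul_assoc, mul_assoc, hFu',
      hFv', hFu, hFv, smul_sub]
    clear_value S
    subst hη
    match_scalars
    · rw [hSdef]; field_simp
    · field_simp; ring
    · field_simp; ring
    · rw [hSdef]; field_simp
  calc _ = P * (((Q - Q⁻¹) • ((g : R) * f)) * G) * (((Q - Q⁻¹) • ((g : R) * f)) * F) := by
        simp only [mul_smul_comm, smul_mul_assoc, smul_smul, pow_two]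
    _ = P * (((1 : K) • u + (1 : K) • v) * G) * ((u + v) * F) := by
        rw [h.g_f, one_smul, one_smul]
    _ = P * G * ((((1 * S) • u + (1 * S⁻¹) • v + η • e) * (u + v)) * F) := by
        rw [key]; simp only [mul_assoc]
    _ = _ := by
        rw [hW, hF]; simp only [mul_assoc]

/-- The element of the linear span of `u`, `v` centred at `n` commutes with `g ^ n * f ^ n`. -/
theorem commute_zpow_mul_zpow (hQ : Q ≠ 0) (hQ1 : Q - 1 ≠ 0) (h : SerreEigen Q f g u v e)
    {a : K} {n : ℤ} (ha : a ^ 2 = Q * (Q ^ n)⁻¹) :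
    Commute (a • u + a⁻¹ • v) ((g ^ n * f ^ n : Rˣ) : R) := by
  have hs : Q ^ n ≠ 0 := zpow_ne_zero n hQ
  have ha0 : a ≠ 0 := by
    rintro rfl
    simp [hQ, hs] at ha
  have key := h.smul_add_smul_mul_zpow hQ hQ1 a a⁻¹ n
  have hFu := zpow_mul_eq_smul hQ h.f_u n
  have hFv := zpow_mul_eq_smul (inv_ne_zero hQ) h.f_v n
  rw [inv_zpow] at hFv
  have hzero : a * (Q ^ n - 1) + a⁻¹ * Q * ((Q ^ n)⁻¹ - 1) = 0 := by
    field_simp at ha ⊢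
    linear_combination (Q ^ n - 1) * ha
  rw [hzero, zero_div, zero_smul, add_zero] at key
  change _ * _ = _ * _
  rw [Units.val_mul, ← mul_assoc, key, mul_assoc, mul_assoc, mul_add, mul_smul_comm, mul_smul_comm,
    hFu, hFv, add_mul, smul_mul_assoc, smul_mul_assoc, smul_smul, smul_smul]

end SerreEigen

/-- The quantum Verma identity of type `B₂` over a field in which `q` is generic enough. -/
theorem quantum_verma_identity_B2_of_field {q : K} (hq : q ≠ 0) (hq2 : q ^ 2 - 1 ≠ 0)
    (hq4 : q ^ 2 - (q ^ 2)⁻¹ ≠ 0) {f g : Rˣ}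
    (hf : (f : R) * f * g - (q ^ 2 + (q ^ 2)⁻¹) • ((f : R) * g * f) + (g : R) * f * f = 0)
    (hg : (g : R) * g * g * f - (q ^ 2 + 1 + (q ^ 2)⁻¹) • ((g : R) * g * f * g)
      + (q ^ 2 + 1 + (q ^ 2)⁻¹) • ((g : R) * f * g * g) - (f : R) * g * g * g = 0)
    (m n : ℤ) :
    f ^ m * g ^ (2 * m + n) * f ^ (m + n) * g ^ n
      = g ^ n * f ^ (m + n) * g ^ (2 * m + n) * f ^ m := by
  have hQ : q ^ 2 ≠ 0 := pow_ne_zero 2 hq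
  obtain ⟨u, v, e, h⟩ := SerreEigen.exists_of_serre hQ hf hg
  have ha : (q * (q ^ n)⁻¹) ^ 2 = q ^ 2 * ((q ^ 2) ^ n)⁻¹ := by
    rw [mul_pow, inv_pow, ← zpow_natCast (q ^ n), ← zpow_natCast q, zpow_comm]
  have hY := h.commute_zpow_mul_zpow hQ hq2 ha
  obtain ⟨hzf, hzg⟩ := h.central hQ hq4
  have hZ : Commute (u * v - (q ^ 2)⁻¹ • (v * u)) ((g ^ n * f ^ n : Rˣ) : R) := by
    rw [Units.val_mul]
    exact (hzg.symm.units_zpow_right n).mul_right (hzf.symm.units_zpow_right n)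
  have hstep (m : ℤ) : Commute
      ((f ^ m * g ^ (2 * m + n) * f ^ (m + n))⁻¹ *
        (f ^ (m + 1) * g ^ (2 * (m + 1) + n) * f ^ (m + 1 + n))) (g ^ n * f ^ n) := by
    obtain ⟨κ, hκ⟩ := h.exists_smul_verma_succ hQ hq2 ha m
    rw [← Units.inv_mul_eq_iff_eq_mul, mul_smul_comm, ← Units.val_mul] at hκ
    have hc := (hY.mul_left hY).add_left (hZ.smul_left κ)
    rw [← hκ] at hc
    have hd := hc.smul_left ((q ^ 2 - (q ^ 2)⁻¹) ^ 2)⁻¹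
    rw [inv_smul_smul₀ (pow_ne_zero 2 hq4)] at hd
    exact Commute.units_of_val hd
  have hcomm (m : ℤ) :
      Commute (f ^ m * g ^ (2 * m + n) * f ^ (m + n)) (g ^ n * f ^ n) := by
    induction m with
    | zero => simp
    | succ k ih => simpa only [mul_inv_cancel_left] using ih.mul_left (hstep k)
    | pred k ih =>
      have hk := hstep (-k - 1)
      rw [sub_add_cancel] at hk
      have hc := ih.mul_left hk.inv_left
      rwa [mul_inv_rev, inv_inv, mul_inv_cancel_left] at hc
  have hm := (hcomm m).eq
  rw [← mul_left_inj (f ^ n)]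
  calc _ = f ^ m * g ^ (2 * m + n) * f ^ (m + n) * (g ^ n * f ^ n) := by group
    _ = _ := hm
    _ = _ := by group

end QSerreB2


/-- Quantum Verma identity for the rank-2 GCM with `a₁₂ = -1`, `a₂₁ = -2`
(symmetrized by `d₁ = 2`, `d₂ = 1`), over the field `F = ℚ(q)`. -/
theorem quantum_verma_identity_B2 (R : Type*) [Ring R] [Algebra (RatFunc ℚ) R] (f g : Rˣ)
    (q : RatFunc ℚ) (hq : q = RatFunc.X)
    (hf : (f : R) ^ 2 * (g : R)
        - (q ^ (2 : ℤ) + q ^ (-2 : ℤ)) • ((f : R) * (g : R) * (f : R))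
        + (g : R) * (f : R) ^ 2 = 0)
    (hg : (g : R) ^ 3 * (f : R)
        - (q ^ (2 : ℤ) + 1 + q ^ (-2 : ℤ)) • ((g : R) ^ 2 * (f : R) * (g : R))
        + (q ^ (2 : ℤ) + 1 + q ^ (-2 : ℤ)) • ((g : R) * (f : R) * (g : R) ^ 2)
        - (f : R) * (g : R) ^ 3 = 0)
    (m n : ℤ) :
    f ^ m * g ^ (2 * m + n) * f ^ (m + n) * g ^ n
      = g ^ n * f ^ (m + n) * g ^ (2 * m + n) * f ^ m := by
  subst hq
  have hpow (k : ℕ) (hk : k ≠ 0) : (RatFunc.X : RatFunc ℚ) ^ k ≠ 1 := fun hX => by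
    rw [← RatFunc.algebraMap_X, ← map_pow, map_eq_one_iff _ (RatFunc.algebraMap_injective ℚ)] at hX
    simpa [hk] using congrArg Polynomial.natDegree hX
  have hX2 : (RatFunc.X : RatFunc ℚ) ^ 2 - 1 ≠ 0 := sub_ne_zero.mpr (hpow 2 two_ne_zero)
  have hX4 : (RatFunc.X : RatFunc ℚ) ^ 2 - (RatFunc.X ^ 2)⁻¹ ≠ 0 := by
    rw [sub_ne_zero]
    intro hX
    have h4 := mul_inv_cancel₀ (pow_ne_zero 2 (RatFunc.X_ne_zero (K := ℚ)))
    rw [← hX, ← pow_add] at h4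
    exact hpow _ (by norm_num) h4
  have hz : (RatFunc.X : RatFunc ℚ) ^ (-2 : ℤ) = (RatFunc.X ^ 2)⁻¹ := by
    rw [zpow_neg]; norm_cast
  have hz' : (RatFunc.X : RatFunc ℚ) ^ (2 : ℤ) = RatFunc.X ^ 2 := by norm_cast
  rw [hz, hz'] at hf hg
  refine quantum_verma_identity_B2_of_field RatFunc.X_ne_zero hX2 hX4 ?_ ?_ m n
  · simpa only [pow_succ, pow_zero, one_mul, mul_assoc] using hf
  · simpa only [pow_succ, pow_zero, one_mul, mul_assoc] using hg
end

section
/- Let F = ℚ(q) be the field of rational functions in one indeterminate q over ℚ, let R be an associative unital F-algebra, and let f, g be invertible elements of R satisfying the q-Serre relations of the rank-2 generalized Cartan matrix with a_{12} = −1, a_{21} = −3 (symmetrized by d₁ = 3, d₂ = 1), namely f²g − (q³ + q^{−3})fgf + gf² = 0 and g⁴f − (q³ + q + q^{−1} + q^{−3})g³fg + (q² + q^{−2})(q² + 1 + q^{−2})g²fg² − (q³ + q + q^{−1} + q^{−3})gfg³ + fg⁴ = 0. Then for all integers m, n one has the quantum Verma identity f^m g^{3m+n} f^{2m+n} g^{3m+2n}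 f^{m+n} g^n = g^n f^{m+n} g^{3m+2n} f^{2m+n} g^{3m+n} f^m. -/
/-- The `q`-Serre relations of type `G₂` (`a₁₂ = -1`, `a₂₁ = -3`) for the pair `(f, g)`. -/
def QSerreG2 {K A : Type*} [Field K] [Ring A] [Algebra K A] (q : K) (f g : A) : Prop :=
  f ^ 2 * g - (q ^ (3 : ℤ) + q ^ (-3 : ℤ)) • (f * g * f) + g * f ^ 2 = 0 ∧
  g ^ 4 * f - (q ^ (3 : ℤ) + q + q ^ (-1 : ℤ) + q ^ (-3 : ℤ)) • (g ^ 3 * f * g)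
    + ((q ^ (2 : ℤ) + q ^ (-2 : ℤ)) * (q ^ (2 : ℤ) + 1 + q ^ (-2 : ℤ))) • (g ^ 2 * f * g ^ 2)
    - (q ^ (3 : ℤ) + q + q ^ (-1 : ℤ) + q ^ (-3 : ℤ)) • (g * f * g ^ 3) + f * g ^ 4 = 0

namespace QSerreG2

section Basic

variable {K A : Type*} [Field K] [Ring A] [Algebra K A] {q : K} {f g : A}

lemma inv (h : QSerreG2 q f g) : QSerreG2 q⁻¹ f g := by
  obtain ⟨h₁, h₂⟩ := h
  have e : ∀ k : ℤ, q⁻¹ ^ k = q ^ (-k) := fun k => by rw [inv_zpow, zpow_neg]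
  constructor
  · rw [← h₁]; simp only [e, neg_neg]; module
  · rw [← h₂]; simp only [e, neg_neg, zpow_neg_one, zpow_one]; module

set_option maxHeartbeats 1000000 in
/-- The upper triangular matrices attached to the first skew derivation satisfy the relations. -/
lemma triangular_left (hq : q ≠ 0) (h : QSerreG2 q f g) :
    QSerreG2 q !![f, 1; 0, q ^ (-6 : ℤ) • f] !![g, 0; 0, q ^ (3 : ℤ) • g] := by
  obtain ⟨h₁, h₂⟩ := h
  constructor
  · ext i j
    fin_cases i <;> fin_cases j <;>
      simp [pow_succ, mul_assoc, smul_smul, add_mul, mul_add]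
    · simpa [pow_succ, mul_assoc, smul_smul, add_mul, mul_add] using h₁
    · match_scalars <;> field_simp <;> ring
    · simp only [pow_succ, pow_zero, one_mul, mul_assoc] at h₁
      refine Eq.trans ?_ ((congrArg ((q ^ (-9 : ℤ)) • ·) h₁).trans (smul_zero _))
      match_scalars <;> field_simp
  · ext i j
    fin_cases i <;> fin_cases j <;>
      simp [pow_succ, mul_assoc, smul_smul, add_mul, mul_add]
    · simpa [pow_succ, mul_assoc, smul_smul, add_mul, mul_add] using h₂
    · match_scalars
      field_simp
      ring
    · simp only [pow_succ, pow_zero, one_mul, mul_assoc] at h₂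
      refine Eq.trans ?_ ((congrArg ((q ^ (6 : ℤ)) • ·) h₂).trans (smul_zero _))
      match_scalars <;> field_simp

set_option maxHeartbeats 1000000 in
/-- The upper triangular matrices attached to the second skew derivation satisfy the relations. -/
lemma triangular_right (hq : q ≠ 0) (h : QSerreG2 q f g) :
    QSerreG2 q !![f, 0; 0, q ^ (3 : ℤ) • f] !![g, 1; 0, q ^ (-2 : ℤ) • g] := by
  obtain ⟨h₁, h₂⟩ := h
  constructor
  · ext i j
    fin_cases i <;> fin_cases j <;>
      simp [pow_succ, mul_assoc, smul_smul, add_mul]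
    · simpa [pow_succ, mul_assoc, smul_smul, add_mul, mul_add] using h₁
    · match_scalars
      field_simp
      ring
    · simp only [pow_succ, pow_zero, one_mul, mul_assoc] at h₁
      refine Eq.trans ?_ ((congrArg ((q ^ (4 : ℤ)) • ·) h₁).trans (smul_zero _))
      match_scalars <;> field_simp
  · ext i j
    fin_cases i <;> fin_cases j <;>
      simp [pow_succ, mul_assoc, smul_smul, add_mul, mul_add]
    · simpa [pow_succ, mul_assoc, smul_smul, add_mul, mul_add] using h₂
    · match_scalars <;> field_simp <;> ring
    · simp only [pow_succ, pow_zero, one_mul, mul_assoc] at h₂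
      refine Eq.trans ?_ ((congrArg ((q ^ (-5 : ℤ)) • ·) h₂).trans (smul_zero _))
      match_scalars <;> field_simp

end Basic
end QSerreG2

lemma sum_inv_pow_mul {K : Type*} [Field K] {ρ : K} (hρ : ρ ≠ 0) (k : ℕ) :
    (∑ i ∈ Finset.range (k + 1), ρ⁻¹ ^ i) * ρ ^ k = ∑ i ∈ Finset.range (k + 1), ρ ^ i := by
  rw [← Finset.sum_range_reflect, Finset.sum_mul]
  refine Finset.sum_congr rfl fun i hi => ?_
  have : i ≤ k := by simpa [Nat.lt_succ_iff] using hi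
  obtain ⟨j, rfl⟩ := Nat.exists_eq_add_of_le this
  have : i + j + 1 - 1 - i = j := by omega
  rw [this, pow_add, inv_pow]
  field_simp

/-- A left Ore condition for `x` on a generating subspace propagates to its powers. -/
lemma exists_mul_pow_eq_pow_mul {K A : Type*} [Field K] [Ring A] [Algebra K A] {x : A}
    {V : Submodule K A} {r : ℕ}
    (hO : ∀ k, ∀ v ∈ V, ∃ w ∈ V ^ (r + 1), v * x ^ (k + r) = x ^ k * w) (N k : ℕ) {u : A}
    (hu : u ∈ V ^ N) : ∃ w ∈ V ^ (N + r * N), u * x ^ (k + r * N) = x ^ k * w := by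
  induction N generalizing u with
  | zero =>
    rw [pow_zero, Submodule.mem_one] at hu
    obtain ⟨c, rfl⟩ := hu
    exact ⟨algebraMap K A c, by simp, by simp [Algebra.commutes]⟩
  | succ N ih =>
    rw [pow_succ] at hu
    induction hu using Submodule.mul_induction_on' with
    | mem_mul_mem u hu v hv =>
      obtain ⟨w₁, hw₁, e₁⟩ := hO (k + r * N) v hv
      obtain ⟨w₂, hw₂, e₂⟩ := ih hu
      refine ⟨w₂ * w₁, ?_, ?_⟩
      · rw [show N + 1 + r * (N + 1) = (N + r * N) + (r + 1) by ring, pow_add]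
        exact Submodule.mul_mem_mul hw₂ hw₁
      · rw [mul_add_one, ← add_assoc, mul_assoc, e₁, ← mul_assoc, e₂, mul_assoc]
    | add a _ b _ ha hb =>
      obtain ⟨w₁, hw₁, e₁⟩ := ha
      obtain ⟨w₂, hw₂, e₂⟩ := hb
      exact ⟨w₁ + w₂, add_mem hw₁ hw₂, by rw [add_mul, e₁, e₂, mul_add]⟩

/-- A linear map `d` with `d (x * y) = d x * τ y + x * d y` for an algebra endomorphism `τ`. -/
structure SkewDerivation (K A : Type*) [Field K] [Ring A] [Algebra K A] where
  /-- the underlying linear map -/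
  toLin : A →ₗ[K] A
  /-- the twisting endomorphism -/
  twist : A →ₐ[K] A
  leibniz : ∀ x y, toLin (x * y) = toLin x * twist y + x * toLin y

namespace SkewDerivation

variable {K A : Type*} [Field K] [Ring A] [Algebra K A]

/-- `D` is a skew derivation with `x ↦ 1`, `y ↦ 0` whose twist scales `x` by `ρ` and `y` by `σ`. -/
structure Adapted (D : SkewDerivation K A) (x y : A) (ρ σ : K) : Prop where
  map_left : D.toLin x = 1
  map_right : D.toLin y = 0
  twist_left : D.twist x = ρ • x
  twist_right : D.twist y = σ • y

lemma map_one (D : SkewDerivation K A) : D.toLin 1 = 0 := by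
  have h := D.leibniz 1 1
  simpa using h

namespace Adapted

variable {D D' : SkewDerivation K A} {x y : A} {ρ σ : K}

lemma map_pow_succ (h : D.Adapted x y ρ σ) (j : ℕ) :
    D.toLin (x ^ (j + 1)) = (∑ i ∈ Finset.range (j + 1), ρ ^ i) • x ^ j := by
  induction j with
  | zero => simp [h.map_left]
  | succ j ih =>
    rw [pow_succ', D.leibniz, ih, h.map_left, map_pow, h.twist_left, smul_pow, one_mul,
      Finset.sum_range_succ _ (j + 1), mul_smul_comm, ← pow_succ', add_smul, add_comm]

lemma twist_pow (h : D.Adapted x y ρ σ) (j : ℕ) : D.twist (x ^ j) = ρ ^ j • x ^ j := by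
  rw [map_pow, h.twist_left, smul_pow]

lemma map_pow_mul_right (h : D.Adapted x y ρ σ) (k : ℕ) (z : A) :
    D.toLin (y ^ k * z) = y ^ k * D.toLin z := by
  induction k generalizing z with
  | zero => simp
  | succ k ih => rw [pow_succ, mul_assoc, ih, D.leibniz, h.map_right]; simp [mul_assoc]

lemma map_mem_pow (h : D.Adapted x y ρ σ) {V : Submodule K A}
    (hV : V = Submodule.span K {x, y}) (N : ℕ) {z : A} (hz : z ∈ V ^ (N + 1)) :
    D.toLin z ∈ V ^ N := by
  have hV₁ : ∀ v ∈ V, D.toLin v ∈ (1 : Submodule K A) ∧ D.twist v ∈ V := by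
    intro v hv
    rw [hV] at hv
    have hx : x ∈ V := hV ▸ Submodule.subset_span (by simp)
    have hy : y ∈ V := hV ▸ Submodule.subset_span (by simp)
    induction hv using Submodule.span_induction with
    | mem v hv =>
      rcases hv with rfl | rfl
      · exact ⟨by rw [h.map_left]; exact Submodule.one_le.mp le_rfl,
          by rw [h.twist_left]; exact V.smul_mem _ hx⟩
      · exact ⟨by rw [h.map_right]; exact Submodule.zero_mem _,
          by rw [h.twist_right]; exact V.smul_mem _ hy⟩
    | zero => simp
    | add a b _ _ ha hb =>
      exact ⟨by rw [map_add]; exact add_mem ha.1 hb.1, by rw [map_add]; exact add_mem ha.2 hb.2⟩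
    | smul c a _ ha =>
      exact ⟨by rw [map_smul]; exact Submodule.smul_mem _ _ ha.1,
        by rw [map_smul]; exact Submodule.smul_mem _ _ ha.2⟩
  induction N generalizing z with
  | zero =>
    rw [zero_add, pow_one] at hz
    rw [pow_zero]
    exact (hV₁ z hz).1
  | succ N ih =>
    rw [pow_succ] at hz
    induction hz using Submodule.mul_induction_on' with
    | mem_mul_mem u hu v hv =>
      rw [D.leibniz]
      refine add_mem ?_ ?_
      · rw [pow_succ]
        exact Submodule.mul_mem_mul (ih hu) (hV₁ v hv).2
      · have := Submodule.mul_mem_mul hu (hV₁ v hv).1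
        rwa [mul_one] at this
    | add a _ b _ ha hb => rw [map_add]; exact add_mem ha hb

/-- The `q`-commutator of `E = κ D - κ⁻¹ D'` with a power of `x` vanishes on vectors of the
appropriate weight. -/
lemma singular_pow_mul (hD : D.Adapted x y ρ σ) (hD' : D'.Adapted x y ρ⁻¹ σ⁻¹) (hρ : ρ ≠ 0)
    {κ w : K} (hκ : κ ≠ 0) (hw : w ≠ 0) {k : ℕ} (hk : (κ * w) ^ 2 * ρ ^ k = ρ) {z : A}
    (hz : D.twist z = w • z) (hz' : D'.twist z = w⁻¹ • z) :
    κ • D.toLin (x ^ k * z) - κ⁻¹ • D'.toLin (x ^ k * z)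
      = x ^ k * (κ • D.toLin z - κ⁻¹ • D'.toLin z) := by
  cases k with
  | zero => simp
  | succ k =>
    have hs := sum_inv_pow_mul hρ k
    have hk' : (κ * w) ^ 2 * ρ ^ k = 1 :=
       mul_right_cancel₀ hρ (by linear_combination hk)
    rw [D.leibniz, D'.leibniz, hD.map_pow_succ, hD'.map_pow_succ, hz, hz', ← hs]
    set s := ∑ i ∈ Finset.range (k + 1), ρ⁻¹ ^ i
    simp only [smul_mul_assoc, mul_smul_comm, smul_add, smul_smul, mul_sub]
    rw [add_sub_add_comm]
    refine (congrArg (· + _) (sub_eq_zero.mpr ?_)).trans ?_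
    · match_scalars
      field_simp
      linear_combination s * hk'
    · rw [zero_add]

/-- If `z` is killed by `E = κ D - κ⁻¹ D'` and `z` has a denominator which is a power of `x`, then
`z` has no denominator. -/
lemma mem_of_mul_pow_mem (hD : D.Adapted x y ρ σ) (hD' : D'.Adapted x y ρ⁻¹ σ⁻¹) (hρ : ρ ≠ 0)
    (hρ₁ : ∀ k : ℕ, ρ ^ (k + 1) ≠ 1) {κ : K} (hκ : κ ≠ 0) (hκ₁ : ∀ k : ℕ, κ ^ 2 ≠ ρ ^ (k + 2))
    {V : Submodule K A} (hV : V = Submodule.span K {x, y}) {N : ℕ} {z : A}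
    (hz : κ • D.toLin z = κ⁻¹ • D'.toLin z) (j : ℕ) (hj : z * x ^ j ∈ V ^ (N + j)) :
    z ∈ V ^ N := by
  induction j with
  | zero => simpa using hj
  | succ j ih =>
    apply ih
    have h₁ := hD.map_mem_pow hV (N + j) hj
    have h₂ := hD'.map_mem_pow hV (N + j) hj
    have hs := sum_inv_pow_mul hρ j
    have hs₀ : ∑ i ∈ Finset.range (j + 1), ρ ^ i ≠ 0 := fun h => hρ₁ j <| by
      have := geom_sum_mul ρ (j + 1)
      rw [h, zero_mul] at this
      exact (sub_eq_zero.mp this.symm)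
    rw [D.leibniz, hD.map_pow_succ, hD.twist_pow, ← hs] at h₁
    rw [D'.leibniz, hD'.map_pow_succ, hD'.twist_pow] at h₂
    rw [← hs] at hs₀
    set s := ∑ i ∈ Finset.range (j + 1), ρ⁻¹ ^ i
    have hs₁ : s ≠ 0 := left_ne_zero_of_mul hs₀
    have hc : s * (κ ^ 2 - ρ ^ (j + 2)) ≠ 0 := mul_ne_zero hs₁ (sub_ne_zero.mpr (hκ₁ j))
    rw [← Submodule.smul_mem_iff _ hc]
    have h := sub_mem (Submodule.smul_mem _ (κ ^ 2 * ρ⁻¹ ^ j) h₁)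
      (Submodule.smul_mem _ (ρ ^ (j + 2)) h₂)
    convert h using 1
    have hz' : D'.toLin z = κ ^ 2 • D.toLin z := by
      rw [pow_two, mul_smul, hz, smul_smul, mul_inv_cancel₀ hκ, one_smul]
    rw [hz']
    simp only [mul_smul_comm, smul_mul_assoc, inv_pow]
    match_scalars
    · field_simp
    · field_simp
      ring

/-- Left division of singular vectors by a power of `x`, given a left Ore condition `hO`. -/
lemma mem_of_pow_mul_mem (hD : D.Adapted x y ρ σ) (hD' : D'.Adapted x y ρ⁻¹ σ⁻¹) (hρ : ρ ≠ 0)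
    (hρ₁ : ∀ k : ℕ, ρ ^ (k + 1) ≠ 1) {κ : K} (hκ : κ ≠ 0) (hκ₁ : ∀ k : ℕ, κ ^ 2 ≠ ρ ^ (k + 2))
    {V : Submodule K A} (hV : V = Submodule.span K {x, y}) (hx : IsUnit x) {r : ℕ}
    (hO : ∀ k, ∀ v ∈ V, ∃ w ∈ V ^ (r + 1), v * x ^ (k + r) = x ^ k * w) {N k : ℕ} {z : A}
    (hz : κ • D.toLin z = κ⁻¹ • D'.toLin z) (hk : x ^ k * z ∈ V ^ (N + k)) :
    z ∈ V ^ N := by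
  obtain ⟨w, hw, e⟩ := exists_mul_pow_eq_pow_mul hO (N + k) k hk
  refine hD.mem_of_mul_pow_mem hD' hρ hρ₁ hκ hκ₁ hV hz (k + r * (N + k)) ?_
  rw [mul_assoc] at e
  rw [(hx.pow k).mul_left_cancel e]
  convert hw using 2
  ring

end Adapted
end SkewDerivation

/-- Kashiwara-type skew derivations on an algebra with the two `q`-Serre generators `f`, `g`. -/
structure KashiwaraData {K A : Type*} [Field K] [Ring A] [Algebra K A] (q : K) (f g : A) where
  /-- right derivation for `f` -/
  d₁ : SkewDerivation K A
  /-- left derivation for `f` -/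
  e₁ : SkewDerivation K A
  /-- right derivation for `g` -/
  d₂ : SkewDerivation K A
  /-- left derivation for `g` -/
  e₂ : SkewDerivation K A
  adapted_d₁ : d₁.Adapted f g (q ^ (-6 : ℤ)) (q ^ (3 : ℤ))
  adapted_e₁ : e₁.Adapted f g (q ^ (-6 : ℤ))⁻¹ (q ^ (3 : ℤ))⁻¹
  adapted_d₂ : d₂.Adapted g f (q ^ (-2 : ℤ)) (q ^ (3 : ℤ))
  adapted_e₂ : e₂.Adapted g f (q ^ (-2 : ℤ))⁻¹ (q ^ (3 : ℤ))⁻¹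

namespace KashiwaraData

variable {K A : Type*} [Field K] [Ring A] [Algebra K A] {q : K} {f g : A}

/-- `z` has degree `(α, β)` in `(f, g)` with respect to the four twists. -/
structure HasDegree (S : KashiwaraData q f g) (α β : ℕ) (z : A) : Prop where
  d₁ : S.d₁.twist z = q ^ (-6 * α + 3 * β : ℤ) • z
  e₁ : S.e₁.twist z = (q ^ (-6 * α + 3 * β : ℤ))⁻¹ • z
  d₂ : S.d₂.twist z = q ^ (3 * α - 2 * β : ℤ) • z
  e₂ : S.e₂.twist z = (q ^ (3 * α - 2 * β : ℤ))⁻¹ • z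

/-- `z` is homogeneous of degree `(α, β)` and, applied to the highest weight vector of weight
`(m - 1, n - 1)`, gives a singular vector. -/
structure IsSingular (S : KashiwaraData q f g) (m n α β : ℕ) (z : A) : Prop where
  degree : S.HasDegree α β z
  killed₁ : q ^ (3 * (m - 1) : ℤ) • S.d₁.toLin z = (q ^ (3 * (m - 1) : ℤ))⁻¹ • S.e₁.toLin z
  killed₂ : q ^ (n - 1 : ℤ) • S.d₂.toLin z = (q ^ (n - 1 : ℤ))⁻¹ • S.e₂.toLin z

lemma twist_pow_mul_iff {D : SkewDerivation K A} {x y : A} {ρ σ w w' : K} (hD : D.Adapted x y ρ σ)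
    (hρ : ρ ≠ 0) (hx : IsUnit x) {k : ℕ} (hw : w' = ρ ^ k * w) {z : A} :
    D.twist (x ^ k * z) = w' • (x ^ k * z) ↔ D.twist z = w • z := by
  rw [map_mul, hD.twist_pow, hw, mul_smul, smul_mul_assoc, smul_right_inj (pow_ne_zero k hρ),
    ← mul_smul_comm, (hx.pow k).mul_right_inj]

lemma twist_pow_mul_iff' {D : SkewDerivation K A} {x y : A} {ρ σ w w' : K} (hD : D.Adapted y x ρ σ)
    (hσ : σ ≠ 0) (hx : IsUnit x) {k : ℕ} (hw : w' = σ ^ k * w) {z : A} :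
    D.twist (x ^ k * z) = w' • (x ^ k * z) ↔ D.twist z = w • z := by
  rw [map_mul, map_pow, hD.twist_right, smul_pow, hw, mul_smul, smul_mul_assoc,
    smul_right_inj (pow_ne_zero k hσ), ← mul_smul_comm, (hx.pow k).mul_right_inj]

variable (S : KashiwaraData q f g)

lemma hasDegree_one : S.HasDegree 0 0 1 := by
  constructor <;> simp

lemma isSingular_one (m n : ℕ) : S.IsSingular m n 0 0 1 :=
  ⟨S.hasDegree_one, by simp [SkewDerivation.map_one], by simp [SkewDerivation.map_one]⟩

variable (hq : q ≠ 0)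
include hq

lemma hasDegree_left_iff (hf : IsUnit f) {α β k : ℕ} {z : A} :
    S.HasDegree (α + k) β (f ^ k * z) ↔ S.HasDegree α β z := by
  have h₁ := twist_pow_mul_iff S.adapted_d₁ (zpow_ne_zero _ hq) hf (k := k) (z := z)
    (w' := q ^ (-6 * (α + k : ℕ) + 3 * β : ℤ)) (w := q ^ (-6 * α + 3 * β : ℤ)) (by
      rw [← zpow_natCast, ← zpow_mul, ← zpow_add₀ hq]; congr 1; push_cast; ring)
  have h₂ := twist_pow_mul_iff S.adapted_e₁ (inv_ne_zero (zpow_ne_zero _ hq)) hf (k := k) (z := z)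
    (w' := (q ^ (-6 * (α + k : ℕ) + 3 * β : ℤ))⁻¹) (w := (q ^ (-6 * α + 3 * β : ℤ))⁻¹) (by
      rw [inv_pow, ← mul_inv, ← zpow_natCast, ← zpow_mul, ← zpow_add₀ hq]
      congr 2; push_cast; ring)
  have h₃ := twist_pow_mul_iff' S.adapted_d₂ (zpow_ne_zero _ hq) hf (k := k) (z := z)
    (w' := q ^ (3 * (α + k : ℕ) - 2 * β : ℤ)) (w := q ^ (3 * α - 2 * β : ℤ)) (by
      rw [← zpow_natCast, ← zpow_mul, ← zpow_add₀ hq]; congr 1; push_cast; ring)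
  have h₄ := twist_pow_mul_iff' S.adapted_e₂ (inv_ne_zero (zpow_ne_zero _ hq)) hf (k := k) (z := z)
    (w' := (q ^ (3 * (α + k : ℕ) - 2 * β : ℤ))⁻¹) (w := (q ^ (3 * α - 2 * β : ℤ))⁻¹) (by
      rw [inv_pow, ← mul_inv, ← zpow_natCast, ← zpow_mul, ← zpow_add₀ hq]
      congr 2; push_cast; ring)
  exact ⟨fun h => ⟨h₁.1 h.d₁, h₂.1 h.e₁, h₃.1 h.d₂, h₄.1 h.e₂⟩,
    fun h => ⟨h₁.2 h.d₁, h₂.2 h.e₁, h₃.2 h.d₂, h₄.2 h.e₂⟩⟩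

lemma hasDegree_right_iff (hg : IsUnit g) {α β k : ℕ} {z : A} :
    S.HasDegree α (β + k) (g ^ k * z) ↔ S.HasDegree α β z := by
  have h₁ := twist_pow_mul_iff' S.adapted_d₁ (zpow_ne_zero _ hq) hg (k := k) (z := z)
    (w' := q ^ (-6 * α + 3 * (β + k : ℕ) : ℤ)) (w := q ^ (-6 * α + 3 * β : ℤ)) (by
      rw [← zpow_natCast, ← zpow_mul, ← zpow_add₀ hq]; congr 1; push_cast; ring)
  have h₂ := twist_pow_mul_iff' S.adapted_e₁ (inv_ne_zero (zpow_ne_zero _ hq)) hg (k := k) (z := z)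
    (w' := (q ^ (-6 * α + 3 * (β + k : ℕ) : ℤ))⁻¹) (w := (q ^ (-6 * α + 3 * β : ℤ))⁻¹) (by
      rw [inv_pow, ← mul_inv, ← zpow_natCast, ← zpow_mul, ← zpow_add₀ hq]
      congr 2; push_cast; ring)
  have h₃ := twist_pow_mul_iff S.adapted_d₂ (zpow_ne_zero _ hq) hg (k := k) (z := z)
    (w' := q ^ (3 * α - 2 * (β + k : ℕ) : ℤ)) (w := q ^ (3 * α - 2 * β : ℤ)) (by
      rw [← zpow_natCast, ← zpow_mul, ← zpow_add₀ hq]; congr 1; push_cast; ring)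
  have h₄ := twist_pow_mul_iff S.adapted_e₂ (inv_ne_zero (zpow_ne_zero _ hq)) hg (k := k) (z := z)
    (w' := (q ^ (3 * α - 2 * (β + k : ℕ) : ℤ))⁻¹) (w := (q ^ (3 * α - 2 * β : ℤ))⁻¹) (by
      rw [inv_pow, ← mul_inv, ← zpow_natCast, ← zpow_mul, ← zpow_add₀ hq]
      congr 2; push_cast; ring)
  exact ⟨fun h => ⟨h₁.1 h.d₁, h₂.1 h.e₁, h₃.1 h.d₂, h₄.1 h.e₂⟩,
    fun h => ⟨h₁.2 h.d₁, h₂.2 h.e₁, h₃.2 h.d₂, h₄.2 h.e₂⟩⟩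

lemma isSingular_left_iff (hf : IsUnit f) {m n α β k : ℕ} (hk : (k : ℤ) = m - 2 * α + β) {z : A} :
    S.IsSingular m n (α + k) β (f ^ k * z) ↔ S.IsSingular m n α β z := by
  have key (h : S.HasDegree α β z) :=
    S.adapted_d₁.singular_pow_mul S.adapted_e₁ (zpow_ne_zero _ hq)
      (zpow_ne_zero (3 * (m - 1) : ℤ) hq) (zpow_ne_zero _ hq) (k := k)
      (by
        rw [← zpow_add₀ hq, ← zpow_natCast, ← zpow_natCast, ← zpow_mul, ← zpow_mul, ← zpow_add₀ hq]
        congr 1; rw [hk]; push_cast; ring) h.d₁ h.e₁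
  have e₁ := S.adapted_d₂.map_pow_mul_right k z
  have e₂ := S.adapted_e₂.map_pow_mul_right k z
  have hfk := hf.pow k
  constructor
  · intro h
    have hd := (S.hasDegree_left_iff hq hf).1 h.degree
    refine ⟨hd, ?_, ?_⟩
    · rw [← sub_eq_zero, ← hfk.mul_right_eq_zero, ← key hd, sub_eq_zero]
      exact h.killed₁
    · have := h.killed₂
      rwa [e₁, e₂, ← mul_smul_comm, ← mul_smul_comm, hfk.mul_right_inj] at this
  · intro h
    refine ⟨(S.hasDegree_left_iff hq hf).2 h.degree, ?_, ?_⟩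
    · rw [← sub_eq_zero, key h.degree, hfk.mul_right_eq_zero, sub_eq_zero]
      exact h.killed₁
    · rw [e₁, e₂, ← mul_smul_comm, ← mul_smul_comm, h.killed₂]

lemma isSingular_right_iff (hg : IsUnit g) {m n α β k : ℕ} (hk : (k : ℤ) = n + 3 * α - 2 * β)
    {z : A} : S.IsSingular m n α (β + k) (g ^ k * z) ↔ S.IsSingular m n α β z := by
  have key (h : S.HasDegree α β z) :=
    S.adapted_d₂.singular_pow_mul S.adapted_e₂ (zpow_ne_zero _ hq)
      (zpow_ne_zero (n - 1 : ℤ) hq) (zpow_ne_zero _ hq) (k := k)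
      (by
        rw [← zpow_add₀ hq, ← zpow_natCast, ← zpow_natCast, ← zpow_mul, ← zpow_mul, ← zpow_add₀ hq]
        congr 1; rw [hk]; push_cast; ring) h.d₂ h.e₂
  have e₁ := S.adapted_d₁.map_pow_mul_right k z
  have e₂ := S.adapted_e₁.map_pow_mul_right k z
  have hgk := hg.pow k
  constructor
  · intro h
    have hd := (S.hasDegree_right_iff hq hg).1 h.degree
    refine ⟨hd, ?_, ?_⟩
    · have := h.killed₁
      rwa [e₁, e₂, ← mul_smul_comm, ← mul_smul_comm, hgk.mul_right_inj] at this
    · rw [← sub_eq_zero, ← hgk.mul_right_eq_zero, ← key hd, sub_eq_zero]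
      exact h.killed₂
  · intro h
    refine ⟨(S.hasDegree_right_iff hq hg).2 h.degree, ?_, ?_⟩
    · rw [e₁, e₂, ← mul_smul_comm, ← mul_smul_comm, h.killed₁]
    · rw [← sub_eq_zero, key h.degree, hgk.mul_right_eq_zero, sub_eq_zero]
      exact h.killed₂

end KashiwaraData

lemma exists_mul_pow_add_eq_pow_mul {K A : Type*} [Field K] [Ring A] [Algebra K A] {x : A}
    {V S : Submodule K A} {r : ℕ} (hS : S ≤ V ^ (r + 1)) (h : ∀ s ∈ S, ∃ t ∈ S, s * x = x * t)
    (hV : ∀ v ∈ V, v * x ^ r ∈ S) (k : ℕ) (v : A) (hv : v ∈ V) :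
    ∃ w ∈ V ^ (r + 1), v * x ^ (k + r) = x ^ k * w := by
  suffices H : ∃ w ∈ S, v * x ^ (k + r) = x ^ k * w by
    obtain ⟨w, hw, e⟩ := H
    exact ⟨w, hS hw, e⟩
  induction k with
  | zero => exact ⟨_, hV v hv, by simp⟩
  | succ k ih =>
    obtain ⟨w, hw, e⟩ := ih
    obtain ⟨t, ht, e'⟩ := h w hw
    exact ⟨t, ht, by rw [add_right_comm, pow_succ, ← mul_assoc, e, mul_assoc, e', ← mul_assoc,
      ← pow_succ]⟩

lemma exists_mul_eq_mul_of_span {K A : Type*} [Field K] [Ring A] [Algebra K A] {x : A} {s : Set A}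
    (h : ∀ a ∈ s, ∃ t ∈ Submodule.span K s, a * x = x * t) :
    ∀ a ∈ Submodule.span K s, ∃ t ∈ Submodule.span K s, a * x = x * t := by
  intro a ha
  induction ha using Submodule.span_induction with
  | mem a ha => exact h a ha
  | zero => exact ⟨0, zero_mem _, by simp⟩
  | add a b _ _ ha hb =>
    obtain ⟨t, ht, e⟩ := ha
    obtain ⟨t', ht', e'⟩ := hb
    exact ⟨t + t', add_mem ht ht', by rw [add_mul, mul_add, e, e']⟩
  | smul c a _ ha =>
    obtain ⟨t, ht, e⟩ := ha
    exact ⟨c • t, Submodule.smul_mem _ c ht, by rw [smul_mul_assoc, mul_smul_comm, e]⟩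

namespace QSerreG2

variable {K A : Type*} [Field K] [Ring A] [Algebra K A] {q : K} {f g : A}

lemma ore_left (h : QSerreG2 q f g) {V : Submodule K A} (hV : V = Submodule.span K {f, g}) (k : ℕ)
    (v : A) (hv : v ∈ V) : ∃ w ∈ V ^ (1 + 1), v * f ^ (k + 1) = f ^ k * w := by
  have hf : f ∈ V := hV ▸ Submodule.subset_span (by simp)
  have hg : g ∈ V := hV ▸ Submodule.subset_span (by simp)
  set s : Set A := {f * f, f * g, g * f} with hs
  have m₁ : f * f ∈ Submodule.span K s := Submodule.subset_span (by simp [hs])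
  have m₂ : f * g ∈ Submodule.span K s := Submodule.subset_span (by simp [hs])
  have m₃ : g * f ∈ Submodule.span K s := Submodule.subset_span (by simp [hs])
  refine exists_mul_pow_add_eq_pow_mul (S := Submodule.span K s) ?_ ?_ ?_ k v hv
  · rw [Submodule.span_le, pow_two]
    rintro _ (rfl | rfl | rfl) <;> exact Submodule.mul_mem_mul ‹_› ‹_›
  · apply exists_mul_eq_mul_of_span
    rintro _ (rfl | rfl | rfl)
    · exact ⟨_, m₁, by rw [mul_assoc]⟩
    · exact ⟨_, m₃, by rw [mul_assoc]⟩
    · refine ⟨(q ^ (3 : ℤ) + q ^ (-3 : ℤ)) • (g * f) - f * g,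
        sub_mem (Submodule.smul_mem _ _ m₃) m₂, ?_⟩
      have := h.1
      rw [← sub_eq_zero, ← this]
      simp only [mul_sub, mul_smul_comm, pow_two, mul_assoc]
      abel
  · subst hV
    intro v hv
    rw [pow_one]
    induction hv using Submodule.span_induction with
    | mem a ha => rcases ha with rfl | rfl <;> assumption
    | zero => simp
    | add a b _ _ ha hb => rw [add_mul]; exact add_mem ha hb
    | smul c a _ ha => rw [smul_mul_assoc]; exact Submodule.smul_mem _ c ha

lemma ore_right (h : QSerreG2 q f g) {V : Submodule K A} (hV : V = Submodule.span K {f, g}) (k : ℕ)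
    (v : A) (hv : v ∈ V) : ∃ w ∈ V ^ (3 + 1), v * g ^ (k + 3) = g ^ k * w := by
  have hf : f ∈ V := hV ▸ Submodule.subset_span (by simp)
  have hg : g ∈ V := hV ▸ Submodule.subset_span (by simp)
  set s : Set A := {g * g * g * g, f * g * g * g, g * f * g * g, g * g * f * g, g * g * g * f}
    with hs
  have m₀ : g * g * g * g ∈ Submodule.span K s := Submodule.subset_span (by simp [hs])
  have m₁ : f * g * g * g ∈ Submodule.span K s := Submodule.subset_span (by simp [hs])
  have m₂ : g * f * g * g ∈ Submodule.span K s := Submodule.subset_span (by simp [hs])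
  have m₃ : g * g * f * g ∈ Submodule.span K s := Submodule.subset_span (by simp [hs])
  have m₄ : g * g * g * f ∈ Submodule.span K s := Submodule.subset_span (by simp [hs])
  refine exists_mul_pow_add_eq_pow_mul (S := Submodule.span K s) ?_ ?_ ?_ k v hv
  · rw [Submodule.span_le,
      show V ^ (3 + 1) = V * V * V * V by simp only [pow_succ, pow_zero, one_mul]]
    rintro _ (rfl | rfl | rfl | rfl | rfl) <;>
      exact Submodule.mul_mem_mul (Submodule.mul_mem_mul (Submodule.mul_mem_mul ‹_› ‹_›) ‹_›) ‹_›
  · apply exists_mul_eq_mul_of_span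
    rintro _ (rfl | rfl | rfl | rfl | rfl)
    · exact ⟨_, m₀, by simp only [mul_assoc]⟩
    · refine ⟨(q ^ (3 : ℤ) + q + q ^ (-1 : ℤ) + q ^ (-3 : ℤ)) • (f * g * g * g)
        - ((q ^ (2 : ℤ) + q ^ (-2 : ℤ)) * (q ^ (2 : ℤ) + 1 + q ^ (-2 : ℤ))) • (g * f * g * g)
        + (q ^ (3 : ℤ) + q + q ^ (-1 : ℤ) + q ^ (-3 : ℤ)) • (g * g * f * g) - g * g * g * f,
        sub_mem (add_mem (sub_mem (Submodule.smul_mem _ _ m₁) (Submodule.smul_mem _ _ m₂))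
          (Submodule.smul_mem _ _ m₃)) m₄, ?_⟩
      have := h.2
      rw [← sub_eq_zero, ← this]
      simp only [mul_sub, mul_add, mul_smul_comm, pow_succ, pow_zero, one_mul, mul_assoc]
      abel
    · exact ⟨_, m₁, by simp only [mul_assoc]⟩
    · exact ⟨_, m₂, by simp only [mul_assoc]⟩
    · exact ⟨_, m₃, by simp only [mul_assoc]⟩
  · subst hV
    intro v hv
    rw [show v * g ^ 3 = v * g * g * g by simp only [pow_succ, pow_zero, one_mul, mul_assoc]]
    induction hv using Submodule.span_induction with
    | mem a ha => rcases ha with rfl | rfl <;> assumption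
    | zero => simp
    | add a b _ _ ha hb => simp only [add_mul]; exact add_mem ha hb
    | smul c a _ ha => simp only [smul_mul_assoc]; exact Submodule.smul_mem _ c ha

end QSerreG2

namespace KashiwaraData

variable {K A : Type*} [Field K] [Ring A] [Algebra K A] {q : K} {f g : A}

/-- Singular elements that are moreover polynomial in `f` and `g`. -/
def IsPolySingular (S : KashiwaraData q f g) (m n α β : ℕ) (z : A) : Prop :=
  S.IsSingular m n α β z ∧ z ∈ Submodule.span K {f, g} ^ (α + β)

variable (S : KashiwaraData q f g) (hq : q ≠ 0) (hq₁ : ∀ k : ℤ, q ^ k = 1 → k = 0)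
  (h : QSerreG2 q f g)

lemma IsPolySingular.mem_range {S : KashiwaraData q f g} {m n : ℕ} {z : A}
    (hz : S.IsPolySingular m n 0 0 z) : ∃ c, algebraMap K A c = z := by
  simpa using hz.2

lemma isPolySingular_one (m n : ℕ) : S.IsPolySingular m n 0 0 1 :=
  ⟨S.isSingular_one m n, by rw [add_zero, pow_zero]; exact Submodule.one_le.mp le_rfl⟩

include hq in
lemma IsPolySingular.left_mul {S : KashiwaraData q f g} (hf : IsUnit f) {m n α β k : ℕ}
    (hk : (k : ℤ) = m - 2 * α + β) {z : A} (hz : S.IsPolySingular m n α β z) :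
    S.IsPolySingular m n (α + k) β (f ^ k * z) := by
  refine ⟨(S.isSingular_left_iff hq hf hk).2 hz.1, ?_⟩
  rw [show α + k + β = k + (α + β) by ring, pow_add]
  exact Submodule.mul_mem_mul (Submodule.pow_mem_pow _ (Submodule.subset_span (by simp)) _) hz.2

include hq in
lemma IsPolySingular.right_mul {S : KashiwaraData q f g} (hg : IsUnit g) {m n α β k : ℕ}
    (hk : (k : ℤ) = n + 3 * α - 2 * β) {z : A} (hz : S.IsPolySingular m n α β z) :
    S.IsPolySingular m n α (β + k) (g ^ k * z) := by
  refine ⟨(S.isSingular_right_iff hq hg hk).2 hz.1, ?_⟩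
  rw [show α + (β + k) = k + (α + β) by ring, pow_add]
  exact Submodule.mul_mem_mul (Submodule.pow_mem_pow _ (Submodule.subset_span (by simp)) _) hz.2

include hq₁ in
lemma zpow_inj_of_not_root {a b : ℤ} (hq : q ≠ 0) (e : q ^ a = q ^ b) : a = b := by
  have := hq₁ (a - b) (by rw [zpow_sub₀ hq, e, div_self (zpow_ne_zero _ hq)])
  omega

include hq hq₁ h in
lemma IsPolySingular.left_cancel {S : KashiwaraData q f g} (hf : IsUnit f) {m n α β k : ℕ}
    (hk : (k : ℤ) = m - 2 * α + β) {z : A} (hz : S.IsPolySingular m n (α + k) β (f ^ k * z)) :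
    S.IsPolySingular m n α β z := by
  have hs := (S.isSingular_left_iff hq hf hk).1 hz.1
  refine ⟨hs, S.adapted_d₁.mem_of_pow_mul_mem S.adapted_e₁ (zpow_ne_zero _ hq) ?_
    (zpow_ne_zero (3 * (m - 1) : ℤ) hq) ?_ rfl hf (h.ore_left rfl) hs.killed₁ (k := k) ?_⟩
  · intro j hj
    rw [← zpow_natCast, ← zpow_mul] at hj
    have := hq₁ _ hj
    push_cast at this; omega
  · intro j hj
    rw [← zpow_natCast, ← zpow_natCast, ← zpow_mul, ← zpow_mul] at hj
    have := zpow_inj_of_not_root hq₁ hq hj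
    push_cast at this; omega
  · convert hz.2 using 2; ring

include hq hq₁ h in
lemma IsPolySingular.right_cancel {S : KashiwaraData q f g} (hg : IsUnit g) {m n α β k : ℕ}
    (hk : (k : ℤ) = n + 3 * α - 2 * β) {z : A} (hz : S.IsPolySingular m n α (β + k) (g ^ k * z)) :
    S.IsPolySingular m n α β z := by
  have hs := (S.isSingular_right_iff hq hg hk).1 hz.1
  refine ⟨hs, S.adapted_d₂.mem_of_pow_mul_mem S.adapted_e₂ (zpow_ne_zero _ hq) ?_
    (zpow_ne_zero (n - 1 : ℤ) hq) ?_ (by rw [Set.pair_comm]) hg (h.ore_right rfl) hs.killed₂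
    (k := k) ?_⟩
  · intro j hj
    rw [← zpow_natCast, ← zpow_mul] at hj
    have := hq₁ _ hj
    push_cast at this; omega
  · intro j hj
    rw [← zpow_natCast, ← zpow_natCast, ← zpow_mul, ← zpow_mul] at hj
    have := zpow_inj_of_not_root hq₁ hq hj
    push_cast at this; omega
  · convert hz.2 using 2; ring

end KashiwaraData

/-- One side of the quantum Verma identity of type `G₂`. -/
def vermaLeft {G : Type*} [Monoid G] (f g : G) (m n : ℕ) : G :=
  f ^ m * (g ^ (3 * m + n) * (f ^ (2 * m + n) * (g ^ (3 * m + 2 * n) * (f ^ (m + n) * g ^ n))))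

/-- The other side of the quantum Verma identity of type `G₂`. -/
def vermaRight {G : Type*} [Monoid G] (f g : G) (m n : ℕ) : G :=
  g ^ n * (f ^ (m + n) * (g ^ (3 * m + 2 * n) * (f ^ (2 * m + n) * (g ^ (3 * m + n) * f ^ m))))

namespace KashiwaraData

/-- Both Verma monomials agree up to a scalar. -/
lemma exists_vermaLeft_eq {K A : Type*} [Field K] [Ring A] [Algebra K A] {q : K} {f g : Aˣ}
    (S : KashiwaraData q (f : A) (g : A)) (hq : q ≠ 0) (hq₁ : ∀ k : ℤ, q ^ k = 1 → k = 0)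
    (h : QSerreG2 q (f : A) (g : A)) (m n : ℕ) :
    ∃ c : K, vermaLeft (f : A) g m n = c • vermaRight (f : A) g m n := by
  have hf := f.isUnit
  have hg := g.isUnit
  have e : vermaLeft (f : A) g m n = vermaRight (f : A) g m n *
      ((vermaRight f g m n)⁻¹ * vermaLeft f g m n : Aˣ) := by
    have : vermaLeft f g m n = vermaRight f g m n *
      ((vermaRight f g m n)⁻¹ * vermaLeft f g m n) := by group
    simpa [vermaLeft, vermaRight] using congrArg (Units.val) this
  generalize (((vermaRight f g m n)⁻¹ * vermaLeft f g m n : Aˣ) : A) = z at e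
  have s₁ := (S.isPolySingular_one m n).right_mul hq hg (k := n) (by push_cast; ring)
  have s₂ := s₁.left_mul hq hf (k := m + n) (by push_cast; ring)
  have s₃ := s₂.right_mul hq hg (k := 3 * m + 2 * n) (by push_cast; ring)
  have s₄ := s₃.left_mul hq hf (k := 2 * m + n) (by push_cast; ring)
  have s₅ := s₄.right_mul hq hg (k := 3 * m + n) (by push_cast; ring)
  have s₆ := s₅.left_mul hq hf (k := m) (by push_cast; ring)
  have e' := e
  rw [vermaLeft, vermaRight] at e'
  rw [mul_one, e'] at s₆
  simp only [mul_assoc] at s₆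
  have t₁ := IsPolySingular.right_cancel (α := 0 + m + (2 * m + n) + (m + n))
    (β := 0 + (3 * m + n) + (3 * m + 2 * n)) (k := n) hq hq₁ h hg (by push_cast; ring)
    (by convert s₆ using 1 <;> ring)
  have t₂ := IsPolySingular.left_cancel hq hq₁ h hf (by push_cast; ring) t₁
  have t₃ := IsPolySingular.right_cancel hq hq₁ h hg (by push_cast; ring) t₂
  have t₄ := IsPolySingular.left_cancel hq hq₁ h hf (by push_cast; ring) t₃
  have t₅ := IsPolySingular.right_cancel hq hq₁ h hg (by push_cast; ring) t₄
  have t₆ := IsPolySingular.left_cancel hq hq₁ h hf (by push_cast; ring) t₅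
  obtain ⟨c, rfl⟩ := t₆.mem_range
  exact ⟨c, by rw [e, Algebra.smul_def, Algebra.commutes]⟩

end KashiwaraData

/-- The unit of the matrix ring given by an upper triangular matrix with units on the diagonal. -/
def Matrix.upperUnit {A : Type*} [Ring A] (u v : Aˣ) (a : A) : (Matrix (Fin 2) (Fin 2) A)ˣ where
  val := !![↑u, a; 0, ↑v]
  inv := !![↑u⁻¹, -(↑u⁻¹ * a * ↑v⁻¹); 0, ↑v⁻¹]
  val_inv := by
    ext i j; fin_cases i <;> fin_cases j <;> simp [← mul_assoc]
  inv_val := by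
    ext i j; fin_cases i <;> fin_cases j <;> simp [mul_assoc]

namespace QSerreG2

variable (K : Type*) [Field K] (q : K)

/-- The two `q`-Serre relations, as relations in the group algebra of the free group. -/
inductive Rel : MonoidAlgebra K (FreeGroup Bool) → MonoidAlgebra K (FreeGroup Bool) → Prop
  | serre {x y : MonoidAlgebra K (FreeGroup Bool)}
      (hx : x = MonoidAlgebra.of K _ (FreeGroup.of true))
      (hy : y = MonoidAlgebra.of K _ (FreeGroup.of false)) :
      Rel (x ^ 2 * y + y * x ^ 2) ((q ^ (3 : ℤ) + q ^ (-3 : ℤ)) • (x * y * x))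
  | serre' {x y : MonoidAlgebra K (FreeGroup Bool)}
      (hx : x = MonoidAlgebra.of K _ (FreeGroup.of true))
      (hy : y = MonoidAlgebra.of K _ (FreeGroup.of false)) :
      Rel (y ^ 4 * x
        + ((q ^ (2 : ℤ) + q ^ (-2 : ℤ)) * (q ^ (2 : ℤ) + 1 + q ^ (-2 : ℤ))) • (y ^ 2 * x * y ^ 2)
        + x * y ^ 4)
        ((q ^ (3 : ℤ) + q + q ^ (-1 : ℤ) + q ^ (-3 : ℤ)) • (y ^ 3 * x * y)
        + (q ^ (3 : ℤ) + q + q ^ (-1 : ℤ) + q ^ (-3 : ℤ)) • (y * x * y ^ 3))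

/-- The universal algebra on two invertible elements satisfying the `q`-Serre relations. -/
abbrev Univ : Type _ := RingQuot (Rel K q)

namespace Univ

/-- The canonical map from the free group to the units of the universal algebra. -/
noncomputable def ofFreeGroup : FreeGroup Bool →* (Univ K q)ˣ :=
  MonoidHom.toHomUnits
    (((RingQuot.mkAlgHom K (Rel K q) : _ →* _)).comp (MonoidAlgebra.of K (FreeGroup Bool)))

/-- The first generator. -/
noncomputable def f : (Univ K q)ˣ := ofFreeGroup K q (FreeGroup.of true)

/-- The second generator. -/
noncomputable def g : (Univ K q)ˣ := ofFreeGroup K q (FreeGroup.of false)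

lemma val_f : (f K q : Univ K q) =
    RingQuot.mkAlgHom K (Rel K q) (MonoidAlgebra.of K _ (FreeGroup.of true)) := rfl

lemma val_g : (g K q : Univ K q) =
    RingQuot.mkAlgHom K (Rel K q) (MonoidAlgebra.of K _ (FreeGroup.of false)) := rfl

lemma qSerreG2 : QSerreG2 q (f K q : Univ K q) (g K q : Univ K q) := by
  have h₁ := RingQuot.mkAlgHom_rel K (Rel.serre (q := q) (x := _) (y := _) rfl rfl)
  have h₂ := RingQuot.mkAlgHom_rel K (Rel.serre' (q := q) (x := _) (y := _) rfl rfl)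
  simp only [map_add, map_mul, map_pow, map_smul, ← val_f, ← val_g] at h₁ h₂
  constructor
  · rw [sub_add_eq_add_sub, h₁, sub_self]
  · rw [← sub_eq_zero] at h₂
    rw [← h₂]
    abel

variable {K q}

lemma mem_subalgebra {S : Subalgebra K (Univ K q)} (hf : (f K q : Univ K q) ∈ S)
    (hf' : ((f K q)⁻¹ : (Univ K q)ˣ).val ∈ S) (hg : (g K q : Univ K q) ∈ S)
    (hg' : ((g K q)⁻¹ : (Univ K q)ˣ).val ∈ S) (x : Univ K q) : x ∈ S := by
  obtain ⟨x, rfl⟩ := RingQuot.mkAlgHom_surjective K (Rel K q) x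
  induction x using MonoidAlgebra.induction_on with
  | of w =>
    change (ofFreeGroup K q w : Univ K q) ∈ S
    induction w using FreeGroup.induction_on with
    | C1 => simp [one_mem]
    | of b => cases b <;> assumption
    | inv_of b _ => rw [map_inv]; cases b <;> assumption
    | mul x y hx hy => rw [map_mul, Units.val_mul]; exact mul_mem hx hy
  | add x y hx hy => rw [map_add]; exact add_mem hx hy
  | smul c x hx => rw [map_smul]; exact S.smul_mem hx c

lemma exists_algHom {B : Type*} [Ring B] [Algebra K B] {F G : Bˣ}
    (h : QSerreG2 q (F : B) (G : B)) :
    ∃ φ : Univ K q →ₐ[K] B, Units.map (φ : Univ K q →* B) (f K q) = F ∧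
      Units.map (φ : Univ K q →* B) (g K q) = G := by
  let θ : MonoidAlgebra K (FreeGroup Bool) →ₐ[K] B := MonoidAlgebra.lift K _ _
    ((Units.coeHom B).comp (FreeGroup.lift fun b => if b then F else G))
  have θf : θ (MonoidAlgebra.of K _ (FreeGroup.of true)) = F := by simp [θ]
  have θg : θ (MonoidAlgebra.of K _ (FreeGroup.of false)) = G := by simp [θ]
  have hθ : ∀ ⦃x y⦄, Rel K q x y → θ x = θ y := by
    rintro _ _ (⟨hx, hy⟩ | ⟨hx, hy⟩)
    · subst hx hy
      simp only [map_add, map_mul, map_pow, map_smul, θf, θg]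
      rw [← sub_eq_zero, ← h.1]
      abel
    · subst hx hy
      simp only [map_add, map_mul, map_pow, map_smul, θf, θg]
      rw [← sub_eq_zero, ← h.2]
      abel
  refine ⟨RingQuot.liftAlgHom K ⟨θ, hθ⟩, Units.ext ?_, Units.ext ?_⟩
  · simp [val_f, ← θf]
  · simp [val_g, ← θg]

lemma exists_skewDerivation {a b : Univ K q} {ρ σ : K} (hρ : ρ ≠ 0) (hσ : σ ≠ 0)
    (h : QSerreG2 q !![(f K q : Univ K q), a; 0, ρ • (f K q : Univ K q)]
      !![(g K q : Univ K q), b; 0, σ • (g K q : Univ K q)]) :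
    ∃ D : SkewDerivation K (Univ K q), (D.toLin (f K q) = a ∧ D.toLin (g K q) = b) ∧
      D.twist (f K q) = ρ • (f K q : Univ K q) ∧ D.twist (g K q) = σ • (g K q : Univ K q) := by
  let c (ρ : K) (hρ : ρ ≠ 0) : (Univ K q)ˣ :=
    Units.map (algebraMap K (Univ K q) : K →* Univ K q) (Units.mk0 ρ hρ)
  let F := Matrix.upperUnit (f K q) (c ρ hρ * f K q) a
  let G := Matrix.upperUnit (g K q) (c σ hσ * g K q) b
  have hF : (F : Matrix (Fin 2) (Fin 2) (Univ K q)) = !![↑(f K q), a; 0, ρ • ↑(f K q)] := by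
    rw [Algebra.smul_def]; rfl
  have hG : (G : Matrix (Fin 2) (Fin 2) (Univ K q)) = !![↑(g K q), b; 0, σ • ↑(g K q)] := by
    rw [Algebra.smul_def]; rfl
  rw [← hF, ← hG] at h
  obtain ⟨φ, φf, φg⟩ := exists_algHom h
  have φf' : φ (f K q)⁻¹.val = F⁻¹.val := by rw [← φf, ← map_inv]; rfl
  have φg' : φ (g K q)⁻¹.val = G⁻¹.val := by rw [← φg, ← map_inv]; rfl
  replace φf : φ (f K q).val = F.val := by rw [← φf]; rfl
  replace φg : φ (g K q).val = G.val := by rw [← φg]; rfl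
  let S : Subalgebra K (Univ K q) :=
    { carrier := {x | φ x 1 0 = 0 ∧ φ x 0 0 = x}
      mul_mem' := by
        rintro x y ⟨hx, hx'⟩ ⟨hy, hy'⟩
        simp [Matrix.mul_apply, hx, hx', hy, hy']
      add_mem' := by
        rintro x y ⟨hx, hx'⟩ ⟨hy, hy'⟩
        simp [hx, hx', hy, hy']
      algebraMap_mem' := by
        intro c
        simp [Matrix.algebraMap_matrix_apply] }
  have hS : ∀ x, φ x 1 0 = 0 ∧ φ x 0 0 = x := mem_subalgebra (S := S)
    (by change _ ∧ _; rw [φf]; exact ⟨rfl, rfl⟩) (by change _ ∧ _; rw [φf']; exact ⟨rfl, rfl⟩)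
    (by change _ ∧ _; rw [φg]; exact ⟨rfl, rfl⟩) (by change _ ∧ _; rw [φg']; exact ⟨rfl, rfl⟩)
  refine ⟨{ toLin := (Matrix.entryLinearMap K (Univ K q) 0 1) ∘ₗ φ.toLinearMap
            twist := AlgHom.ofLinearMap
              ((Matrix.entryLinearMap K (Univ K q) 1 1) ∘ₗ φ.toLinearMap) (by simp)
              (fun x y => by simp [Matrix.mul_apply, hS])
            leibniz := fun x y => by simp [Matrix.mul_apply, hS, add_comm] }, ⟨?_, ?_⟩, ?_, ?_⟩
  · simp [φf, hF]
  · simp [φg, hG]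
  · simp [φf, hF]
  · simp [φg, hG]

lemma nonempty_kashiwaraData (hq : q ≠ 0) :
    Nonempty (KashiwaraData q (f K q : Univ K q) (g K q : Univ K q)) := by
  have hq' := inv_ne_zero hq
  have h := qSerreG2 K q
  have e (k : ℤ) : q⁻¹ ^ k = (q ^ k)⁻¹ := inv_zpow q k
  have l := (h.inv.triangular_left hq').inv
  have r := (h.inv.triangular_right hq').inv
  rw [inv_inv, e, e] at l r
  have z (k : ℤ) : q ^ k ≠ 0 := zpow_ne_zero k hq
  obtain ⟨d₁, ⟨h₁, h₁'⟩, h₁'', h₁'''⟩ := exists_skewDerivation (z _) (z _) (h.triangular_left hq)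
  obtain ⟨e₁, ⟨h₂, h₂'⟩, h₂'', h₂'''⟩ :=
    exists_skewDerivation (inv_ne_zero (z _)) (inv_ne_zero (z _)) l
  obtain ⟨d₂, ⟨h₃, h₃'⟩, h₃'', h₃'''⟩ := exists_skewDerivation (z _) (z _) (h.triangular_right hq)
  obtain ⟨e₂, ⟨h₄, h₄'⟩, h₄'', h₄'''⟩ :=
    exists_skewDerivation (inv_ne_zero (z _)) (inv_ne_zero (z _)) r
  exact ⟨d₁, e₁, d₂, e₂, ⟨h₁, h₁', h₁'', h₁'''⟩, ⟨h₂, h₂', h₂'', h₂'''⟩, ⟨h₃', h₃, h₃''', h₃''⟩,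
    ⟨h₄', h₄, h₄''', h₄''⟩⟩

end Univ
end QSerreG2

section QuantumTorus

variable {K A : Type*} [Field K] [Ring A] [Algebra K A] {t : K} {f g : A}

lemma pow_mul_pow_of_mul_eq_smul (h : f * g = t • (g * f)) (a b : ℕ) :
    f ^ a * g ^ b = t ^ (a * b) • (g ^ b * f ^ a) := by
  have h₁ (b : ℕ) : f * g ^ b = t ^ b • (g ^ b * f) := by
    induction b with
    | zero => simp
    | succ b ih =>
      rw [pow_succ, ← mul_assoc, ih, smul_mul_assoc, mul_assoc, h, mul_smul_comm, smul_smul,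
        mul_assoc, pow_succ]
  induction a with
  | zero => simp
  | succ a ih =>
    rw [pow_succ, mul_assoc, h₁, mul_smul_comm, ← mul_assoc, ih, smul_mul_assoc, smul_smul,
      mul_assoc]
    congr 1
    ring

lemma vermaLeft_eq_vermaRight_of_mul_eq_smul (h : f * g = t • (g * f)) (m n : ℕ) :
    vermaLeft f g m n = vermaRight f g m n := by
  have hf (k a b : ℕ) (c : K) : f ^ k * (c • (g ^ b * f ^ a)) =
      (t ^ (k * b) * c) • (g ^ b * f ^ (k + a)) := by
    rw [mul_smul_comm, ← mul_assoc, pow_mul_pow_of_mul_eq_smul h, smul_mul_assoc, smul_smul,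
      mul_assoc, pow_add, mul_comm c]
  have hg (k a b : ℕ) (c : K) : g ^ k * (c • (g ^ b * f ^ a)) = c • (g ^ (k + b) * f ^ a) := by
    rw [mul_smul_comm, ← mul_assoc, pow_add]
  have l := pow_mul_pow_of_mul_eq_smul h (m + n) n
  have r : g ^ (3 * m + n) * f ^ m = (1 : K) • (g ^ (3 * m + n) * f ^ m) := (one_smul _ _).symm
  rw [vermaLeft, vermaRight, l, r]
  simp only [hf, hg]
  simp only [← pow_add, mul_one]
  congr 2
  · ring
  · congr 1
    ring
  · congr 1
    ring

lemma qSerreG2_of_mul_eq_smul {q : K} (hq : q ≠ 0) (h : f * g = q ^ 3 • (g * f)) :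
    QSerreG2 q f g := by
  have h' (x : A) : f * (g * x) = q ^ 3 • (g * (f * x)) := by
    rw [← mul_assoc, h, smul_mul_assoc, mul_assoc]
  have e (x : A) : x ^ 4 = x * (x * (x * x)) ∧ x ^ 3 = x * (x * x) ∧ x ^ 2 = x * x := by
    simp [pow_succ, mul_assoc]
  constructor
  · simp only [e f, mul_assoc, h, h', mul_smul_comm, smul_mul_assoc, smul_smul]
    match_scalars
    field_simp
    ring
  · simp only [e g, mul_assoc, h, h', mul_smul_comm, smul_smul]
    match_scalars
    field_simp
    ring

end QuantumTorus

/-- The quantum torus is represented on sequences by the shift and a diagonal operator. -/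
lemma exists_units_mul_eq_smul {K : Type*} [Field K] {t : K} (ht : t ≠ 0) :
    ∃ f g : (Module.End K (ℤ → K))ˣ,
      (f : Module.End K (ℤ → K)) * g = t • (g * f : Module.End K (ℤ → K)) := by
  let f : (Module.End K (ℤ → K))ˣ :=
    { val := LinearMap.funLeft K K (· + 1)
      inv := LinearMap.funLeft K K (· - 1)
      val_inv := by ext v k; simp [LinearMap.funLeft]
      inv_val := by ext v k; simp [LinearMap.funLeft] }
  let g : (Module.End K (ℤ → K))ˣ :=
    { val := LinearMap.pi fun k => t ^ k • LinearMap.proj k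
      inv := LinearMap.pi fun k => t ^ (-k) • LinearMap.proj k
      val_inv := by ext v k; simp [mul_inv_cancel_left₀ (zpow_ne_zero k ht)]
      inv_val := by ext v k; simp [inv_mul_cancel_left₀ (zpow_ne_zero k ht)] }
  refine ⟨f, g, ?_⟩
  ext v k
  simp [f, g, LinearMap.funLeft, zpow_add₀ ht]
  ring

lemma map_vermaLeft {G H F : Type*} [Monoid G] [Monoid H] [FunLike F G H] [MonoidHomClass F G H]
    (φ : F) (f g : G) (m n : ℕ) : φ (vermaLeft f g m n) = vermaLeft (φ f) (φ g) m n := by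
  simp [vermaLeft]

lemma map_vermaRight {G H F : Type*} [Monoid G] [Monoid H] [FunLike F G H] [MonoidHomClass F G H]
    (φ : F) (f g : G) (m n : ℕ) : φ (vermaRight f g m n) = vermaRight (φ f) (φ g) m n := by
  simp [vermaRight]

namespace QSerreG2

variable {K : Type*} [Field K] {q : K}

lemma Univ.vermaLeft_eq (hq : q ≠ 0) (hq₁ : ∀ k : ℤ, q ^ k = 1 → k = 0) (m n : ℕ) :
    vermaLeft (Univ.f K q) (Univ.g K q) m n = vermaRight (Univ.f K q) (Univ.g K q) m n := by
  obtain ⟨S⟩ := Univ.nonempty_kashiwaraData hq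
  obtain ⟨c, hc⟩ := S.exists_vermaLeft_eq hq hq₁ (Univ.qSerreG2 K q) m n
  obtain ⟨F, G, hFG⟩ := exists_units_mul_eq_smul (pow_ne_zero 3 hq)
  obtain ⟨φ, φf, φg⟩ := Univ.exists_algHom (qSerreG2_of_mul_eq_smul hq hFG)
  replace φf : φ (Univ.f K q).val = F.val := by rw [← φf]; rfl
  replace φg : φ (Univ.g K q).val = G.val := by rw [← φg]; rfl
  have hc' := congrArg φ hc
  rw [map_smul, map_vermaLeft, map_vermaRight, φf, φg,
    vermaLeft_eq_vermaRight_of_mul_eq_smul hFG] at hc'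
  have hu : vermaRight F.val G.val m n ≠ 0 := by
    have := map_vermaRight (Units.coeHom _) F G m n
    simp only [Units.coeHom_apply] at this
    rw [← this]
    exact Units.ne_zero _
  have hc₁ : c = 1 := smul_left_injective K hu (by simpa using hc'.symm)
  rw [hc₁, one_smul] at hc
  apply Units.ext
  have l := map_vermaLeft (Units.coeHom _) (Univ.f K q) (Univ.g K q) m n
  have r := map_vermaRight (Units.coeHom _) (Univ.f K q) (Univ.g K q) m n
  simp only [Units.coeHom_apply] at l r
  rw [l, r, hc]

/-- The quantum Verma identity of type `G₂` for natural exponents. -/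
lemma vermaLeft_eq {A : Type*} [Ring A] [Algebra K A] (hq : q ≠ 0)
    (hq₁ : ∀ k : ℤ, q ^ k = 1 → k = 0) {f g : Aˣ} (h : QSerreG2 q (f : A) (g : A)) (m n : ℕ) :
    vermaLeft f g m n = vermaRight f g m n := by
  obtain ⟨φ, φf, φg⟩ := Univ.exists_algHom h
  rw [← φf, ← φg, ← map_vermaLeft, ← map_vermaRight, Univ.vermaLeft_eq hq hq₁]

end QSerreG2

/-- The Verma identity of type `G₂` with integer exponents in a group. -/
def VermaIdentity {G : Type*} [Group G] (f g : G) (m n : ℤ) : Prop :=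
  f ^ m * g ^ (3 * m + n) * f ^ (2 * m + n) * g ^ (3 * m + 2 * n) * f ^ (m + n) * g ^ n
    = g ^ n * f ^ (m + n) * g ^ (3 * m + 2 * n) * f ^ (2 * m + n) * g ^ (3 * m + n) * f ^ m

namespace VermaIdentity

variable {G : Type*} [Group G] {f g : G}

lemma of_reflect_left {m n : ℤ} (h : VermaIdentity f g (-m) (3 * m + n)) :
    VermaIdentity f g m n := by
  rw [VermaIdentity] at *
  have e₁ : 3 * -m + (3 * m + n) = n := by ring
  have e₂ : 2 * -m + (3 * m + n) = m + n := by ring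
  have e₃ : 3 * -m + 2 * (3 * m + n) = 3 * m + 2 * n := by ring
  have e₄ : -m + (3 * m + n) = 2 * m + n := by ring
  rw [e₁, e₂, e₃, e₄, zpow_neg] at h
  have := congrArg (fun x => f ^ m * x * f ^ m) h
  simpa [mul_assoc] using this.symm

lemma of_reflect_right {m n : ℤ} (h : VermaIdentity f g (m + n) (-n)) :
    VermaIdentity f g m n := by
  rw [VermaIdentity] at *
  have e₁ : 3 * (m + n) + -n = 3 * m + 2 * n := by ring
  have e₂ : 2 * (m + n) + -n = 2 * m + n := by ring
  have e₃ : 3 * (m + n) + 2 * -n = 3 * m + n := by ring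
  have e₄ : m + n + -n = m := by ring
  rw [e₁, e₂, e₃, e₄, zpow_neg] at h
  have := congrArg (fun x => g ^ n * x * g ^ n) h
  simpa [mul_assoc] using this.symm

lemma of_neg {m n : ℤ} (h : VermaIdentity f g (-m) (-n)) : VermaIdentity f g m n := by
  rw [VermaIdentity] at *
  have e₁ : 3 * -m + -n = -(3 * m + n) := by ring
  have e₂ : 2 * -m + -n = -(2 * m + n) := by ring
  have e₃ : 3 * -m + 2 * -n = -(3 * m + 2 * n) := by ring
  have e₄ : -m + -n = -(m + n) := by ring
  rw [e₁, e₂, e₃, e₄] at h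
  have := congrArg (·⁻¹) h
  simpa only [mul_inv_rev, zpow_neg, inv_inv, mul_assoc] using this.symm

/-- The Weyl group symmetries reduce the identity to nonnegative exponents. -/
lemma of_nat (h : ∀ m n : ℕ, VermaIdentity f g m n) (m n : ℤ) : VermaIdentity f g m n := by
  have h₀ {m n : ℤ} (hm : 0 ≤ m) (hn : 0 ≤ n) : VermaIdentity f g m n := by
    lift m to ℕ using hm
    lift n to ℕ using hn
    exact h m n
  wlog hm : 0 ≤ m generalizing m n
  · exact of_neg (this _ _ (by omega))
  by_cases c₁ : 0 ≤ n
  · exact h₀ hm c₁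
  apply of_reflect_right
  by_cases c₂ : 0 ≤ m + n
  · exact h₀ c₂ (by omega)
  apply of_reflect_left
  by_cases c₃ : 0 ≤ 3 * (m + n) + -n
  · exact h₀ (by omega) c₃
  apply of_reflect_right
  by_cases c₄ : 0 ≤ -(m + n) + (3 * (m + n) + -n)
  · exact h₀ c₄ (by omega)
  apply of_reflect_left
  by_cases c₅ : 0 ≤ 3 * (-(m + n) + (3 * (m + n) + -n)) + -(3 * (m + n) + -n)
  · exact h₀ (by omega) c₅
  apply of_reflect_right
  exact h₀ (by omega) (by omega)

end VermaIdentity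

lemma QSerreG2.vermaIdentity {K A : Type*} [Field K] [Ring A] [Algebra K A] {q : K} (hq : q ≠ 0)
    (hq₁ : ∀ k : ℤ, q ^ k = 1 → k = 0) {f g : Aˣ} (h : QSerreG2 q (f : A) (g : A)) (m n : ℤ) :
    VermaIdentity f g m n := by
  refine VermaIdentity.of_nat (fun m n => ?_) m n
  have := h.vermaLeft_eq hq hq₁ m n
  simp only [vermaLeft, vermaRight, ← zpow_natCast, ← mul_assoc] at this
  exact_mod_cast this

lemma RatFunc.X_zpow_eq_one {K : Type*} [Field K] {k : ℤ} (h : (RatFunc.X : RatFunc K) ^ k = 1) :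
    k = 0 := by
  have key (j : ℕ) (hj : (RatFunc.X : RatFunc K) ^ j = 1) : j = 0 := by
    rw [← RatFunc.algebraMap_X, ← map_pow, ← map_one (algebraMap (Polynomial K) (RatFunc K))] at hj
    simpa using congrArg Polynomial.natDegree (RatFunc.algebraMap_injective K hj)
  obtain ⟨j, rfl | rfl⟩ := k.eq_nat_or_neg
  · exact_mod_cast key j (by exact_mod_cast h)
  · rw [zpow_neg, inv_eq_one] at h
    simpa using key j (by exact_mod_cast h)

/-- Quantum Verma identity for the rank-2 GCM with `a₁₂ = -1`, `a₂₁ = -3`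
(symmetrized by `d₁ = 3`, `d₂ = 1`), over the field `F = ℚ(q)`. -/
theorem quantum_verma_identity_G2 (R : Type*) [Ring R] [Algebra (RatFunc ℚ) R] (f g : Rˣ)
    (q : RatFunc ℚ) (hq : q = RatFunc.X)
    (hf : (f : R) ^ 2 * (g : R)
        - (q ^ (3 : ℤ) + q ^ (-3 : ℤ)) • ((f : R) * (g : R) * (f : R))
        + (g : R) * (f : R) ^ 2 = 0)
    (hg : (g : R) ^ 4 * (f : R)
        - (q ^ (3 : ℤ) + q + q ^ (-1 : ℤ) + q ^ (-3 : ℤ)) • ((g : R) ^ 3 * (f : R) * (g : R))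
        + ((q ^ (2 : ℤ) + q ^ (-2 : ℤ)) * (q ^ (2 : ℤ) + 1 + q ^ (-2 : ℤ))) •
            ((g : R) ^ 2 * (f : R) * (g : R) ^ 2)
        - (q ^ (3 : ℤ) + q + q ^ (-1 : ℤ) + q ^ (-3 : ℤ)) • ((g : R) * (f : R) * (g : R) ^ 3)
        + (f : R) * (g : R) ^ 4 = 0)
    (m n : ℤ) :
    f ^ m * g ^ (3 * m + n) * f ^ (2 * m + n) * g ^ (3 * m + 2 * n) * f ^ (m + n) * g ^ n
      = g ^ n * f ^ (m + n) * g ^ (3 * m + 2 * n) * f ^ (2 * m + n) * g ^ (3 * m + n) * f ^ m := by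
  subst hq
  exact QSerreG2.vermaIdentity RatFunc.X_ne_zero (fun _ => RatFunc.X_zpow_eq_one) ⟨hf, hg⟩ m n
end

section
/- Let R be a commutative ring and let D : R[X] → R[X] be formal differentiation of polynomials. Then for all natural numbers a, b and every polynomial p ∈ R[X] one has the Verma identity in the Weyl algebra: X^a · D^{a+b}(X^b · p) = D^{b}(X^{a+b} · D^{a}(p)), where D^k denotes the k-fold iterate of D and X^c · q denotes multiplication of the polynomial q by X^c. -/
open Polynomial

/-- Verma identity in the Weyl algebra:
`X^a ∘ D^(a+b) ∘ X^b = D^b ∘ X^(a+b) ∘ D^a` as operators on `R[X]`. -/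
theorem weyl_verma_identity (R : Type*) [CommRing R] (a b : ℕ) (p : R[X]) :
    X ^ a * (fun q : R[X] => derivative q)^[a + b] (X ^ b * p)
      = (fun q : R[X] => derivative q)^[b]
          (X ^ (a + b) * (fun q : R[X] => derivative q)^[a] p) := by
  change X ^ a * derivative^[a + b] (X ^ b * p)
    = derivative^[b] (X ^ (a + b) * derivative^[a] p)
  induction p using Polynomial.induction_on' with
  | add p q hp hq => simp only [mul_add, iterate_map_add, hp, hq]
  | monomial n c =>
    rw [← C_mul_X_pow_eq_monomial, mul_left_comm, ← pow_add, iterate_derivative_C_mul,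
      iterate_derivative_C_mul, mul_left_comm, mul_left_comm (X ^ (a + b)),
      iterate_derivative_C_mul]
    congr 1
    rw [iterate_derivative_X_pow_eq_natCast_mul, iterate_derivative_X_pow_eq_natCast_mul,
      mul_left_comm, mul_left_comm (X ^ (a + b)), iterate_derivative_natCast_mul, ← pow_add,
      ← pow_add, iterate_derivative_X_pow_eq_natCast_mul]
    rcases lt_or_ge n a with h | h
    · rw [Nat.descFactorial_of_lt h, Nat.descFactorial_of_lt (by lia : b + n < a + b)]
      simp
    · have hd := Nat.descFactorial_mul_descFactorial (n := b + n) (Nat.le_add_left b a)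
      rw [Nat.add_sub_cancel_left, Nat.add_sub_cancel] at hd
      rw [← hd, show a + b + (n - a) = b + n by lia, show a + (b + n - (a + b)) = n by lia,
        Nat.add_sub_cancel_left, Nat.cast_mul, mul_assoc]
end

section
/- Let R be an associative unital ring with no nonzero zero divisors and let f ∈ R, f ≠ 0, be such that ad f is locally nilpotent on R, i.e. for every a ∈ R there exists N ∈ ℕ with (ad f)^N(a) = 0. Then the multiplicative set {f^n : n ∈ ℕ} is a left and right Ore set in R: for every a ∈ R and every n ∈ ℕ there exist m ∈ ℕ and b ∈ R with f^m · a = b · f^n, and there exist l ∈ ℕ and c ∈ R with a · f^l = f^n · c. -/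
theorem exists_pow_add_mul_eq_mul_pow_of_iterate_ad_eq_zero {R : Type*} [Ring R] (f : R) (N : ℕ) :
    ∀ (n : ℕ) (a : R), (fun x => f * x - x * f)^[N] a = 0 →
      ∃ b : R, f ^ (N + n) * a = b * f ^ n := by
  induction N with
  | zero => exact fun n a h => ⟨0, by simp_all⟩
  | succ N ihN =>
    intro n
    induction n with
    | zero => exact fun a _ => ⟨f ^ (N + 1) * a, by simp⟩
    | succ n ihn =>
      intro a h
      obtain ⟨b, hb⟩ := ihn a h
      obtain ⟨c, hc⟩ := ihN (n + 1) (f * a - a * f) h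
      rw [show N + (n + 1) = N + 1 + n by omega] at hc
      refine ⟨b + c, ?_⟩
      calc f ^ (N + 1 + (n + 1)) * a
          = f ^ (N + 1 + n) * a * f + f ^ (N + 1 + n) * (f * a - a * f) := by
            rw [← add_assoc, pow_succ]; noncomm_ring
        _ = (b + c) * f ^ (n + 1) := by rw [hb, hc, mul_assoc b, ← pow_succ, add_mul]

theorem exists_mul_pow_add_eq_pow_mul_of_iterate_ad_eq_zero {R : Type*} [Ring R] (f : R) (N : ℕ) :
    ∀ (n : ℕ) (a : R), (fun x => f * x - x * f)^[N] a = 0 →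
      ∃ c : R, a * f ^ (N + n) = f ^ n * c := by
  induction N with
  | zero => exact fun n a h => ⟨0, by simp_all⟩
  | succ N ihN =>
    intro n
    induction n with
    | zero => exact fun a _ => ⟨a * f ^ (N + 1), by simp⟩
    | succ n ihn =>
      intro a h
      obtain ⟨b, hb⟩ := ihn a h
      obtain ⟨c, hc⟩ := ihN (n + 1) (f * a - a * f) h
      rw [show N + (n + 1) = N + 1 + n by omega] at hc
      refine ⟨b - c, ?_⟩
      calc a * f ^ (N + 1 + (n + 1))
          = f * (a * f ^ (N + 1 + n)) - (f * a - a * f) * f ^ (N + 1 + n) := by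
            rw [← add_assoc, pow_succ' f (N + 1 + n), sub_mul]; simp only [mul_assoc]; abel
        _ = f ^ (n + 1) * (b - c) := by rw [hb, hc, ← mul_assoc, ← pow_succ', mul_sub]


/-- If `R` is a domain and `ad f` is locally nilpotent, then the powers of a
nonzero element `f` form a left and right Ore set in `R`. -/
theorem powers_ore_of_locally_nilpotent_ad (R : Type*) [Ring R]
    (hzd : ∀ x y : R, x * y = 0 → x = 0 ∨ y = 0)
    (f : R) (hf : f ≠ 0)
    (hln : ∀ a : R, ∃ N : ℕ, (fun x => f * x - x * f)^[N] a = 0)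
    (a : R) (n : ℕ) :
    (∃ m : ℕ, ∃ b : R, f ^ m * a = b * f ^ n) ∧
    (∃ l : ℕ, ∃ c : R, a * f ^ l = f ^ n * c) := by
  obtain ⟨N, hN⟩ := hln a
  exact ⟨⟨N + n, exists_pow_add_mul_eq_mul_pow_of_iterate_ad_eq_zero f N n a hN⟩,
    ⟨N + n, exists_mul_pow_add_eq_pow_mul_of_iterate_ad_eq_zero f N n a hN⟩⟩
end

section
/- Let R be a commutative ring and a ∈ R. On the polynomial ring R[X] define the R-linear operators f₁(p) = D(p) (the formal derivative), f₂(p) = X·p, and f₀(p) = (X−a)³·p. Then these operators satisfy the Serre relations of the generalized Cartan matrix of type G₂⁽¹⁾ (with a_{12} = a_{21} = −1, a_{10} = −3, a_{01} = −1, a_{02} = a_{20} = 0): [f₁,[f₁,f₂]] = 0, [f₂,[f₂,f₁]] = 0, (ad f₁)⁴(f₀) = 0, [f₀,[f₀,f₁]] = 0, and [f₂,f₀] = 0, where the brackets are commutators of R-linear operators on R[X]. -/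
open Polynomial

/-- Formal differentiation as an `R`-linear endomorphism of `R[X]`. -/
noncomputable def opDerivative (R : Type*) [CommRing R] : Module.End R R[X] :=
  Polynomial.derivative

/-- Multiplication by a fixed polynomial as an `R`-linear endomorphism of `R[X]`. -/
noncomputable def opMulBy (R : Type*) [CommRing R] (u : R[X]) : Module.End R R[X] :=
  LinearMap.mulLeft R u

/-- The commutator of the derivative with multiplication by `u` is multiplication by the
derivative of `u`. -/
theorem opDerivative_commutator_opMulBy (R : Type*) [CommRing R] (u : R[X]) :
    opDerivative R * opMulBy R u - opMulBy R u * opDerivative R =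
      opMulBy R (derivative u) := by
  refine LinearMap.ext fun p => ?_
  simp [opDerivative, opMulBy, derivative_mul]

/-- Multiplication operators commute. -/
theorem opMulBy_commute (R : Type*) [CommRing R] (u v : R[X]) :
    opMulBy R u * opMulBy R v = opMulBy R v * opMulBy R u := by
  refine LinearMap.ext fun p => ?_
  simp [opMulBy, mul_left_comm]

/-- Iterated commutators with the derivative are multiplications by iterated derivatives. -/
theorem iterate_opDerivative_commutator_opMulBy (R : Type*) [CommRing R] (n : ℕ) (u : R[X]) :
    (fun x => opDerivative R * x - x * opDerivative R)^[n] (opMulBy R u) =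
      opMulBy R (derivative^[n] u) := by
  induction n generalizing u with
  | zero => rfl
  | succ n ih => simp only [Function.iterate_succ_apply, opDerivative_commutator_opMulBy, ih]

/-- A multiplication operator commutes with its commutator with the derivative. -/
theorem opMulBy_commutator_commutator_opDerivative (R : Type*) [CommRing R] (u : R[X]) :
    opMulBy R u * (opMulBy R u * opDerivative R - opDerivative R * opMulBy R u) -
      (opMulBy R u * opDerivative R - opDerivative R * opMulBy R u) * opMulBy R u = 0 := by
  refine LinearMap.ext fun p => ?_
  simp only [opDerivative, opMulBy, LinearMap.sub_apply, Module.End.mul_apply,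
    LinearMap.mulLeft_apply, derivative_mul, LinearMap.zero_apply]
  ring

/-- The operators `f₁ = D`, `f₂ = X·`, `f₀ = (X-a)³·` on `R[X]` satisfy the Serre
relations of the GCM of type `G₂⁽¹⁾`. -/
theorem serre_relations_G2_affine (R : Type*) [CommRing R] (a : R)
    (f₁ f₂ f₀ : Module.End R R[X])
    (h1 : f₁ = opDerivative R) (h2 : f₂ = opMulBy R X)
    (h0 : f₀ = opMulBy R ((X - C a) ^ 3)) :
    f₁ * (f₁ * f₂ - f₂ * f₁) - (f₁ * f₂ - f₂ * f₁) * f₁ = 0 ∧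
    f₂ * (f₂ * f₁ - f₁ * f₂) - (f₂ * f₁ - f₁ * f₂) * f₂ = 0 ∧
    (fun x => f₁ * x - x * f₁)^[4] f₀ = 0 ∧
    f₀ * (f₀ * f₁ - f₁ * f₀) - (f₀ * f₁ - f₁ * f₀) * f₀ = 0 ∧
    f₂ * f₀ - f₀ * f₂ = 0 := by
  subst h1 h2 h0
  refine ⟨?_, opMulBy_commutator_commutator_opDerivative R X, ?_,
    opMulBy_commutator_commutator_opDerivative R _, sub_eq_zero.2 (opMulBy_commute R _ _)⟩
  · rw [opDerivative_commutator_opMulBy, opDerivative_commutator_opMulBy]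
    simp [opMulBy]
  · rw [iterate_opDerivative_commutator_opMulBy, iterate_derivative_eq_zero]
    · simp [opMulBy]
    · refine lt_of_le_of_lt (natDegree_pow_le_of_le 3 (natDegree_X_sub_C_le a)) ?_
      norm_num
end

section
/- Let R be an associative unital algebra over ℚ containing elements f₁, f₂, f₃ with f₂ invertible and satisfying [f₁,f₂] = 1, [f₂,f₃] = 1, and [f₁,f₃] = 0. Then for every integer c and all rationals β, γ one has f₂^{−c}·(f₁f₂f₃ + β f₁ + γ f₃)·f₂^{c} = f₁f₂f₃ + (β−c) f₁ + (γ+c) f₃ + c(β−γ−c) f₂^{−1}. In particular, if c = β − γ (an integer), then f₂^{−c}·(f₁f₂f₃ + β f₁ + γ f₃)·f₂^{c} = f₁f₂f₃ + γ f₁ + β f₃. -/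
/-- If `[a, u] = s` commutes with the unit `u`, then conjugating `a` by `u ^ c` adds
`c • (s * u⁻¹)`. -/
theorem zpow_neg_mul_mul_zpow_of_commute {R : Type*} [Ring R] {a s : R} {u : Rˣ}
    (h : a * (u : R) - (u : R) * a = s) (hs : Commute s (u : R)) (c : ℤ) :
    (↑(u ^ (-c)) : R) * a * ↑(u ^ c) = a + c • (s * (↑u⁻¹ : R)) := by
  have hsi : Commute s (↑u⁻¹ : R) := hs.units_inv_right
  have hau : (↑u⁻¹ : R) * a * u = a + s * (↑u⁻¹ : R) := by
    rw [mul_assoc, sub_eq_iff_eq_add.mp h, mul_add, Units.inv_mul_cancel_left, hsi.eq, add_comm]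
  have hau' : (u : R) * a * (↑u⁻¹ : R) = a - s * (↑u⁻¹ : R) := by
    rw [← h, sub_mul, Units.mul_inv_cancel_right, sub_sub_cancel]
  have hu : (↑u⁻¹ : R) * (s * (↑u⁻¹ : R)) * u = s * (↑u⁻¹ : R) := by
    rw [mul_assoc, Units.inv_mul_cancel_right, hsi.eq]
  have hu' : (u : R) * (s * (↑u⁻¹ : R)) * (↑u⁻¹ : R) = s * (↑u⁻¹ : R) := by
    rw [← mul_assoc, ← hs.eq, Units.mul_inv_cancel_right]
  induction c using Int.induction_on with
  | zero => simp
  | succ n ih =>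
    calc (↑(u ^ (-((n : ℤ) + 1))) : R) * a * ↑(u ^ ((n : ℤ) + 1))
        = (↑u⁻¹ : R) * ((↑(u ^ (-(n : ℤ))) : R) * a * ↑(u ^ (n : ℤ))) * u := by
          rw [zpow_add_one, neg_add_rev, zpow_add, zpow_neg_one, Units.val_mul, Units.val_mul]
          simp only [mul_assoc]
      _ = a + ((n : ℤ) + 1) • (s * (↑u⁻¹ : R)) := by
          rw [ih, mul_add, add_mul, hau, mul_smul_comm, smul_mul_assoc, hu, add_smul, one_smul]
          abel
  | pred n ih =>
    calc (↑(u ^ (-(-(n : ℤ) - 1))) : R) * a * ↑(u ^ (-(n : ℤ) - 1))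
        = (u : R) * ((↑(u ^ (-(-(n : ℤ)))) : R) * a * ↑(u ^ (-(n : ℤ)))) * (↑u⁻¹ : R) := by
          rw [zpow_sub_one, neg_sub', sub_neg_eq_add, add_comm, zpow_one_add, Units.val_mul,
            Units.val_mul]
          simp only [mul_assoc]
      _ = a + (-(n : ℤ) - 1) • (s * (↑u⁻¹ : R)) := by
          rw [ih, mul_add, add_mul, hau', mul_smul_comm, smul_mul_assoc, hu', sub_smul, one_smul]
          abel

/-- Conjugation of the tau-cocycle polynomial `f₁f₂f₃ + β f₁ + γ f₃` by powers of `f₂`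
in an algebra with `[f₁,f₂] = 1`, `[f₂,f₃] = 1`, `[f₁,f₃] = 0`. -/
theorem tau_cocycle_conjugation (R : Type*) [Ring R] [Algebra ℚ R]
    (f₁ f₃ : R) (f₂ : Rˣ)
    (h12 : f₁ * (f₂ : R) - (f₂ : R) * f₁ = 1)
    (h23 : (f₂ : R) * f₃ - f₃ * (f₂ : R) = 1)
    (h13 : f₁ * f₃ - f₃ * f₁ = 0)
    (c : ℤ) (β γ : ℚ) :
    (↑(f₂ ^ (-c)) : R) * (f₁ * (f₂ : R) * f₃ + β • f₁ + γ • f₃) * ↑(f₂ ^ c)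
      = f₁ * (f₂ : R) * f₃ + (β - (c : ℚ)) • f₁ + (γ + (c : ℚ)) • f₃
        + ((c : ℚ) * (β - γ - (c : ℚ))) • (↑f₂⁻¹ : R) ∧
    ((c : ℚ) = β - γ →
      (↑(f₂ ^ (-c)) : R) * (f₁ * (f₂ : R) * f₃ + β • f₁ + γ • f₃) * ↑(f₂ ^ c)
        = f₁ * (f₂ : R) * f₃ + γ • f₁ + β • f₃) := by
  have h1 : (↑(f₂ ^ (-c)) : R) * f₁ * ↑(f₂ ^ c) = f₁ + (c : ℚ) • (↑f₂⁻¹ : R) := by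
    rw [zpow_neg_mul_mul_zpow_of_commute h12 (Commute.one_left _), one_mul, Int.cast_smul_eq_zsmul]
  have h3 : (↑(f₂ ^ (-c)) : R) * f₃ * ↑(f₂ ^ c) = f₃ - (c : ℚ) • (↑f₂⁻¹ : R) := by
    have h32 : f₃ * (f₂ : R) - (f₂ : R) * f₃ = -1 := by rw [← h23, neg_sub]
    rw [zpow_neg_mul_mul_zpow_of_commute h32 (Commute.one_left _).neg_left, neg_one_mul, smul_neg,
      Int.cast_smul_eq_zsmul, sub_eq_add_neg]
  have h2 : (f₂ : R) * ↑(f₂ ^ c) = ↑(f₂ ^ c) * (f₂ : R) := by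
    rw [← Units.val_mul, ← Units.val_mul, ← zpow_one_add, ← zpow_add_one, add_comm]
  have hc : (↑(f₂ ^ c) : R) * ↑(f₂ ^ (-c)) = 1 := by
    rw [← Units.val_mul, ← zpow_add, add_neg_cancel, zpow_zero, Units.val_one]
  have hprod : (↑(f₂ ^ (-c)) : R) * (f₁ * (f₂ : R) * f₃) * ↑(f₂ ^ c)
      = (↑(f₂ ^ (-c)) * f₁ * ↑(f₂ ^ c)) * f₂ * (↑(f₂ ^ (-c)) * f₃ * ↑(f₂ ^ c)) := by
    calc _ = (↑(f₂ ^ (-c)) : R) * f₁ * (f₂ * (↑(f₂ ^ c) * ↑(f₂ ^ (-c)))) * f₃ * ↑(f₂ ^ c) := by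
          rw [hc, mul_one]; simp only [mul_assoc]
      _ = _ := by rw [← mul_assoc (f₂ : R), h2]; simp only [mul_assoc]
  have key : (↑(f₂ ^ (-c)) : R) * (f₁ * (f₂ : R) * f₃ + β • f₁ + γ • f₃) * ↑(f₂ ^ c)
      = f₁ * (f₂ : R) * f₃ + (β - (c : ℚ)) • f₁ + (γ + (c : ℚ)) • f₃
        + ((c : ℚ) * (β - γ - (c : ℚ))) • (↑f₂⁻¹ : R) := by
    simp only [mul_add, add_mul, mul_smul_comm, smul_mul_assoc, hprod, h1, h3, mul_sub,
      Units.inv_mul, Units.mul_inv_cancel_right, one_mul]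
    module
  refine ⟨key, fun h => ?_⟩
  rw [key, h]
  module
end
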